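/- Let d ≥ 1 and let (p,q) be an admissible pair with q < ∞. Then there exists a constant C > 0 such that for every Schwartz function u₀ on ℝ^d, ‖e^{itΔ²}u₀‖_{L^p(ℝ,L^q)} ≤ C ‖u₀‖_{Ḣ^{γ_{p,q}}}, where the left-hand side is the mixed space-time norm of (t,x) ↦ (e^{itΔ²}u₀)(x). -/

import Mathlib

open MeasureTheory Real Complex
open scoped FourierTransform ENNReal SchwartzMap RealInnerProductSpace

/-- A pair `(p,q)` is admissible if `p,q ∈ [2,∞]`, `(p,q,d) ≠ (2,∞,2)` and
`2/p + d/q ≤ d/2` (with `1/∞ = 0`). -/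
def Admissible (d : ℕ) (p q : ℝ≥0∞) : Prop :=
  2 ≤ p ∧ 2 ≤ q ∧ ¬(p = 2 ∧ q = ∞ ∧ d = 2) ∧
    2 / p + (d : ℝ≥0∞) / q ≤ (d : ℝ≥0∞) / 2

/-- The exponent `γ_{p,q} = d/2 - d/q - 4/p` (with `1/∞ = 0`). -/
noncomputable def gammaExp (d : ℕ) (p q : ℝ≥0∞) : ℝ :=
  (d : ℝ) / 2 - (d : ℝ) / q.toReal - 4 / p.toReal

/-- `L^p`-in-time norm on a set `I` of an `ℝ≥0∞`-valued function, with the usual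
essential supremum convention when `p = ∞`. -/
noncomputable def timeLp (p : ℝ≥0∞) (I : Set ℝ) (g : ℝ → ℝ≥0∞) : ℝ≥0∞ :=
  if p = ∞ then essSup g (MeasureTheory.volume.restrict I)
  else (∫⁻ t in I, g t ^ p.toReal) ^ (1 / p.toReal)

/-- The mixed norm `‖u‖_{L^p(I, L^q)}`. -/
noncomputable def mixedLp {d : ℕ} (p q : ℝ≥0∞) (I : Set ℝ)
    (u : ℝ → EuclideanSpace ℝ (Fin d) → ℂ) : ℝ≥0∞ :=
  timeLp p I fun t => eLpNorm (u t) q MeasureTheory.volume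

/-- The fourth-order Schrödinger propagator
`(e^{itΔ²}u₀)(x) = ∫ e^{2πi x·ξ} e^{it(2π|ξ|)⁴} û₀(ξ) dξ`. -/
noncomputable def prop4 {d : ℕ} (t : ℝ) (u₀ : EuclideanSpace ℝ (Fin d) → ℂ)
    (x : EuclideanSpace ℝ (Fin d)) : ℂ :=
  ∫ ξ : EuclideanSpace ℝ (Fin d),
    Complex.exp (2 * Real.pi * Complex.I * ((⟪x, ξ⟫ : ℝ) : ℂ)) *
      Complex.exp (Complex.I * (t : ℂ) * ((2 * Real.pi * ‖ξ‖ : ℝ) : ℂ) ^ 4) * 𝓕 u₀ ξ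

/-- The homogeneous Sobolev norm `‖f‖_{Ḣ^γ}`, valued in `[0,∞]`. -/
noncomputable def homSobNorm {d : ℕ} (γ : ℝ) (f : EuclideanSpace ℝ (Fin d) → ℂ) : ℝ≥0∞ :=
  (∫⁻ ξ : EuclideanSpace ℝ (Fin d),
      (‖ξ‖₊ : ℝ≥0∞) ^ (2 * γ) * (‖𝓕 f ξ‖₊ : ℝ≥0∞) ^ (2 : ℝ)) ^ ((1 : ℝ) / 2)


/-- Euclidean space. -/
abbrev Eu (d : ℕ) := EuclideanSpace ℝ (Fin d)

/-- Amplitudes depending on parameters `(e, l)`, supported in an annulus. -/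
def AmpClass {d : ℕ} (a : Eu d × Eu d × ℝ → ℝ) : Prop :=
  ContDiff ℝ (⊤ : ℕ∞) a ∧ ∀ z, a z ≠ 0 → 1 / 4 ≤ ‖z.1‖ ∧ ‖z.1‖ ≤ 4

/-- The (normalized) derivative of the phase. -/
noncomputable def Qf {d : ℕ} (z : Eu d × Eu d × ℝ) : ℝ :=
  2 * ⟪z.1, z.2.1⟫ ^ 2 + 3 * ⟪z.1, z.2.1⟫ * z.2.2 + z.2.2 ^ 2 + ‖z.1‖ ^ 2 * (1 + ‖z.2.1‖ ^ 2) / 2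

/-- The integration by parts operator. -/
noncomputable def Lop {d : ℕ} (a : Eu d × Eu d × ℝ → ℝ) (z : Eu d × Eu d × ℝ) : ℝ :=
  fderiv ℝ (fun w => a w / Qf w) z (z.2.1, 0, 0)

lemma Qf_pos {d : ℕ} (z : Eu d × Eu d × ℝ) (hz : z.1 ≠ 0) : 0 < Qf z := by
  unfold Qf
  have h1 : |⟪z.1, z.2.1⟫| ≤ ‖z.1‖ * ‖z.2.1‖ := abs_real_inner_le_norm _ _
  have h2 : ⟪z.1, z.2.1⟫ ^ 2 ≤ (‖z.1‖ * ‖z.2.1‖) ^ 2 := by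
    rw [← sq_abs]; gcongr
  have h3 : 0 < ‖z.1‖ ^ 2 := by positivity
  generalize ⟪z.1, z.2.1⟫ = r at *
  nlinarith [sq_nonneg (z.2.2 + 3 / 2 * r), mul_nonneg h3.le (sq_nonneg ‖z.2.1‖)]

lemma Qf_contDiff {d : ℕ} : ContDiff ℝ (⊤ : ℕ∞) (Qf (d := d)) := by
  unfold Qf
  have h1 : ContDiff ℝ (⊤ : ℕ∞) (fun z : Eu d × Eu d × ℝ => ⟪z.1, z.2.1⟫) :=
    contDiff_fst.inner ℝ (contDiff_fst.comp contDiff_snd)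
  have h2 : ContDiff ℝ (⊤ : ℕ∞) (fun z : Eu d × Eu d × ℝ => ‖z.1‖ ^ 2) := contDiff_fst.norm_sq ℝ
  have h3 : ContDiff ℝ (⊤ : ℕ∞) (fun z : Eu d × Eu d × ℝ => ‖z.2.1‖ ^ 2) :=
    (contDiff_fst.comp contDiff_snd).norm_sq ℝ
  have h4 : ContDiff ℝ (⊤ : ℕ∞) (fun z : Eu d × Eu d × ℝ => z.2.2) :=
    (contDiff_snd.comp contDiff_snd)
  fun_prop

lemma AmpClass.div {d : ℕ} {a : Eu d × Eu d × ℝ → ℝ} (ha : AmpClass a) :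
    AmpClass (fun w => a w / Qf w) := by
  refine ⟨?_, fun z hz => ha.2 z (fun h => hz (by simp [h]))⟩
  rw [contDiff_iff_contDiffAt]
  intro z
  by_cases hz : z.1 = 0
  · have : (fun w => a w / Qf w) =ᶠ[nhds z] fun _ => 0 := by
      have : ∀ᶠ w in nhds z, ‖w.1‖ < 1 / 4 := by
        apply (continuous_fst.norm.tendsto z).eventually_lt_const
        simp [hz]
      filter_upwards [this] with w hw
      have : a w = 0 := by
        by_contra h
        linarith [(ha.2 w h).1]
      simp [this]
    exact contDiffAt_const.congr_of_eventuallyEq this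
  · exact ha.1.contDiffAt.div Qf_contDiff.contDiffAt (Qf_pos z hz).ne'

lemma AmpClass.lop {d : ℕ} {a : Eu d × Eu d × ℝ → ℝ} (ha : AmpClass a) :
    AmpClass (Lop a) := by
  have hb := ha.div
  constructor
  · unfold Lop
    have h1 : ContDiff ℝ (⊤ : ℕ∞) (fderiv ℝ (fun w => a w / Qf w)) :=
      hb.1.fderiv_right (by norm_cast)
    exact h1.clm_apply ((contDiff_fst.comp contDiff_snd).prodMk contDiff_const)
  · intro z hz
    by_contra hcon
    apply hz
    have : (fun w => a w / Qf w) =ᶠ[nhds z] fun _ => 0 := by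
      have h2 : IsOpen {w : Eu d × Eu d × ℝ | ¬ (1 / 4 ≤ ‖w.1‖ ∧ ‖w.1‖ ≤ 4)} := by
        have : IsClosed {w : Eu d × Eu d × ℝ | (1 / 4 ≤ ‖w.1‖ ∧ ‖w.1‖ ≤ 4)} :=
          (isClosed_le continuous_const continuous_fst.norm).inter
            (isClosed_le continuous_fst.norm continuous_const)
        exact this.isOpen_compl
      filter_upwards [h2.mem_nhds hcon] with w hw
      by_contra h
      exact hw (hb.2 w h)
    unfold Lop
    rw [this.fderiv_eq]
    simp

/-- The phase difference. -/
noncomputable def Ph {d : ℕ} (e : Eu d) (l : ℝ) (ξ : Eu d) : ℝ := ‖ξ + l • e‖ ^ 4 - ‖ξ‖ ^ 4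

lemma Ph_cont {d : ℕ} (e : Eu d) (l : ℝ) : Continuous (Ph e l) := by
  unfold Ph; fun_prop

lemma Ph_lineDeriv {d : ℕ} (e : Eu d) (he : ‖e‖ = 1) (l : ℝ) (ξ : Eu d) :
    HasDerivAt (fun t : ℝ => Ph e l (ξ + t • e)) (4 * l * Qf (ξ, e, l)) 0 := by
  have key : ∀ s : ℝ, ‖ξ + s • e‖ ^ 2 = ‖ξ‖ ^ 2 + 2 * s * ⟪ξ, e⟫ + s ^ 2 := by
    intro s
    rw [norm_add_sq_real, inner_smul_right, norm_smul, he]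
    simp; ring
  have h1 : (fun t : ℝ => Ph e l (ξ + t • e)) = fun t : ℝ =>
      (‖ξ‖ ^ 2 + 2 * (t + l) * ⟪ξ, e⟫ + (t + l) ^ 2) ^ 2
        - (‖ξ‖ ^ 2 + 2 * t * ⟪ξ, e⟫ + t ^ 2) ^ 2 := by
    ext t
    rw [← key, ← key]
    unfold Ph
    rw [add_assoc, ← add_smul]
    ring
  rw [h1]
  have hid := hasDerivAt_id (0 : ℝ)
  have h2 := (((((hid.add_const l).const_mul 2).mul_const ⟪ξ, e⟫).const_add (‖ξ‖ ^ 2)).add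
    ((hid.add_const l).pow 2)).pow 2
  have h3 := ((((hid.const_mul 2).mul_const ⟪ξ, e⟫).const_add (‖ξ‖ ^ 2)).add
    (hid.pow 2)).pow 2
  have h4 := h2.sub h3
  refine HasDerivAt.congr_deriv (f := fun t : ℝ =>
      (‖ξ‖ ^ 2 + 2 * (t + l) * ⟪ξ, e⟫ + (t + l) ^ 2) ^ 2
        - (‖ξ‖ ^ 2 + 2 * t * ⟪ξ, e⟫ + t ^ 2) ^ 2) h4 ?_
  simp [Qf, he]
  ring

lemma AmpClass.slice_integrable {d : ℕ} {a : Eu d × Eu d × ℝ → ℝ} (ha : AmpClass a) (e : Eu d)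
    (l : ℝ) (g : Eu d → ℂ) (hg : Continuous g) :
    Integrable (fun ξ => a (ξ, e, l) • g ξ) := by
  apply Continuous.integrable_of_hasCompactSupport
  · have := ha.1.continuous
    fun_prop
  · apply HasCompactSupport.intro (isCompact_closedBall (0 : Eu d) 4)
    intro x hx
    have : a (x, e, l) = 0 := by
      by_contra h
      apply hx
      simpa using (ha.2 _ h).2
    simp [this]

lemma osc_ibp {d : ℕ} {a : Eu d × Eu d × ℝ → ℝ} (ha : AmpClass a) (e : Eu d) (he : ‖e‖ = 1)
    (l τ : ℝ) :
    (τ * (4 * l) : ℝ) * I * ∫ ξ, a (ξ, e, l) • Complex.exp ((τ * Ph e l ξ : ℝ) * I)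
      = - ∫ ξ, Lop a (ξ, e, l) • Complex.exp ((τ * Ph e l ξ : ℝ) * I) := by
  have hPh := Ph_cont e l
  have hb := ha.div
  have main := integral_bilinear_hasLineDerivAt_right_eq_neg_left_of_integrable
    (μ := (volume : Measure (Eu d))) (v := e)
    (B := ContinuousLinearMap.lsmul ℝ ℝ (E := ℂ))
    (f := fun ξ => a (ξ, e, l) / Qf (ξ, e, l)) (f' := fun ξ => Lop a (ξ, e, l))
    (g := fun ξ => Complex.exp ((τ * Ph e l ξ : ℝ) * I))
    (g' := fun ξ => Complex.exp ((τ * Ph e l ξ : ℝ) * I) *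
      ((τ * (4 * l * Qf (ξ, e, l)) : ℝ) * I)) ?_ ?_ ?_ ?_ ?_
  · simp only [ContinuousLinearMap.lsmul_apply] at main
    rw [← main, ← integral_const_mul]
    congr 1
    ext ξ
    by_cases hξ : ξ = 0
    · have : a (ξ, e, l) = 0 := by
        by_contra h
        have := (ha.2 _ h).1
        simp [hξ] at this
        norm_num at this
      simp [this]
    · have hQ := Qf_pos (ξ, e, l) hξ
      have hQ' : (Qf (ξ, e, l) : ℂ) ≠ 0 := by exact_mod_cast hQ.ne'
      simp only [real_smul]
      push_cast
      field_simp
  · exact ha.lop.slice_integrable e l _ (by fun_prop)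
  · have : Continuous (Qf (d := d)) := Qf_contDiff.continuous
    exact hb.slice_integrable e l _ (by fun_prop)
  · exact hb.slice_integrable e l _ (by fun_prop)
  · intro x _
    have h1 : HasFDerivAt (fun w => a w / Qf w) (fderiv ℝ (fun w => a w / Qf w) (x, e, l))
        (x, e, l) := (hb.1.differentiable (by simp) _).hasFDerivAt
    have h2 := (h1.hasLineDerivAt (e, 0, 0))
    unfold HasLineDerivAt at h2 ⊢
    simpa [Lop] using h2
  · intro x _
    have h1 := Ph_lineDeriv e he l x
    unfold HasLineDerivAt
    have h2 := ((h1.const_mul τ).ofReal_comp.mul_const I).cexp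
    simpa using h2

lemma osc_iter {d : ℕ} (n : ℕ) : ∀ {a : Eu d × Eu d × ℝ → ℝ} (_ : AmpClass a), ∃ C : ℝ, ∀ (e : Eu d)
    (_ : ‖e‖ = 1) (l τ : ℝ) (_ : |l| ≤ 16),
    (4 * |τ| * |l|) ^ n * ‖∫ ξ, a (ξ, e, l) • Complex.exp ((τ * Ph e l ξ : ℝ) * I)‖ ≤ C := by
  induction n with
  | zero =>
    intro a ha
    have hK : IsCompact ((Metric.closedBall (0 : Eu d) 4) ×ˢ ((Metric.closedBall (0 : Eu d) 1) ×ˢ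
      (Metric.closedBall (0 : ℝ) 16))) :=
      (isCompact_closedBall _ _).prod ((isCompact_closedBall _ _).prod (isCompact_closedBall _ _))
    obtain ⟨M, hM⟩ := hK.exists_bound_of_continuousOn ha.1.continuous.continuousOn
    refine ⟨M * volume.real (Metric.closedBall (0 : Eu d) 4), fun e he l τ hl => ?_⟩
    simp only [pow_zero, one_mul]
    have : ∫ ξ, a (ξ, e, l) • Complex.exp ((τ * Ph e l ξ : ℝ) * I)
      = ∫ ξ in Metric.closedBall (0 : Eu d) 4,
          a (ξ, e, l) • Complex.exp ((τ * Ph e l ξ : ℝ) * I) := by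
      symm
      apply setIntegral_eq_integral_of_forall_compl_eq_zero
      intro x hx
      have : a (x, e, l) = 0 := by
        by_contra h
        apply hx
        simpa using (ha.2 _ h).2
      simp [this]
    rw [this]
    apply norm_setIntegral_le_of_norm_le_const measure_closedBall_lt_top
    intro ξ hξ
    rw [norm_smul, Complex.norm_exp_ofReal_mul_I, mul_one]
    apply hM
    simp only [Set.mem_prod]
    refine ⟨hξ, by simp [he], by simpa using hl⟩
  | succ n ih =>
    intro a ha
    obtain ⟨C, hC⟩ := ih ha.lop
    refine ⟨C, fun e he l τ hl => ?_⟩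
    have h1 := hC e he l τ hl
    have h2 := congrArg norm (osc_ibp ha e he l τ)
    rw [norm_neg] at h2
    rw [← h2] at h1
    rw [norm_mul, norm_mul, norm_I, mul_one, norm_real, Real.norm_eq_abs, abs_mul, abs_mul] at h1
    calc _ = (4 * |τ| * |l|) ^ n * (|τ| * (|4| * |l|) * ‖∫ ξ, a (ξ, e, l) •
            Complex.exp ((τ * Ph e l ξ : ℝ) * I)‖) := by
          rw [pow_succ, abs_of_pos (by norm_num : (0 : ℝ) < 4)]; ring
      _ ≤ C := h1

/-- the standard bump. -/
noncomputable def chiB (d : ℕ) : ContDiffBump (0 : Eu d) := ⟨1, 2, one_pos, one_lt_two⟩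

/-- A cutoff to an annulus. -/
noncomputable def phiB {d : ℕ} (ξ : Eu d) : ℝ := chiB d ((1 / 2 : ℝ) • ξ) - chiB d ((4 : ℝ) • ξ)

lemma chiB_smooth {d : ℕ} : ContDiff ℝ (⊤ : ℕ∞) (chiB d) := (chiB d).contDiff

lemma chiB_one {d : ℕ} {ξ : Eu d} (h : ‖ξ‖ ≤ 1) : chiB d ξ = 1 :=
  (chiB d).one_of_mem_closedBall (by simpa [chiB] using h)

lemma chiB_zero {d : ℕ} {ξ : Eu d} (h : 2 ≤ ‖ξ‖) : chiB d ξ = 0 :=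
  (chiB d).zero_of_le_dist (by simpa [chiB] using h)

lemma phiB_smooth {d : ℕ} : ContDiff ℝ (⊤ : ℕ∞) (phiB (d := d)) := by
  unfold phiB
  exact (chiB_smooth.comp (contDiff_const_smul _)).sub (chiB_smooth.comp (contDiff_const_smul _))

lemma phiB_supp {d : ℕ} {ξ : Eu d} (h : phiB ξ ≠ 0) : 1 / 4 ≤ ‖ξ‖ ∧ ‖ξ‖ ≤ 4 := by
  constructor
  · by_contra hc
    push Not at hc
    apply h
    unfold phiB
    rw [chiB_one, chiB_one, sub_self]
    · rw [norm_smul]; norm_num; linarith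
    · rw [norm_smul]; norm_num; linarith
  · by_contra hc
    push Not at hc
    apply h
    unfold phiB
    rw [chiB_zero, chiB_zero, sub_self]
    · rw [norm_smul]; norm_num; linarith
    · rw [norm_smul]; norm_num; linarith

lemma phiB_nonneg {d : ℕ} (ξ : Eu d) : 0 ≤ phiB ξ := by
  unfold phiB
  by_cases h : 1 / 2 ≤ ‖ξ‖
  · rw [chiB_zero (ξ := (4 : ℝ) • ξ)]
    · simpa using (chiB d).nonneg
    · rw [norm_smul]; norm_num; linarith
  · rw [chiB_one (ξ := (1 / 2 : ℝ) • ξ)]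
    · simpa using (chiB d).le_one
    · rw [norm_smul]; norm_num; push Not at h; linarith

lemma phiB_le_one {d : ℕ} (ξ : Eu d) : phiB ξ ≤ 1 := by
  unfold phiB
  have h1 : chiB d ((1 / 2 : ℝ) • ξ) ≤ 1 := (chiB d).le_one
  have h2 : 0 ≤ chiB d ((4 : ℝ) • ξ) := (chiB d).nonneg
  linarith

lemma phiB_one {d : ℕ} {ξ : Eu d} (h1 : 1 / 2 ≤ ‖ξ‖) (h2 : ‖ξ‖ ≤ 2) : phiB ξ = 1 := by
  unfold phiB
  rw [chiB_zero (ξ := (4 : ℝ) • ξ), chiB_one]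
  · simp
  · rw [norm_smul]; norm_num; linarith
  · rw [norm_smul]; norm_num; linarith

lemma phiB_hcs {d : ℕ} : HasCompactSupport (phiB (d := d)) := by
  apply HasCompactSupport.intro (isCompact_closedBall (0 : Eu d) 4)
  intro x hx
  by_contra h
  apply hx
  simpa using (phiB_supp h).2

lemma phi_amp {d : ℕ} : AmpClass (fun z : Eu d × Eu d × ℝ => phiB z.1 * phiB (z.1 + z.2.2 • z.2.1)) := by
  constructor
  · have h1 : ContDiff ℝ (⊤ : ℕ∞) (fun z : Eu d × Eu d × ℝ => z.1 + z.2.2 • z.2.1) :=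
      contDiff_fst.add ((contDiff_snd.comp contDiff_snd).smul (contDiff_fst.comp contDiff_snd))
    exact (phiB_smooth.comp contDiff_fst).mul (phiB_smooth.comp h1)
  · intro z hz
    exact phiB_supp (left_ne_zero_of_mul hz)

/-- The phase. -/
noncomputable def thetaP {d : ℕ} (t : ℝ) (x ξ : Eu d) : ℝ :=
  2 * π * ⟪x, ξ⟫ + t * (2 * π * ‖ξ‖) ^ 4

lemma thetaP_cont {d : ℕ} (t : ℝ) (x : Eu d) : Continuous (thetaP t x) := by
  unfold thetaP; fun_prop

/-- The frequency localized kernel. -/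
noncomputable def Kd {d : ℕ} (t : ℝ) (x : Eu d) : ℂ :=
  ∫ ξ : Eu d, Complex.exp ((thetaP t x ξ : ℝ) * I) * (phiB ξ : ℂ)

lemma phi_osc {d : ℕ} : ∃ C : ℝ, 0 ≤ C ∧ ∀ (h : Eu d) (τ : ℝ),
    ‖∫ ξ : Eu d, (phiB ξ * phiB (ξ + h)) • Complex.exp ((τ * (‖ξ + h‖ ^ 4 - ‖ξ‖ ^ 4) : ℝ) * I)‖
      ≤ C * (1 + ‖τ • h‖) ^ (-(d + 1 : ℝ)) := by
  obtain ⟨C0, hC0⟩ := osc_iter 0 (phi_amp (d := d))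
  obtain ⟨C1, hC1⟩ := osc_iter (d + 1) (phi_amp (d := d))
  -- bound for the trivial direction
  have int0 : ∀ (h : Eu d) (τ : ℝ), ‖∫ ξ : Eu d, (phiB ξ * phiB (ξ + h)) • Complex.exp
      ((τ * (‖ξ + h‖ ^ 4 - ‖ξ‖ ^ 4) : ℝ) * I)‖ ≤ ∫ ξ : Eu d, phiB ξ := by
    intro h τ
    apply norm_integral_le_of_norm_le
    · exact phiB_smooth.continuous.integrable_of_hasCompactSupport phiB_hcs
    · refine Filter.Eventually.of_forall fun ξ => ?_
      rw [norm_smul, Complex.norm_exp_ofReal_mul_I, mul_one, Real.norm_eq_abs,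
        abs_of_nonneg (mul_nonneg (phiB_nonneg _) (phiB_nonneg _))]
      exact mul_le_of_le_one_right (phiB_nonneg _) (phiB_le_one _)
  set A := ∫ ξ : Eu d, phiB ξ with hA
  have hA0 : 0 ≤ A := integral_nonneg fun ξ => phiB_nonneg ξ
  set D := max C1 0 with hD
  have hD0 : 0 ≤ D := le_max_right _ _
  have key : ∀ (h : Eu d) (τ : ℝ), (‖τ • h‖) ^ (d + 1) * ‖∫ ξ : Eu d, (phiB ξ * phiB (ξ + h)) •
      Complex.exp ((τ * (‖ξ + h‖ ^ 4 - ‖ξ‖ ^ 4) : ℝ) * I)‖ ≤ D := by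
    intro h τ
    by_cases h0 : h = 0
    · simp [h0, hD0]
    by_cases h16 : ‖h‖ ≤ 16
    · have hn : ‖h‖ ≠ 0 := by simpa using h0
      have := hC1 ((1 / ‖h‖) • h) (by rw [norm_smul]; simp [hn]) ‖h‖ τ (by simpa using h16)
      have e1 : ‖h‖ • ((1 / ‖h‖) • h) = h := by
        rw [smul_smul]; field_simp; simp
      simp only [Ph, e1] at this
      have h3 : ‖τ • h‖ ^ (d + 1) ≤ (4 * |τ| * |‖h‖|) ^ (d + 1) := by
        gcongr
        rw [norm_smul, abs_norm, Real.norm_eq_abs, mul_assoc]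
        nlinarith [mul_nonneg (abs_nonneg τ) (norm_nonneg h)]
      calc _ ≤ _ := mul_le_mul_of_nonneg_right h3 (norm_nonneg _)
        _ ≤ C1 := this
        _ ≤ D := le_max_left _ _
    · have : ∀ ξ : Eu d, phiB ξ * phiB (ξ + h) = 0 := by
        intro ξ
        by_contra hc
        have h1 := (phiB_supp (left_ne_zero_of_mul hc)).2
        have h2 := (phiB_supp (right_ne_zero_of_mul hc)).2
        have h3 : ‖h‖ ≤ ‖ξ + h‖ + ‖ξ‖ := by
          calc ‖h‖ = ‖(ξ + h) - ξ‖ := by simp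
            _ ≤ _ := norm_sub_le _ _
        linarith
      simp [this, hD0]
  refine ⟨2 ^ (d + 1) * (A + D), by positivity, fun h τ => ?_⟩
  have hpos : 0 < 1 + ‖τ • h‖ := by positivity
  rw [Real.rpow_neg hpos.le, ← div_eq_mul_inv, le_div_iff₀ (by positivity)]
  have e2 : (1 + ‖τ • h‖) ^ (d + 1 : ℝ) = (1 + ‖τ • h‖) ^ (d + 1) := by
    rw [← Real.rpow_natCast]; simp
  rw [e2]
  set X := ‖∫ ξ : Eu d, (phiB ξ * phiB (ξ + h)) •
      Complex.exp ((τ * (‖ξ + h‖ ^ 4 - ‖ξ‖ ^ 4) : ℝ) * I)‖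
  have h5 : (1 + ‖τ • h‖) ^ (d + 1) ≤ 2 ^ (d + 1) * (1 + ‖τ • h‖ ^ (d + 1)) := by
    have : 1 + ‖τ • h‖ ≤ 2 * max 1 ‖τ • h‖ := by
      have := le_max_left 1 ‖τ • h‖
      have := le_max_right 1 ‖τ • h‖
      linarith
    calc _ ≤ (2 * max 1 ‖τ • h‖) ^ (d + 1) := by gcongr
      _ = 2 ^ (d + 1) * (max 1 ‖τ • h‖) ^ (d + 1) := by rw [mul_pow]
      _ ≤ _ := by
        gcongr
        rcases max_cases 1 ‖τ • h‖ with ⟨h, _⟩ | ⟨h, _⟩ <;> rw [h]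
        · simp
        · simp
  calc X * (1 + ‖τ • h‖) ^ (d + 1) ≤ X * (2 ^ (d + 1) * (1 + ‖τ • h‖ ^ (d + 1))) := by
        gcongr
    _ = 2 ^ (d + 1) * (X + ‖τ • h‖ ^ (d + 1) * X) := by ring
    _ ≤ _ := by
      gcongr
      · exact int0 h τ
      · exact key h τ

lemma Kd_sq {d : ℕ} (t : ℝ) (x : Eu d) : ‖Kd t x‖ ^ 2 ≤ ∫ h : Eu d, ‖∫ ξ : Eu d,
    (phiB ξ * phiB (ξ + h)) •
      Complex.exp (((t * (2 * π) ^ 4) * (‖ξ + h‖ ^ 4 - ‖ξ‖ ^ 4) : ℝ) * I)‖ := by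
  set f : Eu d → ℂ := fun ξ => Complex.exp ((thetaP t x ξ : ℝ) * I) * (phiB ξ : ℂ) with hf
  have hfc : Continuous f := by
    have := thetaP_cont t x
    have := (phiB_smooth (d := d)).continuous
    fun_prop
  have hint : Integrable (Function.uncurry fun (η h : Eu d) => f (η + h) * (starRingEnd ℂ) (f η))
      (volume.prod volume) := by
    apply Continuous.integrable_of_hasCompactSupport
    · unfold Function.uncurry
      fun_prop
    · apply HasCompactSupport.intro ((isCompact_closedBall (0 : Eu d) 4).prod
        (isCompact_closedBall (0 : Eu d) 8))
      rintro ⟨η, h⟩ hx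
      by_contra hc
      apply hx
      simp only [Function.uncurry, hf] at hc
      have h1 := (phiB_supp (ξ := η) (by rintro h; simp [h] at hc)).2
      have h2 := (phiB_supp (ξ := η + h) (by rintro h; simp [h] at hc)).2
      have h3 : ‖h‖ ≤ ‖η + h‖ + ‖η‖ := by
        calc ‖h‖ = ‖(η + h) - η‖ := by simp
          _ ≤ _ := norm_sub_le _ _
      simp
      exact ⟨h1, by linarith⟩
  have e1 : Kd t x * (starRingEnd ℂ) (Kd t x) = ∫ h : Eu d, ∫ η : Eu d,
      f (η + h) * (starRingEnd ℂ) (f η) := by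
    rw [← integral_integral_swap hint]
    have : ∀ η : Eu d, ∫ h : Eu d, f (η + h) * (starRingEnd ℂ) (f η) =
        Kd t x * (starRingEnd ℂ) (f η) := by
      intro η
      rw [integral_mul_const, integral_add_left_eq_self f]
      rfl
    simp_rw [this]
    rw [integral_const_mul, integral_conj]
    rfl
  have e2 : ‖Kd t x‖ ^ 2 = ‖Kd t x * (starRingEnd ℂ) (Kd t x)‖ := by
    rw [norm_mul, RCLike.norm_conj, sq]
  rw [e2, e1]
  refine (norm_integral_le_integral_norm _).trans (le_of_eq ?_)
  congr 1
  ext h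
  have : ∀ η : Eu d, f (η + h) * (starRingEnd ℂ) (f η) = Complex.exp ((2 * π * ⟪x, h⟫ : ℝ) * I) *
      ((phiB η * phiB (η + h)) •
      Complex.exp (((t * (2 * π) ^ 4) * (‖η + h‖ ^ 4 - ‖η‖ ^ 4) : ℝ) * I)) := by
    intro η
    simp only [hf, map_mul, conj_ofReal, ← Complex.exp_conj, conj_I, real_smul]
    have : Complex.exp (↑(thetaP t x (η + h)) * I) * Complex.exp (↑(thetaP t x η) * -I) =
      Complex.exp ((2 * π * ⟪x, h⟫ : ℝ) * I) *
      Complex.exp (((t * (2 * π) ^ 4) * (‖η + h‖ ^ 4 - ‖η‖ ^ 4) : ℝ) * I) := by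
      rw [← Complex.exp_add, ← Complex.exp_add]
      congr 1
      simp only [thetaP, inner_add_right]
      push_cast
      ring
    push_cast at this ⊢
    linear_combination (phiB η : ℂ) * (phiB (η + h) : ℂ) * this
  simp_rw [this]
  rw [integral_const_mul, norm_mul, Complex.norm_exp_ofReal_mul_I, one_mul]

lemma Kd_bound {d : ℕ} (t : ℝ) (x : Eu d) : ‖Kd t x‖ ≤ ∫ ξ : Eu d, phiB ξ := by
  unfold Kd
  apply norm_integral_le_of_norm_le
  · exact phiB_smooth.continuous.integrable_of_hasCompactSupport phiB_hcs
  · refine Filter.Eventually.of_forall fun ξ => ?_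
    rw [norm_mul, Complex.norm_exp_ofReal_mul_I, one_mul, norm_real, Real.norm_eq_abs,
        abs_of_nonneg (phiB_nonneg _)]

/-- The dispersive estimate. -/
theorem dispersive {d : ℕ} : ∃ C : ℝ, 0 < C ∧ (∀ (t : ℝ) (x : Eu d), ‖Kd t x‖ ≤ C) ∧
    ∀ (σ : ℝ), 0 ≤ σ → σ ≤ d / 2 → ∀ (t : ℝ) (x : Eu d), t ≠ 0 → ‖Kd t x‖ ≤ C * |t| ^ (-σ) := by
  obtain ⟨C, hC0, hC⟩ := phi_osc (d := d)
  set A := ∫ ξ : Eu d, phiB ξ with hA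
  have hA0 : 0 ≤ A := integral_nonneg fun ξ => phiB_nonneg ξ
  have hint : Integrable (fun h : Eu d => (1 + ‖h‖) ^ (-(d + 1 : ℝ))) :=
    integrable_one_add_norm (by simp)
  set B := ∫ h : Eu d, (1 + ‖h‖) ^ (-(d + 1 : ℝ)) with hB
  have hB0 : 0 ≤ B := integral_nonneg fun ξ => by positivity
  have main : ∀ (t : ℝ) (x : Eu d), t ≠ 0 → ‖Kd t x‖ ^ 2 ≤ C * B * |t| ^ (-(d : ℝ)) := by
    intro t x ht
    set τ := t * (2 * π) ^ 4 with hτ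
    have hτ0 : τ ≠ 0 := by positivity
    calc ‖Kd t x‖ ^ 2 ≤ _ := Kd_sq t x
      _ ≤ ∫ h : Eu d, C * (1 + ‖τ • h‖) ^ (-(d + 1 : ℝ)) := by
        apply integral_mono_of_nonneg
        · exact Filter.Eventually.of_forall fun h => norm_nonneg _
        · exact (hint.comp_smul hτ0).const_mul C
        · exact Filter.Eventually.of_forall fun h => hC h τ
      _ = C * (|τ| ^ (-(d : ℝ)) * B) := by
        rw [integral_const_mul, Measure.integral_comp_smul volume
          (fun h : Eu d => (1 + ‖h‖) ^ (-(d + 1 : ℝ)))]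
        rw [smul_eq_mul, finrank_euclideanSpace_fin, abs_inv, abs_pow,
          Real.rpow_neg (abs_nonneg _), Real.rpow_natCast]
      _ ≤ C * (|t| ^ (-(d : ℝ)) * B) := by
        refine mul_le_mul_of_nonneg_left (mul_le_mul_of_nonneg_right ?_ hB0) hC0
        apply Real.rpow_le_rpow_of_nonpos (by positivity)
        · rw [hτ, abs_mul]
          apply le_mul_of_one_le_right (abs_nonneg _)
          rw [abs_of_nonneg (by positivity)]
          apply one_le_pow₀
          linarith [Real.pi_gt_three]
        · simp
      _ = _ := by ring
  set M := A + C * B + 1 with hM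
  have hCB : 0 ≤ C * B := by positivity
  have hM1 : 1 ≤ M := by linarith
  refine ⟨M, by linarith, fun t x => (Kd_bound t x).trans (by linarith), ?_⟩
  intro σ h0 h1 t x ht
  have ht' : 0 < |t| := by positivity
  by_cases h : 1 ≤ |t|
  · have h2 : ‖Kd t x‖ ^ 2 ≤ (M * |t| ^ (-σ)) ^ 2 := by
      calc _ ≤ _ := main t x ht
        _ ≤ M ^ 2 * |t| ^ (-(2 * σ)) := by
          have : C * B ≤ M ^ 2 := by nlinarith
          have h3 : |t| ^ (-(d : ℝ)) ≤ |t| ^ (-(2 * σ)) := by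
            apply Real.rpow_le_rpow_of_exponent_le h
            linarith
          gcongr
        _ = _ := by
          rw [mul_pow, ← Real.rpow_natCast (|t| ^ (-σ)), ← Real.rpow_mul ht'.le]
          congr 2
          push_cast; ring
    exact abs_le_of_sq_le_sq' h2 (by positivity) |>.2
  · push Not at h
    have : 1 ≤ |t| ^ (-σ) := by
      apply Real.one_le_rpow_of_pos_of_le_one_of_nonpos ht' h.le (by linarith)
    calc _ ≤ M := (Kd_bound t x).trans (by linarith)
      _ ≤ _ := le_mul_of_one_le_right (by linarith) this

/-- The time shell around `t`. -/
def JS (t R : ℝ) : Set ℝ := {s | R ≤ |s - t| ∧ |s - t| < 2 * R}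

lemma JS_meas (t R : ℝ) : MeasurableSet (JS t R) := by
  unfold JS
  refine (measurableSet_le (f := fun _ : ℝ => R) (g := fun s => |s - t|) ?_ ?_).inter
    (measurableSet_lt (f := fun s : ℝ => |s - t|) (g := fun _ => 2 * R) ?_ ?_) <;> fun_prop

lemma JS_symm {t s R : ℝ} : s ∈ JS t R ↔ t ∈ JS s R := by
  unfold JS; simp only [Set.mem_ofPred_eq]; rw [abs_sub_comm]

lemma JS_vol (t R : ℝ) : volume (JS t R) ≤ ENNReal.ofReal (4 * R) := by
  have : JS t R ⊆ Set.Icc (t - 2 * R) (t + 2 * R) := by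
    intro s hs
    have := abs_lt.1 hs.2
    constructor <;> linarith [this.1, this.2]
  refine (measure_mono this).trans ?_
  rw [Real.volume_Icc]; apply ENNReal.ofReal_le_ofReal; linarith

lemma time_H1 {p p' : ℝ} (h : p'.HolderConjugate p) {c : ℝ → ℝ≥0∞} (hc : Measurable c)
    {J : Set ℝ} {V : ℝ≥0∞} (hV : volume J ≤ V) :
    ∫⁻ s in J, c s ≤ V ^ (1 / p) * (∫⁻ s in J, c s ^ p') ^ (1 / p') := by
  have h1 := ENNReal.lintegral_mul_le_Lp_mul_Lq (volume.restrict J) h (f := c) (g := fun _ => 1)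
    hc.aemeasurable (by fun_prop)
  simp only [Pi.mul_apply, mul_one, ENNReal.one_rpow, lintegral_const, one_mul,
    Measure.restrict_apply_univ] at h1
  rw [mul_comm]
  refine h1.trans ?_
  gcongr
  exact h.symm.one_div_nonneg

lemma JS_meas2 (R : ℝ) : MeasurableSet {z : ℝ × ℝ | z.2 ∈ JS z.1 R} := by
  unfold JS
  refine (measurableSet_le (f := fun _ : ℝ × ℝ => R) (g := fun z => |z.2 - z.1|) ?_ ?_).inter
    (measurableSet_lt (f := fun z : ℝ × ℝ => |z.2 - z.1|) (g := fun _ => 2 * R) ?_ ?_) <;> fun_prop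

lemma lint_JS_eq (f : ℝ → ℝ≥0∞) (t R : ℝ) :
    ∫⁻ s in JS t R, f s = ∫⁻ s, {z : ℝ × ℝ | z.2 ∈ JS z.1 R}.indicator (fun z => f z.2) (t, s) := by
  rw [← lintegral_indicator (JS_meas t R)]
  rfl

lemma lint_JS_meas {f : ℝ → ℝ≥0∞} (hf : Measurable f) (R : ℝ) :
    Measurable fun t => ∫⁻ s in JS t R, f s := by
  simp_rw [lint_JS_eq]
  exact Measurable.lintegral_prod_right' ((hf.comp measurable_snd).indicator (JS_meas2 R))

lemma lint_lint_JS {f : ℝ → ℝ≥0∞} (hf : Measurable f) (R : ℝ) :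
    ∫⁻ t, ∫⁻ s in JS t R, f s ≤ ENNReal.ofReal (4 * R) * ∫⁻ s, f s := by
  simp_rw [lint_JS_eq]
  rw [lintegral_lintegral_swap (f := fun t s =>
    {z : ℝ × ℝ | z.2 ∈ JS z.1 R}.indicator (fun z => f z.2) (t, s))
    (((hf.comp measurable_snd).indicator (JS_meas2 R)).aemeasurable)]
  rw [← lintegral_const_mul _ hf]
  apply lintegral_mono
  intro s
  have : ∀ t, {z : ℝ × ℝ | z.2 ∈ JS z.1 R}.indicator (fun z => f z.2) (t, s)
      = (JS s R).indicator (fun _ => f s) t := by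
    intro t
    by_cases h : t ∈ JS s R
    · rw [Set.indicator_of_mem h, Set.indicator_of_mem]
      exact JS_symm.1 h
    · rw [Set.indicator_of_notMem h, Set.indicator_of_notMem]
      exact fun h' => h (JS_symm.1 h')
  simp only [this]
  rw [lintegral_indicator_const (JS_meas s R), mul_comm]
  gcongr
  exact JS_vol s R

lemma time_H2 {p p' : ℝ} (h : p'.HolderConjugate p) (hp : 2 ≤ p) {c e : ℝ → ℝ≥0∞}
    (hc : Measurable c) (he : Measurable e) (R : ℝ) :
    ∫⁻ t, (∫⁻ s in JS t R, c s ^ p') ^ (1 / p') * e t ≤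
      ENNReal.ofReal (4 * R) ^ (1 / p) * (∫⁻ s, c s ^ p') ^ (1 / p') *
        (∫⁻ s, e s ^ p') ^ (1 / p') := by
  have hp0 : 0 < p := by linarith
  have hp'0 : 0 < p' := h.pos
  have hp'p : p' ≤ p := by
    have h1 := h.inv_add_inv_eq_one
    have h2 : p⁻¹ ≤ 2⁻¹ := by gcongr
    have h3 : 2⁻¹ ≤ p'⁻¹ := by linarith
    have h4 : p' ≤ 2 := by
      rwa [inv_le_inv₀ (by norm_num) hp'0] at h3
    linarith
  have hcp : Measurable fun s => c s ^ p' := hc.pow_const _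
  have hM := lint_JS_meas hcp R
  have h1 := ENNReal.lintegral_mul_le_Lp_mul_Lq volume h.symm
    (f := fun t => (∫⁻ s in JS t R, c s ^ p') ^ (1 / p')) (g := e)
    (hM.pow_const _).aemeasurable he.aemeasurable
  refine h1.trans ?_
  gcongr
  set N := ∫⁻ s, c s ^ p' with hN
  have key : ∫⁻ t, ((∫⁻ s in JS t R, c s ^ p') ^ (1 / p')) ^ p ≤
      ENNReal.ofReal (4 * R) * N ^ (p / p') := by
    have e1 : p / p' = 1 + (p / p' - 1) := by ring
    have e2 : 0 ≤ p / p' - 1 := by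
      have : 1 ≤ p / p' := by rwa [le_div_iff₀ hp'0, one_mul]
      linarith
    calc ∫⁻ t, ((∫⁻ s in JS t R, c s ^ p') ^ (1 / p')) ^ p
        ≤ ∫⁻ t, (∫⁻ s in JS t R, c s ^ p') * N ^ (p / p' - 1) := by
          apply lintegral_mono
          intro t
          simp only
          rw [← ENNReal.rpow_mul, show 1 / p' * p = 1 + (p / p' - 1) by ring,
            ENNReal.rpow_add_of_nonneg _ _ zero_le_one e2, ENNReal.rpow_one]
          gcongr
          exact setLIntegral_le_lintegral _ _
      _ = (∫⁻ t, ∫⁻ s in JS t R, c s ^ p') * N ^ (p / p' - 1) := lintegral_mul_const _ hM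
      _ ≤ ENNReal.ofReal (4 * R) * N * N ^ (p / p' - 1) := by
          gcongr
          exact lint_lint_JS hcp R
      _ = _ := by
          rw [mul_assoc]; nth_rw 2 [e1]
          rw [ENNReal.rpow_add_of_nonneg _ _ zero_le_one e2, ENNReal.rpow_one]
  calc _ ≤ (ENNReal.ofReal (4 * R) * N ^ (p / p')) ^ (1 / p) := by gcongr
    _ = _ := by
      rw [ENNReal.mul_rpow_of_nonneg _ _ (by positivity), ← ENNReal.rpow_mul]
      congr 2
      field_simp

lemma pow_int_scale {β : ℝ} (hβ : β < 1) : ∃ C : ℝ≥0∞, C ≠ ∞ ∧ ∀ R : ℝ, 0 < R → ∀ s : ℝ,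
    ∫⁻ u in {u : ℝ | |s - u| ≤ 4 * R}, ENNReal.ofReal |s - u| ^ (-β) ≤
      C * ENNReal.ofReal R ^ (1 - β) := by
  refine ⟨2 * ENNReal.ofReal ((4 : ℝ) ^ (1 - β) / (1 - β)), by finiteness, ?_⟩
  intro R hR s
  have hs : MeasurableSet {u : ℝ | |s - u| ≤ 4 * R} :=
    measurableSet_le (by fun_prop) (by fun_prop)
  have h0 : ∫⁻ u in {u : ℝ | |s - u| ≤ 4 * R}, ENNReal.ofReal |s - u| ^ (-β)
      = ∫⁻ u, {u : ℝ | |u| ≤ 4 * R}.indicator (fun u => ENNReal.ofReal |u| ^ (-β)) u := by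
    rw [← lintegral_indicator hs]
    exact lintegral_sub_left_eq_self (μ := volume)
      ({u : ℝ | |u| ≤ 4 * R}.indicator (fun u => ENNReal.ofReal |u| ^ (-β))) s
  rw [h0]
  set f : ℝ → ℝ≥0∞ := fun u => (Set.Ioc 0 (4 * R)).indicator (fun u => ENNReal.ofReal (u ^ (-β))) u
    with hf
  have hfm : Measurable f := by
    apply Measurable.indicator _ measurableSet_Ioc
    fun_prop
  have h1 : ∫⁻ u, {u : ℝ | |u| ≤ 4 * R}.indicator (fun u => ENNReal.ofReal |u| ^ (-β)) u
      ≤ ∫⁻ u, (f u + f (-u)) := by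
    apply lintegral_mono_ae
    have : ∀ᵐ u : ℝ, u ≠ 0 := by simp [ae_iff, measure_singleton]
    filter_upwards [this] with u hu
    by_cases hu4 : |u| ≤ 4 * R
    · rw [Set.indicator_of_mem (by exact hu4)]
      rcases lt_or_gt_of_ne hu with h | h
      · rw [abs_of_neg h] at hu4 ⊢
        rw [ENNReal.ofReal_rpow_of_pos (by linarith)]
        have : f (-u) = ENNReal.ofReal ((-u) ^ (-β)) :=
          Set.indicator_of_mem (s := Set.Ioc 0 (4 * R)) (a := -u) ⟨by linarith, hu4⟩ _
        rw [this]; exact le_add_self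
      · rw [abs_of_pos h] at hu4 ⊢
        rw [ENNReal.ofReal_rpow_of_pos h]
        have : f u = ENNReal.ofReal (u ^ (-β)) :=
          Set.indicator_of_mem (s := Set.Ioc 0 (4 * R)) (a := u) ⟨h, hu4⟩ _
        rw [this]; exact le_self_add
    · rw [Set.indicator_of_notMem (by exact hu4)]; exact zero_le
  refine h1.trans ?_
  rw [lintegral_add_left hfm]
  have h2 : ∫⁻ u, f (-u) = ∫⁻ u, f u := by
    have := lintegral_sub_left_eq_self (μ := volume) f 0
    simpa using this
  rw [h2, ← two_mul, mul_assoc]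
  gcongr
  rw [hf, lintegral_indicator measurableSet_Ioc]
  have hii : IntervalIntegrable (fun u : ℝ => u ^ (-β)) volume 0 (4 * R) :=
    intervalIntegral.intervalIntegrable_rpow' (by linarith)
  have h3 := integral_rpow (a := 0) (b := 4 * R) (r := -β) (Or.inl (by linarith))
  rw [intervalIntegral.integral_of_le (by positivity)] at h3
  rw [← ofReal_integral_eq_lintegral_ofReal
    ((intervalIntegrable_iff_integrableOn_Ioc_of_le (by positivity)).1 hii)]
  · rw [h3, Real.zero_rpow (by linarith), sub_zero, ENNReal.ofReal_rpow_of_pos hR,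
      ← ENNReal.ofReal_mul (by have : 0 < 1 - β := by linarith
                               positivity)]
    apply ENNReal.ofReal_le_ofReal
    rw [Real.mul_rpow (by norm_num) hR.le, show -β + 1 = 1 - β by ring]
    apply le_of_eq; ring
  · refine (ae_restrict_mem measurableSet_Ioc).mono fun u hu => ?_
    exact Real.rpow_nonneg hu.1.le _

lemma time_H3 {p p' : ℝ} (h : p'.HolderConjugate p) {α : ℝ} (hα : α * p < 1) :
    ∃ C : ℝ≥0∞, C ≠ ∞ ∧ ∀ (c : ℝ → ℝ≥0∞), Measurable c → ∀ R : ℝ, 0 < R → ∀ t : ℝ,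
    ∫⁻ s in JS t R, ∫⁻ s' in JS t R, ENNReal.ofReal |s - s'| ^ (-α) * c s * c s' ≤
      C * ENNReal.ofReal R ^ (2 / p - α) * ((∫⁻ s in JS t R, c s ^ p') ^ (1 / p')) ^ 2 := by
  have hp0 : 0 < p := h.symm.pos
  obtain ⟨C, hC, hCR⟩ := pow_int_scale hα
  refine ⟨C ^ (1 / p) * ENNReal.ofReal 4 ^ (1 / p), by finiteness, ?_⟩
  intro c hc R hR t
  set A := (∫⁻ s in JS t R, c s ^ p') ^ (1 / p') with hA
  have hi : ∀ s ∈ JS t R, ∫⁻ s' in JS t R, ENNReal.ofReal |s - s'| ^ (-α) * c s * c s' ≤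
      c s * ((C * ENNReal.ofReal R ^ (1 - α * p)) ^ (1 / p) * A) := by
    intro s hs
    have e1 : ∫⁻ s' in JS t R, ENNReal.ofReal |s - s'| ^ (-α) * c s * c s' =
        c s * ∫⁻ s' in JS t R, ENNReal.ofReal |s - s'| ^ (-α) * c s' := by
      rw [← lintegral_const_mul _ (by fun_prop)]
      congr 1; ext s'; ring
    rw [e1]
    gcongr
    have h1 := ENNReal.lintegral_mul_le_Lp_mul_Lq (volume.restrict (JS t R)) h.symm
      (f := fun s' => ENNReal.ofReal |s - s'| ^ (-α)) (g := c) (by fun_prop) hc.aemeasurable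
    refine h1.trans ?_
    gcongr
    · refine le_trans ?_ (hCR R hR s)
      refine (lintegral_mono_set (t := {u : ℝ | |s - u| ≤ 4 * R}) ?_).trans ?_
      · intro u hu
        have := abs_lt.1 hs.2
        have := abs_lt.1 hu.2
        simp only [Set.mem_ofPred_eq]
        rw [abs_le]; constructor <;> linarith
      · apply lintegral_mono; intro u
        simp only
        rw [← ENNReal.rpow_mul]
        apply le_of_eq; congr 1; ring
  calc _ ≤ ∫⁻ s in JS t R, c s * ((C * ENNReal.ofReal R ^ (1 - α * p)) ^ (1 / p) * A) :=
        setLIntegral_mono' (JS_meas t R) hi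
    _ = (∫⁻ s in JS t R, c s) * ((C * ENNReal.ofReal R ^ (1 - α * p)) ^ (1 / p) * A) :=
        lintegral_mul_const _ hc
    _ ≤ (ENNReal.ofReal (4 * R) ^ (1 / p) * A) *
          ((C * ENNReal.ofReal R ^ (1 - α * p)) ^ (1 / p) * A) := by
        gcongr
        exact time_H1 h hc (JS_vol t R)
    _ = _ := by
        have hR0 : ENNReal.ofReal R ≠ 0 := by simp [hR]
        rw [ENNReal.ofReal_mul (by norm_num), ENNReal.mul_rpow_of_nonneg _ _ (by positivity),
          ENNReal.mul_rpow_of_nonneg _ _ (by positivity), ← ENNReal.rpow_mul,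
          show 2 / p - α = 1 / p + (1 - α * p) * (1 / p) by field_simp; ring,
          ENNReal.rpow_add _ _ hR0 ENNReal.ofReal_ne_top]
        ring

section KT
set_option linter.unusedSectionVars false
variable {H : Type*} [NormedAddCommGroup H] [InnerProductSpace ℂ H] [CompleteSpace H]

lemma enorm_inner_self (v : H) : ‖(inner ℂ v v : ℂ)‖ₑ = ‖v‖ₑ ^ 2 := by
  rw [← ofReal_norm, inner_self_eq_norm_sq_to_K, ← ofReal_norm, ← ENNReal.ofReal_pow (norm_nonneg _)]
  congr 1
  simp

lemma enorm_inner_le (v w : H) : ‖(inner ℂ v w : ℂ)‖ₑ ≤ ‖v‖ₑ * ‖w‖ₑ := by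
  rw [← ofReal_norm, ← ofReal_norm, ← ofReal_norm, ← ENNReal.ofReal_mul (norm_nonneg _)]
  exact ENNReal.ofReal_le_ofReal (norm_inner_le_norm v w)

lemma inner_integral_right {α : Type*} [MeasurableSpace α] {μ : Measure α} {f : α → H}
    (hf : Integrable f μ) (v : H) :
    (inner ℂ v (∫ s, f s ∂μ) : ℂ) = ∫ s, inner ℂ v (f s) ∂μ := by
  exact (integral_inner hf v).symm

lemma inner_integral_left {α : Type*} [MeasurableSpace α] {μ : Measure α} {f : α → H}
    (hf : Integrable f μ) (v : H) :
    (inner ℂ (∫ s, f s ∂μ) v : ℂ) = ∫ s, inner ℂ (f s) v ∂μ := by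
  rw [← inner_conj_symm, inner_integral_right hf, ← integral_conj]
  congr 1; ext s; rw [inner_conj_symm]

lemma enorm_sq_integral_le {α : Type*} [MeasurableSpace α] {μ : Measure α} {f : α → H}
    (hf : Integrable f μ) :
    ‖∫ s, f s ∂μ‖ₑ ^ 2 ≤ ∫⁻ s, ∫⁻ s', ‖(inner ℂ (f s) (f s') : ℂ)‖ₑ ∂μ ∂μ := by
  rw [← enorm_inner_self, inner_integral_left hf]
  refine (enorm_integral_le_lintegral_enorm _).trans ?_
  apply lintegral_mono; intro s
  simp only
  rw [inner_integral_right hf]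
  exact enorm_integral_le_lintegral_enorm _

/-- The bilinear form on a time shell. -/
noncomputable def Tann (f g : ℝ → H) (R : ℝ) : ℂ :=
  ∫ t, ∫ s in JS t R, (inner ℂ (g t) (f s) : ℂ)

lemma ktA {p p' : ℝ} (h : p'.HolderConjugate p) (hp : 2 ≤ p) {σ : ℝ} (hσ : 0 ≤ σ)
    {f g : ℝ → H} {c e : ℝ → ℝ≥0∞} (hc : Measurable c) (he : Measurable e)
    {D X Y : ℝ≥0∞} (hA : ∀ t s, ‖(inner ℂ (g t) (f s) : ℂ)‖ₑ ≤
      D * ENNReal.ofReal |t - s| ^ (-σ) * (X * c s) * (Y * e t)) {R : ℝ} (hR : 0 < R) :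
    ‖Tann f g R‖ₑ ≤ D * ENNReal.ofReal 4 ^ (2 / p) * X * Y * ENNReal.ofReal R ^ (2 / p - σ) *
      (∫⁻ s, c s ^ p') ^ (1 / p') * (∫⁻ s, e s ^ p') ^ (1 / p') := by
  have hR0 : ENNReal.ofReal R ≠ 0 := by simp [hR]
  have hp0 : 0 < p := by linarith
  set L := D * ENNReal.ofReal R ^ (-σ) * X * Y with hL
  have h1 : ‖Tann f g R‖ₑ ≤ ∫⁻ t, L * ENNReal.ofReal (4 * R) ^ (1 / p) *
      ((∫⁻ s in JS t R, c s ^ p') ^ (1 / p') * e t) := by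
    refine (enorm_integral_le_lintegral_enorm _).trans ?_
    apply lintegral_mono; intro t
    simp only
    refine (enorm_integral_le_lintegral_enorm _).trans ?_
    calc _ ≤ ∫⁻ s in JS t R, (L * e t) * c s := by
          apply setLIntegral_mono' (JS_meas t R)
          intro s hs
          refine (hA t s).trans ?_
          have : ENNReal.ofReal |t - s| ^ (-σ) ≤ ENNReal.ofReal R ^ (-σ) := by
            rw [ENNReal.rpow_neg, ENNReal.rpow_neg]
            gcongr
            rw [abs_sub_comm]; exact hs.1
          calc _ ≤ D * ENNReal.ofReal R ^ (-σ) * (X * c s) * (Y * e t) := by gcongr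
            _ = _ := by rw [hL]; ring
      _ = (L * e t) * ∫⁻ s in JS t R, c s := lintegral_const_mul _ hc
      _ ≤ (L * e t) * (ENNReal.ofReal (4 * R) ^ (1 / p) *
            (∫⁻ s in JS t R, c s ^ p') ^ (1 / p')) := by
          gcongr; exact time_H1 h hc (JS_vol t R)
      _ = _ := by ring
  refine h1.trans ?_
  have hmeas : Measurable fun t => (∫⁻ s in JS t R, c s ^ p') ^ (1 / p') * e t :=
    ((lint_JS_meas (hc.pow_const _) R).pow_const _).mul he
  rw [lintegral_const_mul _ hmeas]
  calc _ ≤ L * ENNReal.ofReal (4 * R) ^ (1 / p) * (ENNReal.ofReal (4 * R) ^ (1 / p) *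
        (∫⁻ s, c s ^ p') ^ (1 / p') * (∫⁻ s, e s ^ p') ^ (1 / p')) := by
        gcongr; exact time_H2 h hp hc he R
    _ = _ := by
        rw [hL, ENNReal.ofReal_mul (by norm_num), ENNReal.mul_rpow_of_nonneg _ _ (by positivity),
          show 2 / p - σ = 1 / p + 1 / p + (-σ) by ring, show 2 / p = 1 / p + 1 / p by ring,
          ENNReal.rpow_add _ _ hR0 ENNReal.ofReal_ne_top,
          ENNReal.rpow_add _ _ hR0 ENNReal.ofReal_ne_top,
          ENNReal.rpow_add _ _ (by simp) ENNReal.ofReal_ne_top]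
        ring

lemma ktB {p p' : ℝ} (h : p'.HolderConjugate p) (hp : 2 ≤ p) {σ θ : ℝ}
    (hθ : 0 ≤ θ) (hθ1 : θ ≤ 1) (hσθ : σ * θ * p < 1) (D E : ℝ≥0∞) (hD : D ≠ ∞) (hE : E ≠ ∞) :
    ∃ C : ℝ≥0∞, C ≠ ∞ ∧ ∀ (f g : ℝ → H), Integrable f →
    ∀ (c e : ℝ → ℝ≥0∞), Measurable c → Measurable e → ∀ (X1 X2 Y2 : ℝ≥0∞),
      (∀ t s, ‖(inner ℂ (f t) (f s) : ℂ)‖ₑ ≤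
        D * ENNReal.ofReal |t - s| ^ (-σ) * (X1 * c s) * (X1 * c t)) →
      (∀ s, ‖f s‖ₑ ≤ E * (X2 * c s)) → (∀ t, ‖g t‖ₑ ≤ E * (Y2 * e t)) →
      ∀ R : ℝ, 0 < R →
    ‖Tann f g R‖ₑ ≤ C * (X1 ^ θ * X2 ^ (1 - θ)) * Y2 * ENNReal.ofReal R ^ (2 / p - σ * θ / 2) *
      (∫⁻ s, c s ^ p') ^ (1 / p') * (∫⁻ s, e s ^ p') ^ (1 / p') := by
  have hp0 : 0 < p := by linarith
  obtain ⟨C, hC, hH3⟩ := time_H3 h hσθ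
  have h1θ : 0 ≤ 1 - θ := by linarith
  refine ⟨E * (D ^ θ * (E ^ 2) ^ (1 - θ) * C) ^ ((1 : ℝ) / 2) * ENNReal.ofReal 4 ^ (1 / p),
    by finiteness, ?_⟩
  intro f g hf c e hc he X1 X2 Y2 hff hf2 hg2 R hR
  have hR0 : ENNReal.ofReal R ≠ 0 := by simp [hR]
  set X := X1 ^ θ * X2 ^ (1 - θ) with hX
  set A : ℝ → ℝ≥0∞ := fun t => (∫⁻ s in JS t R, c s ^ p') ^ (1 / p') with hA
  set B := D ^ θ * (E ^ 2) ^ (1 - θ) * C with hB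
  have hpt : ∀ s s', ‖(inner ℂ (f s) (f s') : ℂ)‖ₑ ≤ D ^ θ * (E ^ 2) ^ (1 - θ) * X ^ 2 *
      (ENNReal.ofReal |s - s'| ^ (-(σ * θ)) * c s * c s') := by
    intro s s'
    have e1 : ‖(inner ℂ (f s) (f s') : ℂ)‖ₑ = ‖(inner ℂ (f s) (f s') : ℂ)‖ₑ ^ θ *
        ‖(inner ℂ (f s) (f s') : ℂ)‖ₑ ^ (1 - θ) := by
      rw [← ENNReal.rpow_add_of_nonneg _ _ hθ h1θ]; simp
    have e2 : ‖(inner ℂ (f s) (f s') : ℂ)‖ₑ ≤ E ^ 2 * X2 ^ 2 * (c s * c s') := by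
      refine (enorm_inner_le _ _).trans ?_
      calc _ ≤ (E * (X2 * c s)) * (E * (X2 * c s')) := by gcongr <;> apply hf2
        _ = _ := by ring
    have e3 : ‖(inner ℂ (f s) (f s') : ℂ)‖ₑ ≤ D * X1 ^ 2 * ENNReal.ofReal |s - s'| ^ (-σ) *
        (c s * c s') := by
      refine (hff _ _).trans ?_
      apply le_of_eq; ring
    rw [e1]
    calc _ ≤ (D * X1 ^ 2 * ENNReal.ofReal |s - s'| ^ (-σ) * (c s * c s')) ^ θ *
          (E ^ 2 * X2 ^ 2 * (c s * c s')) ^ (1 - θ) := by gcongr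
      _ = _ := by
        simp only [ENNReal.mul_rpow_of_nonneg _ _ hθ, ENNReal.mul_rpow_of_nonneg _ _ h1θ]
        rw [← ENNReal.rpow_mul, show -σ * θ = -(σ * θ) by ring]
        have hcs : ∀ z : ℝ≥0∞, z = z ^ θ * z ^ (1 - θ) := by
          intro z; rw [← ENNReal.rpow_add_of_nonneg _ _ hθ h1θ]; simp
        have hcs2 : ∀ z : ℝ≥0∞, ∀ τ : ℝ, (z ^ 2) ^ τ = (z ^ τ) ^ 2 := by
          intro z τ
          rw [← ENNReal.rpow_natCast, ← ENNReal.rpow_natCast, ← ENNReal.rpow_mul,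
            ← ENNReal.rpow_mul, mul_comm]
        rw [hX]
        conv_rhs => rw [hcs (c s), hcs (c s')]
        rw [hcs2 X1, hcs2 X2]
        ring
  have hJ : ∀ t, ‖∫ s in JS t R, f s‖ₑ ≤ B ^ ((1 : ℝ) / 2) * X *
      ENNReal.ofReal R ^ (1 / p - σ * θ / 2) * A t := by
    intro t
    have i1 := enorm_sq_integral_le (hf.integrableOn (s := JS t R))
    have i2 : ‖∫ s in JS t R, f s‖ₑ ^ 2 ≤
        B * X ^ 2 * ENNReal.ofReal R ^ (2 / p - σ * θ) * A t ^ 2 := by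
      refine i1.trans ?_
      calc _ ≤ ∫⁻ s in JS t R, ∫⁻ s' in JS t R, D ^ θ * (E ^ 2) ^ (1 - θ) * X ^ 2 *
            (ENNReal.ofReal |s - s'| ^ (-(σ * θ)) * c s * c s') := by
            gcongr; apply hpt
        _ = D ^ θ * (E ^ 2) ^ (1 - θ) * X ^ 2 * ∫⁻ s in JS t R, ∫⁻ s' in JS t R,
            (ENNReal.ofReal |s - s'| ^ (-(σ * θ)) * c s * c s') := by
            have : ∀ s, ∫⁻ s' in JS t R, D ^ θ * (E ^ 2) ^ (1 - θ) * X ^ 2 *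
                (ENNReal.ofReal |s - s'| ^ (-(σ * θ)) * c s * c s') =
                D ^ θ * (E ^ 2) ^ (1 - θ) * X ^ 2 * ∫⁻ s' in JS t R,
                (ENNReal.ofReal |s - s'| ^ (-(σ * θ)) * c s * c s') := by
              intro s
              rw [lintegral_const_mul]; fun_prop
            simp_rw [this]
            rw [lintegral_const_mul]
            apply Measurable.lintegral_prod_right' (f := fun z : ℝ × ℝ =>
              ENNReal.ofReal |z.1 - z.2| ^ (-(σ * θ)) * c z.1 * c z.2)
            fun_prop
        _ ≤ D ^ θ * (E ^ 2) ^ (1 - θ) * X ^ 2 *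
            (C * ENNReal.ofReal R ^ (2 / p - σ * θ) * A t ^ 2) := by
            gcongr; exact hH3 c hc R hR t
        _ = _ := by rw [hB]; ring
    have i3 : ∀ z : ℝ≥0∞, (z ^ 2) ^ ((1 : ℝ) / 2) = z := by
      intro z
      rw [← ENNReal.rpow_natCast, ← ENNReal.rpow_mul]; simp
    have i4 := ENNReal.rpow_le_rpow i2 (show (0 : ℝ) ≤ 1 / 2 by norm_num)
    rw [i3] at i4
    refine i4.trans (le_of_eq ?_)
    have hh : (0 : ℝ) ≤ 1 / 2 := by norm_num
    simp only [ENNReal.mul_rpow_of_nonneg _ _ hh, i3]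
    rw [← ENNReal.rpow_mul, show (2 / p - σ * θ) * (1 / 2) = 1 / p - σ * θ / 2 by ring]
  have h1 : ‖Tann f g R‖ₑ ≤ ∫⁻ t, (E * Y2 * (B ^ ((1 : ℝ) / 2) * X *
      ENNReal.ofReal R ^ (1 / p - σ * θ / 2))) * (A t * e t) := by
    refine (enorm_integral_le_lintegral_enorm _).trans ?_
    apply lintegral_mono; intro t
    simp only
    rw [← inner_integral_right hf.integrableOn]
    refine (enorm_inner_le _ _).trans ?_
    calc _ ≤ (E * (Y2 * e t)) * (B ^ ((1 : ℝ) / 2) * X *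
          ENNReal.ofReal R ^ (1 / p - σ * θ / 2) * A t) := by
          gcongr
          · exact hg2 t
          · exact hJ t
      _ = _ := by ring
  refine h1.trans ?_
  have hmeas : Measurable fun t => (∫⁻ s in JS t R, c s ^ p') ^ (1 / p') * e t :=
    ((lint_JS_meas (hc.pow_const _) R).pow_const _).mul he
  rw [lintegral_const_mul _ hmeas]
  calc _ ≤ (E * Y2 * (B ^ ((1 : ℝ) / 2) * X *
      ENNReal.ofReal R ^ (1 / p - σ * θ / 2))) * (ENNReal.ofReal (4 * R) ^ (1 / p) *
        (∫⁻ s, c s ^ p') ^ (1 / p') * (∫⁻ s, e s ^ p') ^ (1 / p')) := by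
        gcongr; exact time_H2 h hp hc he R
    _ = _ := by
        rw [ENNReal.ofReal_mul (by norm_num),
          ENNReal.mul_rpow_of_nonneg (ENNReal.ofReal 4) _ (by positivity),
          show 2 / p - σ * θ / 2 = 1 / p + (1 / p - σ * θ / 2) by ring,
          ENNReal.rpow_add _ _ hR0 ENNReal.ofReal_ne_top]
        ring

lemma integrable_inner_prod {f g : ℝ → H} (hf : Integrable f) (hg : Integrable g) :
    Integrable (fun z : ℝ × ℝ => (inner ℂ (g z.1) (f z.2) : ℂ)) (volume.prod volume) := by
  have := hg.norm.mul_prod hf.norm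
  refine this.mono' ?_ ?_
  · exact (hg.1.comp_fst).inner (hf.1.comp_snd)
  · exact Filter.Eventually.of_forall fun z => norm_inner_le_norm _ _

lemma Tann_eq {f g : ℝ → H} (hf : Integrable f) (hg : Integrable g) (R : ℝ) :
    Tann f g R = ∫ z in {z : ℝ × ℝ | z.2 ∈ JS z.1 R}, (inner ℂ (g z.1) (f z.2) : ℂ)
      ∂(volume.prod volume) := by
  rw [← integral_indicator (JS_meas2 R), integral_prod _
    ((integrable_inner_prod hf hg).indicator (JS_meas2 R))]
  unfold Tann
  congr 1; ext t
  rw [← integral_indicator (JS_meas t R)]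
  rfl

lemma Tann_symm {f g : ℝ → H} (hf : Integrable f) (hg : Integrable g) (R : ℝ) :
    ‖Tann f g R‖ₑ = ‖Tann g f R‖ₑ := by
  have : Tann f g R = starRingEnd ℂ (Tann g f R) := by
    rw [Tann_eq hf hg, ← integral_indicator (JS_meas2 R), integral_prod_symm _
      ((integrable_inner_prod hf hg).indicator (JS_meas2 R))]
    unfold Tann
    rw [← integral_conj]
    congr 1; ext t
    rw [← integral_conj, ← integral_indicator (JS_meas t R)]
    congr 1; ext s
    by_cases hs : s ∈ JS t R
    · rw [Set.indicator_of_mem hs, Set.indicator_of_mem (by exact JS_symm.1 hs)]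
      simp
    · rw [Set.indicator_of_notMem hs, Set.indicator_of_notMem (by exact fun h => hs (JS_symm.1 h))]
  rw [this, ← ofReal_norm, RCLike.norm_conj, ofReal_norm]

/-- dyadic decomposition of the bilinear form. -/
lemma form_le_tsum {f g : ℝ → H} (hf : Integrable f) (hg : Integrable g) :
    ‖(inner ℂ (∫ t, g t) (∫ s, f s) : ℂ)‖ₑ ≤ ∑' j : ℤ, ‖Tann f g ((2 : ℝ) ^ j)‖ₑ := by
  have hI := integrable_inner_prod hf hg
  have h1 : (inner ℂ (∫ t, g t) (∫ s, f s) : ℂ) =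
      ∫ z : ℝ × ℝ, (inner ℂ (g z.1) (f z.2) : ℂ) ∂(volume.prod volume) := by
    rw [integral_prod _ hI, inner_integral_left hg]
    congr 1; ext t
    rw [inner_integral_right hf]
  set S : ℤ → Set (ℝ × ℝ) := fun j => {z : ℝ × ℝ | z.2 ∈ JS z.1 ((2 : ℝ) ^ j)} with hS
  have hdisj : Pairwise (Function.onFun Disjoint S) := by
    intro i j hij
    rw [Function.onFun, Set.disjoint_left]
    intro z hz hz'
    have key : ∀ i j : ℤ, i < j → z ∈ S i → z ∈ S j → False := by
      intro i j hij h1 h2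
      have a1 : |z.2 - z.1| < 2 * 2 ^ i := h1.2
      have a2 : (2 : ℝ) ^ j ≤ |z.2 - z.1| := h2.1
      have a3 : (2 : ℝ) ^ (i + 1) ≤ 2 ^ j := zpow_le_zpow_right₀ (by norm_num) (by omega)
      rw [zpow_add₀ (by norm_num)] at a3
      norm_num at a3
      linarith
    rcases lt_or_gt_of_ne hij with h | h
    · exact key i j h hz hz'
    · exact key j i h hz' hz
  have hU : (⋃ j, S j) =ᵐ[volume.prod volume] (Set.univ : Set (ℝ × ℝ)) := by
    rw [Filter.eventuallyEq_univ, mem_ae_iff]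
    have hsub : (⋃ j, S j)ᶜ ⊆ {z : ℝ × ℝ | z.1 = z.2} := by
      intro z hz
      by_contra hne
      apply hz
      have hpos : 0 < |z.2 - z.1| := abs_pos.2 (sub_ne_zero.2 fun h => hne h.symm)
      obtain ⟨n, hn⟩ := exists_mem_Ico_zpow hpos (show (1 : ℝ) < 2 by norm_num)
      refine Set.mem_iUnion.2 ⟨n, hn.1, ?_⟩
      have := hn.2
      rw [zpow_add₀ (by norm_num)] at this
      norm_num at this
      linarith
    refine measure_mono_null hsub ?_
    have hm : MeasurableSet {z : ℝ × ℝ | z.1 = z.2} := measurableSet_eq_fun measurable_fst measurable_snd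
    rw [Measure.measure_prod_null hm]
    filter_upwards with t
    have : Prod.mk t ⁻¹' {z : ℝ × ℝ | z.1 = z.2} = {t} := by ext s; simp [eq_comm]
    rw [this]; simp
  have h2 := hasSum_integral_iUnion (μ := (volume : Measure ℝ).prod (volume : Measure ℝ))
    (fun j => JS_meas2 ((2 : ℝ) ^ j)) hdisj hI.integrableOn
  rw [setIntegral_congr_set hU, setIntegral_univ, ← h1] at h2
  rw [← h2.tsum_eq]
  refine enorm_tsum_le_tsum_enorm.trans ?_
  apply le_of_eq
  congr 1; ext j
  rw [Tann_eq hf hg]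
end KT

lemma theta_bound {a δ : ℝ} (ha : 0 < a) (hδ : 0 < δ) : ∃ C : ℝ≥0∞, C ≠ ∞ ∧ ∀ b : ℝ,
    ∑' n : ℤ, (2 : ℝ≥0∞) ^ (-(δ * |a * n + b|)) ≤ C := by
  set r : ℝ := 2 ^ (-(δ * a)) with hr
  have hr0 : 0 < r := by positivity
  have hr1 : r < 1 := Real.rpow_lt_one_of_one_lt_of_neg (by norm_num) (by nlinarith)
  have hsum : Summable fun n : ℤ => r ^ n.natAbs := by
    apply Summable.of_nat_of_neg
    · simpa using summable_geometric_of_lt_one hr0.le hr1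
    · simpa using summable_geometric_of_lt_one hr0.le hr1
  refine ⟨(2 : ℝ≥0∞) ^ (δ * a) * ∑' n : ℤ, ENNReal.ofReal (r ^ n.natAbs), ?_, ?_⟩
  · apply ENNReal.mul_ne_top (by finiteness)
    rw [← ENNReal.ofReal_tsum_of_nonneg (fun n => by positivity) hsum]
    exact ENNReal.ofReal_ne_top
  intro b
  set m : ℤ := ⌊b / a⌋ with hm
  have hm1 : (m : ℝ) ≤ b / a := Int.floor_le _
  have hm2 : b / a < m + 1 := Int.lt_floor_add_one _
  rw [le_div_iff₀ ha] at hm1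
  rw [div_lt_iff₀ ha] at hm2
  rw [← (Equiv.subRight m).tsum_eq, ← ENNReal.tsum_mul_left]
  apply ENNReal.tsum_le_tsum
  intro n
  have e1 : ENNReal.ofReal (r ^ n.natAbs) = (2 : ℝ≥0∞) ^ (-(δ * a * n.natAbs)) := by
    rw [hr, ← Real.rpow_natCast, ← Real.rpow_mul (by norm_num), ← ENNReal.ofReal_rpow_of_pos (by norm_num)]
    congr 1
    · simp
    · ring
  rw [e1, ← ENNReal.rpow_add _ _ (by norm_num) (by norm_num)]
  apply ENNReal.rpow_le_rpow_of_exponent_le (by norm_num)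
  have e2 : ((n.natAbs : ℕ) : ℝ) = |(n : ℝ)| := by
    rw [← Int.cast_abs, Int.abs_eq_natAbs]; simp
  rw [e2]
  simp only [Equiv.subRight_apply]
  push_cast
  have : a * |(n : ℝ)| ≤ |a * (n - m) + b| + a := by
    have h1 : a * |(n : ℝ)| = |a * n| := by rw [abs_mul, abs_of_pos ha]
    rw [h1]
    have h2 : a * n = (a * (n - m) + b) + (m * a - b) := by ring
    rw [h2]
    refine (abs_add_le _ _).trans ?_
    gcongr
    rw [abs_le]; constructor <;> linarith
  nlinarith

lemma min_lemma {q μ ε : ℝ} (hq : 0 < q) (hε : 0 < ε) (hμ : ε < μ) : ∃ δ > 0, ∀ k l : ℝ,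
    (k + l) / q ≤ -(δ * (|k| + |l|)) ∨ -k * (μ - ε) - l * μ ≤ -(δ * (|k| + |l|)) ∨
    -l * (μ - ε) - k * μ ≤ -(δ * (|k| + |l|)) := by
  have hμ0 : 0 < μ := by linarith
  set c := ε / (4 * μ) with hc
  have hc0 : 0 < c := by positivity
  have hcμ : c * μ = ε / 4 := by rw [hc]; field_simp
  set δ := min (min (1 / (q * (1 + 1 / c))) (ε / (4 * (1 + c)))) (ε / 2) with hδ
  have d1 : δ ≤ 1 / (q * (1 + 1 / c)) := (min_le_left _ _).trans (min_le_left _ _)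
  have d2 : δ ≤ ε / (4 * (1 + c)) := (min_le_left _ _).trans (min_le_right _ _)
  have d3 : δ ≤ ε / 2 := min_le_right _ _
  have hδ0 : 0 < δ := by rw [hδ]; positivity
  refine ⟨δ, hδ0, ?_⟩
  rw [le_div_iff₀ (by positivity)] at d1 d2
  have d1' : δ * q * (1 + c) ≤ c := by
    have : δ * (q * (1 + 1 / c)) * c = δ * q * (1 + c) := by field_simp; ring
    nlinarith
  intro k l
  set S := k + l with hS
  have hkl : |k| + |l| ≤ |S| + |k - l| := by
    rw [hS]
    rcases abs_cases k with h | h <;> rcases abs_cases l with h' | h' <;>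
    rcases abs_cases (k + l) with h1 | h1 <;> rcases abs_cases (k - l) with h2 | h2 <;> linarith
  by_cases hcase : S ≤ -(c * |k - l|)
  · left
    rw [div_le_iff₀ hq]
    have hD : 0 ≤ |k - l| := abs_nonneg _
    have hS0 : S ≤ 0 := by nlinarith
    rw [abs_of_nonpos hS0] at hkl
    have h3 : δ * q * (|k| + |l|) ≤ δ * q * (-S + |k - l|) := by gcongr
    have h4 : c * (-S + |k - l|) ≤ (1 + c) * (-S) := by nlinarith
    have h5 : c * (δ * q * (-S + |k - l|)) ≤ c * (-S) := by
      have := mul_le_mul_of_nonneg_left h4 (show 0 ≤ δ * q by positivity)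
      nlinarith
    have h6 := le_of_mul_le_mul_left h5 hc0
    linarith
  · push Not at hcase
    right
    have hD : 0 ≤ |k - l| := abs_nonneg _
    have main : -(μ - ε / 2) * S - ε / 2 * |k - l| ≤ -(δ * (|k| + |l|)) := by
      rcases le_total 0 S with hS0 | hS0
      · rw [abs_of_nonneg hS0] at hkl
        have h3 : δ * (|k| + |l|) ≤ ε / 2 * (S + |k - l|) := by
          apply mul_le_mul d3 hkl (by positivity) (by positivity)
        nlinarith
      · rw [abs_of_nonpos hS0] at hkl
        have h3 : δ * (|k| + |l|) ≤ δ * ((1 + c) * |k - l|) := by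
          gcongr; nlinarith
        have h4 : (μ - ε / 2) * (-S) ≤ μ * (c * |k - l|) := by
          apply mul_le_mul (by linarith) (by linarith) (by linarith) hμ0.le
        nlinarith
    rcases le_total 0 (k - l) with h | h
    · rw [abs_of_nonneg h] at main
      right
      have : -l * (μ - ε) - k * μ = -(μ - ε / 2) * S - ε / 2 * (k - l) := by rw [hS]; ring
      linarith
    · rw [abs_of_nonpos h] at main
      left
      have : -k * (μ - ε) - l * μ = -(μ - ε / 2) * S - ε / 2 * (-(k - l)) := by rw [hS]; ring
      linarith

section KT
variable {H : Type*} [NormedAddCommGroup H] [InnerProductSpace ℂ H] [CompleteSpace H]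

/-- Off-diagonal decay for the atoms. -/
lemma kt_atoms {p p' q σ : ℝ} (h : p'.HolderConjugate p) (hp : 2 ≤ p) (hq : 2 < q) (hσ : 0 < σ)
    (hpq : 1 / p = σ * (1 / 2 - 1 / q)) (D E : ℝ≥0∞) (hD : D ≠ ∞) (hE : E ≠ ∞) :
    ∃ δ > 0, ∃ C : ℝ≥0∞, C ≠ ∞ ∧ ∀ (f g : ℝ → H), Integrable f → Integrable g →
    ∀ (c e : ℝ → ℝ≥0∞), Measurable c → Measurable e → ∀ (k l : ℝ),
      (∀ t s, ‖(inner ℂ (f t) (f s) : ℂ)‖ₑ ≤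
        D * ENNReal.ofReal |t - s| ^ (-σ) * (2 ^ (k / q) * c s) * (2 ^ (k / q) * c t)) →
      (∀ t s, ‖(inner ℂ (g t) (g s) : ℂ)‖ₑ ≤
        D * ENNReal.ofReal |t - s| ^ (-σ) * (2 ^ (l / q) * e s) * (2 ^ (l / q) * e t)) →
      (∀ t s, ‖(inner ℂ (g t) (f s) : ℂ)‖ₑ ≤
        D * ENNReal.ofReal |t - s| ^ (-σ) * (2 ^ (k / q) * c s) * (2 ^ (l / q) * e t)) →
      (∀ s, ‖f s‖ₑ ≤ E * (2 ^ (-(k * (1 / 2 - 1 / q))) * c s)) →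
      (∀ s, ‖g s‖ₑ ≤ E * (2 ^ (-(l * (1 / 2 - 1 / q))) * e s)) →
      ∀ j : ℤ, ‖Tann f g (2 ^ j)‖ₑ ≤ C * (2 ^ (-(δ * |k - σ * j|)) * 2 ^ (-(δ * |l - σ * j|))) *
        ((∫⁻ s, c s ^ p') ^ (1 / p') * (∫⁻ s, e s ^ p') ^ (1 / p')) := by
  have hp0 : 0 < p := by linarith
  set μ := 1 / 2 - 1 / q with hμ
  have hμ0 : 0 < μ := by
    rw [hμ, sub_pos]; exact one_div_lt_one_div_of_lt (by norm_num) hq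
  have hμ1 : μ ≤ 1 / 2 := by rw [hμ]; have : 0 < 1 / q := by positivity
                             linarith
  -- use θ = μ / 2, ε = μ / 4
  have hσθ : σ * (μ / 2) * p < 1 := by
    rw [mul_div_assoc', ← hpq]; field_simp; norm_num
  obtain ⟨CB, hCB, hB⟩ := ktB (H := H) h hp (θ := μ / 2) (by positivity) (by linarith) hσθ D E hD hE
  obtain ⟨δ, hδ, hmin⟩ := min_lemma (q := q) (μ := μ) (ε := μ / 4) (by linarith) (by positivity)
    (by linarith)
  refine ⟨δ, hδ, D * ENNReal.ofReal 4 ^ (2 / p) + CB, by finiteness, ?_⟩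
  intro f g hf hg c e hc he k l hff hgg hgf hf2 hg2 j
  have hR : (0 : ℝ) < 2 ^ j := by positivity
  have hRe : ENNReal.ofReal ((2 : ℝ) ^ j) = (2 : ℝ≥0∞) ^ (j : ℝ) := by
    rw [← Real.rpow_intCast, ← ENNReal.ofReal_rpow_of_pos (by norm_num)]; simp
  have two0 : (2 : ℝ≥0∞) ≠ 0 := by norm_num
  have twot : (2 : ℝ≥0∞) ≠ ∞ := by norm_num
  set c0 := (∫⁻ s, c s ^ p') ^ (1 / p')
  set e0 := (∫⁻ s, e s ^ p') ^ (1 / p')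
  have h2p : 2 / p = 2 * (σ * μ) := by rw [← hpq]; ring
  have hqμ : 1 / q = 1 / 2 - μ := by rw [hμ]; ring
  have bA : ‖Tann f g (2 ^ j)‖ₑ ≤ (D * ENNReal.ofReal 4 ^ (2 / p)) *
      2 ^ (((k - σ * j) + (l - σ * j)) / q) * (c0 * e0) := by
    refine (ktA h hp hσ.le hc he hgf hR).trans (le_of_eq ?_)
    rw [hRe, ← ENNReal.rpow_mul, show ((k - σ * j) + (l - σ * j)) / q =
      k / q + l / q + (j * (2 / p - σ)) by
        rw [h2p, add_div, sub_div, sub_div, mul_div_assoc, div_eq_mul_one_div (j : ℝ) q, hqμ]; ring,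
      ENNReal.rpow_add _ _ two0 twot, ENNReal.rpow_add _ _ two0 twot]
    ring
  have bB : ∀ (f g : ℝ → H), Integrable f →
    ∀ (c e : ℝ → ℝ≥0∞), Measurable c → Measurable e → ∀ (k l : ℝ),
      (∀ t s, ‖(inner ℂ (f t) (f s) : ℂ)‖ₑ ≤
        D * ENNReal.ofReal |t - s| ^ (-σ) * (2 ^ (k / q) * c s) * (2 ^ (k / q) * c t)) →
      (∀ s, ‖f s‖ₑ ≤ E * (2 ^ (-(k * μ)) * c s)) →
      (∀ s, ‖g s‖ₑ ≤ E * (2 ^ (-(l * μ)) * e s)) →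
      ‖Tann f g (2 ^ j)‖ₑ ≤ CB * 2 ^ (-(k - σ * j) * (μ - μ / 4) - (l - σ * j) * μ) *
      ((∫⁻ s, c s ^ p') ^ (1 / p') * (∫⁻ s, e s ^ p') ^ (1 / p')) := by
    intro f g hf c e hc he k l hff hf2 hg2
    refine (hB f g hf c e hc he _ _ _ hff hf2 hg2 _ hR).trans (le_of_eq ?_)
    rw [hRe, ← ENNReal.rpow_mul, ← ENNReal.rpow_mul, ← ENNReal.rpow_mul,
      show -(k - σ * j) * (μ - μ / 4) - (l - σ * j) * μ =
      (k / q * (μ / 2) + (-(k * μ)) * (1 - μ / 2)) + (-(l * μ)) +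
        j * (2 / p - σ * (μ / 2) / 2) by
        rw [h2p, div_eq_mul_one_div k q, hqμ]; ring,
      ENNReal.rpow_add _ _ two0 twot, ENNReal.rpow_add _ _ two0 twot,
      ENNReal.rpow_add _ _ two0 twot]
    ring
  have hδe : (2 : ℝ≥0∞) ^ (-(δ * |k - σ * j|)) * 2 ^ (-(δ * |l - σ * j|)) =
      2 ^ (-(δ * (|k - σ * j| + |l - σ * j|))) := by
    rw [← ENNReal.rpow_add _ _ two0 twot]; congr 1; ring
  rw [hδe]
  rcases hmin (k - σ * j) (l - σ * j) with h1 | h1 | h1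
  · refine bA.trans ?_
    gcongr
    · exact le_self_add
    · norm_num
  · refine (bB f g hf c e hc he k l hff hf2 hg2).trans ?_
    gcongr
    · exact le_add_self
    · norm_num
  · rw [Tann_symm hf hg, mul_comm c0 e0]
    refine (bB g f hg e c he hc l k hgg hg2 hf2).trans ?_
    gcongr
    · exact le_add_self
    · norm_num

/-- Summation over all atoms. -/
lemma kt_sum {p p' q σ a : ℝ} (h : p'.HolderConjugate p) (hp : 2 ≤ p) (hq : 2 < q) (hσ : 0 < σ)
    (hpq : 1 / p = σ * (1 / 2 - 1 / q)) (ha : 0 < a) (D E : ℝ≥0∞) (hD : D ≠ ∞) (hE : E ≠ ∞) :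
    ∃ C : ℝ≥0∞, C ≠ ∞ ∧ ∀ (f : ℤ → ℝ → H), (∀ n, Integrable (f n)) →
    ∀ (c : ℤ → ℝ → ℝ≥0∞), (∀ n, Measurable (c n)) →
      (∀ n m t s, ‖(inner ℂ (f n t) (f m s) : ℂ)‖ₑ ≤
        D * ENNReal.ofReal |t - s| ^ (-σ) * (2 ^ ((-(a * m)) / q) * c m s) *
          (2 ^ ((-(a * n)) / q) * c n t)) →
      (∀ n s, ‖f n s‖ₑ ≤ E * (2 ^ (-(-(a * n) * (1 / 2 - 1 / q))) * c n s)) →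
      ∀ S : Finset ℤ, ‖∑ n ∈ S, ∫ s, f n s‖ₑ ^ 2 ≤
        C * ∑' n, ((∫⁻ s, c n s ^ p') ^ (1 / p')) ^ 2 := by
  obtain ⟨δ, hδ, C, hC, hT⟩ := kt_atoms (H := H) h hp hq hσ hpq D E hD hE
  obtain ⟨Ca, hCa, hTa⟩ := theta_bound ha hδ
  obtain ⟨Cs, hCs, hTs⟩ := theta_bound hσ hδ
  refine ⟨2 * (C * (Ca * Cs)), by finiteness, ?_⟩
  intro f hf c hc hff hf2 S
  set γ : ℤ → ℝ≥0∞ := fun n => (∫⁻ s, c n s ^ p') ^ (1 / p') with hγ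
  set w : ℤ → ℤ → ℝ≥0∞ := fun n j => 2 ^ (-(δ * |-(a * n) - σ * j|)) with hw
  have e0 : ∀ n m j, ‖Tann (f n) (f m) (2 ^ j)‖ₑ ≤ C * (w n j * w m j) * (γ n * γ m) := by
    intro n m j
    exact hT (f n) (f m) (hf n) (hf m) (c n) (c m) (hc n) (hc m) (-(a * n)) (-(a * m))
      (hff n n) (hff m m) (hff m n) (hf2 n) (hf2 m) j
  have e1 : ‖∑ n ∈ S, ∫ s, f n s‖ₑ ^ 2 ≤
      ∑ m ∈ S, ∑ n ∈ S, ‖(inner ℂ (∫ t, f m t) (∫ s, f n s) : ℂ)‖ₑ := by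
    rw [← enorm_inner_self, sum_inner]
    refine (enorm_sum_le _ _).trans ?_
    gcongr with m hm
    rw [inner_sum]
    exact enorm_sum_le _ _
  have w1 : ∀ j, ∑' m, w m j ≤ Ca := by
    intro j
    refine le_trans (le_of_eq ?_) (hTa (σ * j))
    congr 1; ext m
    rw [hw]; simp only
    rw [← abs_neg]; congr 4; ring
  have w2 : ∀ n, ∑' j, w n j ≤ Cs := by
    intro n
    refine le_trans (le_of_eq ?_) (hTs (a * n))
    congr 1; ext m
    rw [hw]; simp only
    rw [← abs_neg]; congr 4; ring
  have e2 : ∑' m : ℤ, ∑' n : ℤ, ∑' j : ℤ, (w n j * w m j) * γ n ^ 2 ≤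
      Ca * Cs * ∑' n, γ n ^ 2 := by
    rw [ENNReal.tsum_comm, ← ENNReal.tsum_mul_left]
    apply ENNReal.tsum_le_tsum
    intro n
    rw [ENNReal.tsum_comm]
    calc ∑' j : ℤ, ∑' m : ℤ, w n j * w m j * γ n ^ 2
        = ∑' j : ℤ, (w n j * γ n ^ 2) * ∑' m : ℤ, w m j := by
          congr 1; ext j
          rw [← ENNReal.tsum_mul_left]; congr 1; ext m; ring
      _ ≤ ∑' j : ℤ, (w n j * γ n ^ 2) * Ca := by gcongr with j; exact w1 j
      _ = Ca * γ n ^ 2 * ∑' j, w n j := by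
          rw [← ENNReal.tsum_mul_left]; congr 1; ext m; ring
      _ ≤ Ca * γ n ^ 2 * Cs := by gcongr; exact w2 n
      _ = _ := by ring
  have e3 : ∑' m : ℤ, ∑' n : ℤ, ∑' j : ℤ, (w n j * w m j) * γ m ^ 2 ≤
      Ca * Cs * ∑' n, γ n ^ 2 := by
    refine le_trans (le_of_eq ?_) e2
    rw [ENNReal.tsum_comm]
    congr 1; ext n; congr 1; ext m; congr 1; ext j; ring
  calc ‖∑ n ∈ S, ∫ s, f n s‖ₑ ^ 2
      ≤ ∑ m ∈ S, ∑ n ∈ S, ‖(inner ℂ (∫ t, f m t) (∫ s, f n s) : ℂ)‖ₑ := e1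
    _ ≤ ∑ m ∈ S, ∑ n ∈ S, ∑' j : ℤ, C * (w n j * w m j * γ n ^ 2 + w n j * w m j * γ m ^ 2) := by
        gcongr with m hm n hn
        refine (form_le_tsum (hf n) (hf m)).trans ?_
        gcongr with j
        refine (e0 n m j).trans ?_
        have : γ n * γ m ≤ γ n ^ 2 + γ m ^ 2 := by
          rcases le_total (γ n) (γ m) with hh | hh
          · calc γ n * γ m ≤ γ m * γ m := by gcongr
              _ = γ m ^ 2 := by ring
              _ ≤ _ := le_add_self
          · calc γ n * γ m ≤ γ n * γ n := by gcongr
              _ = γ n ^ 2 := by ring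
              _ ≤ _ := le_self_add
        calc _ ≤ C * (w n j * w m j) * (γ n ^ 2 + γ m ^ 2) := by gcongr
          _ = _ := by ring
    _ ≤ ∑' m : ℤ, ∑' n : ℤ, ∑' j : ℤ, C * (w n j * w m j * γ n ^ 2 + w n j * w m j * γ m ^ 2) := by
        refine le_trans ?_ (ENNReal.sum_le_tsum S)
        gcongr with m hm
        exact ENNReal.sum_le_tsum S
    _ = C * (∑' m : ℤ, ∑' n : ℤ, ∑' j : ℤ, (w n j * w m j) * γ n ^ 2 +
          ∑' m : ℤ, ∑' n : ℤ, ∑' j : ℤ, (w n j * w m j) * γ m ^ 2) := by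
        simp_rw [ENNReal.tsum_mul_left, ENNReal.tsum_add]
    _ ≤ C * (Ca * Cs * ∑' n, γ n ^ 2 + Ca * Cs * ∑' n, γ n ^ 2) := by gcongr
    _ = _ := by ring
end KT

section Lev
set_option linter.unusedSectionVars false
variable {X : Type*} [MeasurableSpace X]

/-- dyadic level sets relative to height `N`. -/
def LevS (g : X → ℝ≥0∞) (N : ℝ≥0∞) (n : ℤ) : Set X :=
  {x | 2 ^ (n : ℝ) * N < g x ∧ g x ≤ 2 ^ ((n : ℝ) + 1) * N}

lemma LevS_meas {g : X → ℝ≥0∞} (hg : Measurable g) (N : ℝ≥0∞) (n : ℤ) :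
    MeasurableSet (LevS g N n) :=
  (measurableSet_lt measurable_const hg).inter (measurableSet_le hg measurable_const)

lemma LevS_disj (g : X → ℝ≥0∞) (N : ℝ≥0∞) : Pairwise (Function.onFun Disjoint (LevS g N)) := by
  intro i j hij
  rw [Function.onFun, Set.disjoint_left]
  intro z hz hz'
  have key : ∀ i j : ℤ, i < j → z ∈ LevS g N i → z ∈ LevS g N j → False := by
    intro i j hij h1 h2
    have a1 := h1.2
    have a2 := h2.1
    have a3 : (2 : ℝ≥0∞) ^ ((i : ℝ) + 1) * N ≤ 2 ^ (j : ℝ) * N := by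
      gcongr
      · norm_num
      · exact_mod_cast hij
    exact absurd (a1.trans a3) (not_le.2 a2)
  rcases lt_or_gt_of_ne hij with h | h
  · exact key i j h hz hz'
  · exact key j i h hz' hz

lemma LevS_cover {g : X → ℝ≥0∞} {N : ℝ≥0∞} (hN0 : N ≠ 0) (hN : N ≠ ∞) {x : X} (hx0 : g x ≠ 0)
    (hx : g x ≠ ∞) : ∃ n, x ∈ LevS g N n := by
  obtain ⟨n, hn⟩ := ENNReal.exists_mem_Ioc_zpow (x := g x / N) (y := 2)
    (ENNReal.div_ne_zero.2 ⟨hx0, hN⟩) (ENNReal.div_ne_top hx hN0) (by norm_num) (by norm_num)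
  refine ⟨n, ?_, ?_⟩
  · have := hn.1
    rw [← ENNReal.rpow_intCast, ENNReal.lt_div_iff_mul_lt (Or.inl hN0) (Or.inl hN)] at this
    exact this
  · have := hn.2
    rw [← ENNReal.rpow_intCast, ENNReal.div_le_iff hN0 hN] at this
    push_cast at this
    exact this

lemma LevS_sum {g : X → ℝ≥0∞} (hg : Measurable g) (μ : Measure X) (N : ℝ≥0∞) (Q : ℝ) :
    ∑' n, (∫⁻ x in LevS g N n, g x ^ Q ∂μ) / (∫⁻ x, g x ^ Q ∂μ) ≤ 1 := by
  simp_rw [div_eq_mul_inv]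
  rw [ENNReal.tsum_mul_right, ← lintegral_iUnion (LevS_meas hg N) (LevS_disj g N), ← div_eq_mul_inv]
  refine ENNReal.div_le_of_le_mul ?_
  rw [one_mul]
  exact setLIntegral_le_lintegral _ _

lemma LevS_bounds {g : X → ℝ≥0∞} (hg : Measurable g) (μ : Measure X) {Q : ℝ} (hQ1 : 1 < Q)
    (hQ2 : Q < 2) (hI : ∫⁻ x, g x ^ Q ∂μ ≠ ∞) (n : ℤ) :
    (∫⁻ x in LevS g ((∫⁻ x, g x ^ Q ∂μ) ^ (1 / Q)) n, g x ∂μ ≤ 2 ^ (-(n * (Q - 1))) *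
      ((∫⁻ x, g x ^ Q ∂μ) ^ (1 / Q) * ((∫⁻ x in LevS g ((∫⁻ x, g x ^ Q ∂μ) ^ (1 / Q)) n,
        g x ^ Q ∂μ) / (∫⁻ x, g x ^ Q ∂μ)) ^ ((1 : ℝ) / 2))) ∧
    ((∫⁻ x in LevS g ((∫⁻ x, g x ^ Q ∂μ) ^ (1 / Q)) n, g x ^ 2 ∂μ) ^ ((1 : ℝ) / 2) ≤
      2 ^ ((n + 1) * (1 - Q / 2)) *
      ((∫⁻ x, g x ^ Q ∂μ) ^ (1 / Q) * ((∫⁻ x in LevS g ((∫⁻ x, g x ^ Q ∂μ) ^ (1 / Q)) n,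
        g x ^ Q ∂μ) / (∫⁻ x, g x ^ Q ∂μ)) ^ ((1 : ℝ) / 2))) := by
  set I := ∫⁻ x, g x ^ Q ∂μ with hIdef
  set N := I ^ (1 / Q) with hN
  set S := LevS g N n with hS
  set In := ∫⁻ x in S, g x ^ Q ∂μ with hIn
  have hSm : MeasurableSet S := LevS_meas hg N n
  have hQ0 : 0 < Q := by linarith
  have hNt : N ≠ ∞ := ENNReal.rpow_ne_top_of_nonneg (by positivity) hI
  have hIN : I = N ^ Q := by
    rw [hN, ← ENNReal.rpow_mul]; field_simp; simp
  have two0 : (2 : ℝ≥0∞) ≠ 0 := by norm_num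
  have twot : (2 : ℝ≥0∞) ≠ ∞ := by norm_num
  by_cases hN0 : N = 0
  · have : S = ∅ := by
      rw [hS, hN0]; ext x; simp [LevS]
      intro h; exact h.ne'
    rw [this]; simp
  have hI0 : I ≠ 0 := by
    intro h; rw [hN, h] at hN0; simp [hQ0] at hN0
  have hInI : In ≤ I := setLIntegral_le_lintegral _ _
  set w := In / I with hw
  have hw1 : w ≤ 1 := by
    rw [hw]; exact ENNReal.div_le_of_le_mul (by rwa [one_mul])
  have hwI : In = w * N ^ Q := by
    rw [hw, ← hIN, ENNReal.div_mul_cancel hI0 hI]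
  have hww : w ≤ w ^ ((1 : ℝ) / 2) := by
    conv_lhs => rw [← ENNReal.rpow_one w]
    exact ENNReal.rpow_le_rpow_of_exponent_ge hw1 (by norm_num)
  constructor
  · calc ∫⁻ x in S, g x ∂μ ≤ ∫⁻ x in S, (2 ^ (n : ℝ) * N) ^ (1 - Q) * g x ^ Q ∂μ := by
          apply setLIntegral_mono' hSm
          intro x hx
          have hx1 := hx.1
          have hg0 : g x ≠ 0 := (bot_le.trans_lt hx1).ne'
          have hgt : g x ≠ ∞ := by
            refine ne_top_of_le_ne_top ?_ hx.2
            finiteness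
          have : g x = g x ^ (1 - Q) * g x ^ Q := by
            rw [← ENNReal.rpow_add _ _ hg0 hgt]; simp
          conv_lhs => rw [this]
          gcongr ?_ * _
          rw [show 1 - Q = -(Q - 1) by ring, ENNReal.rpow_neg, ENNReal.rpow_neg]
          gcongr
      _ = (2 ^ (n : ℝ) * N) ^ (1 - Q) * In := lintegral_const_mul _ (hg.pow_const _)
      _ = 2 ^ (-(n * (Q - 1))) * (N * w) := by
          rw [hwI, ENNReal.mul_rpow_of_ne_top (by finiteness) hNt, ← ENNReal.rpow_mul,
            show (n : ℝ) * (1 - Q) = -(n * (Q - 1)) by ring]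
          have : N ^ (1 - Q) * N ^ Q = N := by
            rw [← ENNReal.rpow_add _ _ hN0 hNt]; simp
          calc _ = 2 ^ (-(n * (Q - 1))) * ((N ^ (1 - Q) * N ^ Q) * w) := by ring
            _ = _ := by rw [this]
      _ ≤ _ := by gcongr
  · have h2 : ∫⁻ x in S, g x ^ 2 ∂μ ≤ 2 ^ ((n + 1) * (2 - Q)) * (N ^ 2 * w) := by
      calc ∫⁻ x in S, g x ^ 2 ∂μ ≤
          ∫⁻ x in S, (2 ^ ((n : ℝ) + 1) * N) ^ (2 - Q) * g x ^ Q ∂μ := by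
            apply setLIntegral_mono' hSm
            intro x hx
            have : g x ^ 2 = g x ^ (2 - Q) * g x ^ Q := by
              rw [← ENNReal.rpow_add_of_nonneg _ _ (by linarith) (by linarith),
                ← ENNReal.rpow_natCast]; simp
            rw [this]
            gcongr ?_ * _
            exact ENNReal.rpow_le_rpow hx.2 (by linarith)
        _ = (2 ^ ((n : ℝ) + 1) * N) ^ (2 - Q) * In := lintegral_const_mul _ (hg.pow_const _)
        _ = _ := by
          rw [hwI, ENNReal.mul_rpow_of_nonneg _ _ (by linarith), ← ENNReal.rpow_mul]
          have : N ^ (2 - Q) * N ^ Q = N ^ 2 := by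
            rw [← ENNReal.rpow_add _ _ hN0 hNt, ← ENNReal.rpow_natCast]; simp
          calc _ = 2 ^ (((n : ℝ) + 1) * (2 - Q)) * ((N ^ (2 - Q) * N ^ Q) * w) := by ring
            _ = _ := by rw [this]
    refine (ENNReal.rpow_le_rpow h2 (by norm_num)).trans (le_of_eq ?_)
    have hh : (0 : ℝ) ≤ 1 / 2 := by norm_num
    rw [ENNReal.mul_rpow_of_nonneg _ _ hh, ENNReal.mul_rpow_of_nonneg _ _ hh, ← ENNReal.rpow_mul,
      ← ENNReal.rpow_natCast, ← ENNReal.rpow_mul]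
    norm_num
    congr 2; ring
end Lev

/-- Summability of the atoms' coefficients. -/
lemma coef_sum {P : ℝ} (hP0 : 0 < P) (hP2 : P ≤ 2) {N : ℝ → ℝ≥0∞} (hN : Measurable N)
    {w : ℤ → ℝ → ℝ≥0∞} (hw : ∀ n, Measurable (w n)) (hw1 : ∀ s, ∑' n, w n s ≤ 1) :
    ∑' n, ((∫⁻ s, (N s * w n s ^ ((1 : ℝ) / 2)) ^ P) ^ (1 / P)) ^ 2 ≤
      ((∫⁻ s, N s ^ P) ^ (1 / P)) ^ 2 := by
  have e1 : 0 ≤ 1 - P / 2 := by linarith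
  have e2 : 0 ≤ 2 / P - 1 := by
    have : 1 ≤ 2 / P := by rwa [le_div_iff₀ hP0, one_mul]
    linarith
  set A := ∫⁻ s, N s ^ P with hA
  have h1 : ∀ n, ((∫⁻ s, (N s * w n s ^ ((1 : ℝ) / 2)) ^ P) ^ (1 / P)) ^ 2 ≤
      A ^ (2 / P - 1) * ∫⁻ s, N s ^ P * w n s := by
    intro n
    have h2 := ENNReal.lintegral_mul_norm_pow_le (μ := volume) (f := fun s => N s ^ P)
      (g := fun s => N s ^ P * w n s) (hN.pow_const _).aemeasurable
      ((hN.pow_const _).mul (hw n)).aemeasurable (p := 1 - P / 2) (q := P / 2) e1 (by positivity)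
      (by ring)
    have h3 : ∀ s, (N s * w n s ^ ((1 : ℝ) / 2)) ^ P =
        (N s ^ P) ^ (1 - P / 2) * (N s ^ P * w n s) ^ (P / 2) := by
      intro s
      rw [ENNReal.mul_rpow_of_nonneg _ _ hP0.le, ENNReal.mul_rpow_of_nonneg _ _ (by positivity),
        ← ENNReal.rpow_mul, ← mul_assoc, ← ENNReal.rpow_add_of_nonneg _ _ e1 (by positivity)]
      rw [show 1 - P / 2 + P / 2 = 1 by ring, ENNReal.rpow_one, show 1 / 2 * P = P / 2 by ring]
    simp_rw [h3]
    rw [← ENNReal.rpow_natCast, ← ENNReal.rpow_mul]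
    calc _ ≤ (A ^ (1 - P / 2) * (∫⁻ s, N s ^ P * w n s) ^ (P / 2)) ^ (1 / P * (2 : ℕ)) := by
          gcongr
      _ = _ := by
          rw [ENNReal.mul_rpow_of_nonneg _ _ (by positivity), ← ENNReal.rpow_mul,
            ← ENNReal.rpow_mul]
          congr 1
          · congr 1; push_cast; field_simp
          · rw [show P / 2 * (1 / P * (2 : ℕ)) = 1 by push_cast; field_simp, ENNReal.rpow_one]
  calc _ ≤ ∑' n, A ^ (2 / P - 1) * ∫⁻ s, N s ^ P * w n s := by gcongr with n; exact h1 n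
    _ = A ^ (2 / P - 1) * ∫⁻ s, N s ^ P * ∑' n, w n s := by
        have hm : ∀ n, AEMeasurable (fun s => N s ^ P * w n s) volume :=
          fun n => ((hN.pow_const _).mul (hw n)).aemeasurable
        rw [ENNReal.tsum_mul_left, ← lintegral_tsum hm]
        simp_rw [ENNReal.tsum_mul_left]
    _ ≤ A ^ (2 / P - 1) * ∫⁻ s, N s ^ P * 1 := by
        gcongr with s; exact hw1 s
    _ = _ := by
        simp only [mul_one]
        rw [← hA, ← ENNReal.rpow_natCast, ← ENNReal.rpow_mul,
          show 1 / P * ((2 : ℕ) : ℝ) = (2 / P - 1) + 1 by push_cast; ring,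
          ENNReal.rpow_add_of_nonneg _ _ e2 zero_le_one, ENNReal.rpow_one]

/-- bounded measurable functions with bounded support. -/
def NiceF {Z : Type*} [NormedAddCommGroup Z] [MeasurableSpace Z] (G : Z → ℂ) : Prop :=
  Measurable G ∧ ∃ M : ℝ, (∀ z, ‖G z‖ ≤ M) ∧ ∀ z, G z ≠ 0 → ‖z‖ ≤ M

section KT
variable {H : Type*} [NormedAddCommGroup H] [InnerProductSpace ℂ H] [CompleteSpace H]

lemma NiceF.integrable_smul {Z : Type*} [NormedAddCommGroup Z] [MeasurableSpace Z] [BorelSpace Z]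
    [ProperSpace Z] [SecondCountableTopology Z] {μ : Measure Z} [IsFiniteMeasureOnCompacts μ]
    {G : Z → ℂ} (hG : NiceF G) {e : Z → H} (he : Continuous e) {M0 : ℝ} (hM0 : ∀ z, ‖e z‖ ≤ M0) :
    Integrable (fun z => G z • e z) μ := by
  obtain ⟨hGm, M, hM, hs⟩ := hG
  have hi : Integrable ((Metric.closedBall (0 : Z) M).indicator fun _ => M * M0) μ := by
    rw [integrable_indicator_iff measurableSet_closedBall]
    exact integrableOn_const (isCompact_closedBall _ _).measure_lt_top.ne
  refine hi.mono' (hGm.stronglyMeasurable.smul he.stronglyMeasurable).aestronglyMeasurable ?_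
  refine Filter.Eventually.of_forall fun z => ?_
  by_cases hz : G z = 0
  · rw [hz, zero_smul, norm_zero]
    apply Set.indicator_nonneg
    intro z _
    exact mul_nonneg ((norm_nonneg _).trans (hM z)) ((norm_nonneg _).trans (hM0 z))
  · rw [Set.indicator_of_mem (by simpa using hs z hz), norm_smul]
    exact mul_le_mul (hM z) (hM0 z) (norm_nonneg _) ((norm_nonneg _).trans (hM z))

lemma NiceF.indicator {Z : Type*} [NormedAddCommGroup Z] [MeasurableSpace Z]
    {G : Z → ℂ} (hG : NiceF G) {S : Set Z} (hS : MeasurableSet S) : NiceF (S.indicator G) := by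
  obtain ⟨hGm, M, hM, hs⟩ := hG
  refine ⟨hGm.indicator hS, M, fun z => (norm_indicator_le_norm_self _ _).trans (hM z), ?_⟩
  intro z hz
  apply hs
  intro h
  apply hz
  by_cases hzS : z ∈ S
  · rw [Set.indicator_of_mem hzS, h]
  · rw [Set.indicator_of_notMem hzS]

lemma NiceF.slice {Z : Type*} [NormedAddCommGroup Z] [MeasurableSpace Z]
    {G : ℝ × Z → ℂ} (hG : NiceF G) (s : ℝ) : NiceF (fun x => G (s, x)) := by
  obtain ⟨hGm, M, hM, hs⟩ := hG
  exact ⟨hGm.comp measurable_prodMk_left, M, fun x => hM _,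
    fun x hx => (le_max_right _ _).trans (hs (s, x) hx)⟩

lemma NiceF.lint {Z : Type*} [NormedAddCommGroup Z] [MeasurableSpace Z] [BorelSpace Z]
    [ProperSpace Z] {μ : Measure Z} [IsFiniteMeasureOnCompacts μ]
    {G : Z → ℂ} (hG : NiceF G) {Q : ℝ} (hQ : 0 < Q) : ∫⁻ z, ‖G z‖ₑ ^ Q ∂μ ≠ ∞ := by
  obtain ⟨hGm, M, hM, hs⟩ := hG
  have : ∫⁻ z, ‖G z‖ₑ ^ Q ∂μ ≤
      ∫⁻ z, (Metric.closedBall (0 : Z) M).indicator (fun _ => ENNReal.ofReal M ^ Q) z ∂μ := by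
    apply lintegral_mono
    intro z
    by_cases hz : G z = 0
    · simp [hz, hQ]
    · rw [Set.indicator_of_mem (by simpa using hs z hz)]
      simp only
      gcongr
      rw [← ofReal_norm]; exact ENNReal.ofReal_le_ofReal (hM z)
  refine ne_top_of_le_ne_top ?_ this
  rw [lintegral_indicator_const measurableSet_closedBall]
  exact ENNReal.mul_ne_top (by finiteness) (isCompact_closedBall _ _).measure_lt_top.ne

/-- The abstract Keel-Tao estimate. -/
theorem kt_main {d : ℕ} {p p' q q' σ : ℝ} (hp' : p'.HolderConjugate p) (hq' : q'.HolderConjugate q)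
    (hp : 2 ≤ p) (hq : 2 < q) (hσ : 0 < σ)
    (hpq : 1 / p = σ * (1 / 2 - 1 / q)) (D E : ℝ≥0∞) (hD : D ≠ ∞) (hE : E ≠ ∞)
    (e : ℝ × Eu d → H) (he : Continuous e) {M0 : ℝ} (hM0 : ∀ z, ‖e z‖ ≤ M0)
    (hdisp : ∀ t s x y, ‖(inner ℂ (e (t, x)) (e (s, y)) : ℂ)‖ₑ ≤ D * ENNReal.ofReal |t - s| ^ (-σ))
    (hL2 : ∀ t (g : Eu d → ℂ), NiceF g →
      ‖∫ x, g x • e (t, x)‖ₑ ≤ E * (∫⁻ x, ‖g x‖ₑ ^ 2) ^ ((1 : ℝ) / 2)) :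
    ∃ C : ℝ≥0∞, C ≠ ∞ ∧ ∀ G : ℝ × Eu d → ℂ, NiceF G → ‖∫ z, G z • e z‖ₑ ^ 2 ≤
      C * ((∫⁻ s, ((∫⁻ x, ‖G (s, x)‖ₑ ^ q') ^ (1 / q')) ^ p') ^ (1 / p')) ^ 2 := by
  have hq'1 : 1 < q' := hq'.lt
  have hqq : 1 / q' + 1 / q = 1 := by simpa using hq'.inv_add_inv_eq_one
  have hq'0 : 0 < q' := by linarith
  have hq0 : 0 < q := by linarith
  have hinv : ∀ {r r' : ℝ}, r'.HolderConjugate r → 2 ≤ r → r' ≤ 2 := by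
    intro r r' h hr
    have h1 := h.inv_add_inv_eq_one
    have h2 : r⁻¹ ≤ 2⁻¹ := by gcongr
    have h3 : 2⁻¹ ≤ r'⁻¹ := by linarith
    rwa [inv_le_inv₀ (by norm_num) h.pos] at h3
  have hp'2 : p' ≤ 2 := hinv hp' hp
  have hq'2 : q' < 2 := by
    have h1 := hq'.inv_add_inv_eq_one
    have h2 : q⁻¹ < 2⁻¹ := by gcongr
    have h3 : 2⁻¹ < q'⁻¹ := by linarith
    rwa [inv_lt_inv₀ (by norm_num) hq'.pos] at h3
  obtain ⟨C, hC, hsum⟩ := kt_sum (H := H) (a := q') hp' hp hq hσ hpq hq'0 D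
    (E * 2 ^ (1 - q' / 2)) hD (by finiteness)
  refine ⟨C, hC, ?_⟩
  intro G hG
  have hGm : Measurable G := hG.1
  have hem : Measurable fun z => ‖G z‖ₑ := hGm.enorm
  set I : ℝ → ℝ≥0∞ := fun s => ∫⁻ x, ‖G (s, x)‖ₑ ^ q' with hI
  have hImeas : Measurable I :=
    Measurable.lintegral_prod_right' (f := fun z : ℝ × Eu d => ‖G z‖ₑ ^ q') (hem.pow_const _)
  have hIt : ∀ s, I s ≠ ∞ := fun s => (hG.slice s).lint hq'0
  set N : ℝ → ℝ≥0∞ := fun s => I s ^ (1 / q') with hN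
  have hNmeas : Measurable N := hImeas.pow_const _
  have hNt : ∀ s, N s ≠ ∞ := fun s => ENNReal.rpow_ne_top_of_nonneg (by positivity) (hIt s)
  set A : ℤ → Set (ℝ × Eu d) := fun n =>
    {z | 2 ^ (n : ℝ) * N z.1 < ‖G z‖ₑ ∧ ‖G z‖ₑ ≤ 2 ^ ((n : ℝ) + 1) * N z.1} with hA
  have hAm : ∀ n, MeasurableSet (A n) := fun n =>
    (measurableSet_lt ((hNmeas.comp measurable_fst).const_mul _) hem).inter
      (measurableSet_le hem ((hNmeas.comp measurable_fst).const_mul _))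
  have hAs : ∀ n s x, (s, x) ∈ A n ↔ x ∈ LevS (fun x => ‖G (s, x)‖ₑ) (N s) n := fun n s x => Iff.rfl
  set Gn : ℤ → ℝ × Eu d → ℂ := fun n => (A n).indicator G with hGn
  have hGnn : ∀ n, NiceF (Gn n) := fun n => hG.indicator (hAm n)
  set In : ℤ → ℝ → ℝ≥0∞ := fun n s => ∫⁻ x in LevS (fun x => ‖G (s, x)‖ₑ) (N s) n, ‖G (s, x)‖ₑ ^ q'
    with hIn
  have hslm : ∀ s, Measurable fun x => ‖G (s, x)‖ₑ := fun s => hem.comp measurable_prodMk_left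
  have hslice : ∀ (n : ℤ) (s : ℝ) (r : ℝ), 0 < r → ∫⁻ x, ‖Gn n (s, x)‖ₑ ^ r =
      ∫⁻ x in LevS (fun x => ‖G (s, x)‖ₑ) (N s) n, ‖G (s, x)‖ₑ ^ r := by
    intro n s r hr
    rw [← lintegral_indicator (LevS_meas (hslm s) _ _)]
    congr 1; ext x
    by_cases hx : x ∈ LevS (fun x => ‖G (s, x)‖ₑ) (N s) n
    · rw [Set.indicator_of_mem hx, hGn]; simp only
      rw [Set.indicator_of_mem ((hAs n s x).2 hx)]
    · rw [Set.indicator_of_notMem hx, hGn]; simp only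
      rw [Set.indicator_of_notMem (fun h => hx ((hAs n s x).1 h))]
      simp [hr]
  have hInm : ∀ n, Measurable (In n) := by
    intro n
    have : In n = fun s => ∫⁻ x, ‖Gn n (s, x)‖ₑ ^ q' := by
      ext s; rw [hslice n s q' hq'0]
    rw [this]
    exact Measurable.lintegral_prod_right' (f := fun z : ℝ × Eu d => ‖Gn n z‖ₑ ^ q')
      ((hGnn n).1.enorm.pow_const _)
  set w : ℤ → ℝ → ℝ≥0∞ := fun n s => In n s / I s with hw
  have hwm : ∀ n, Measurable (w n) := fun n => (hInm n).div hImeas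
  set c : ℤ → ℝ → ℝ≥0∞ := fun n s => N s * w n s ^ ((1 : ℝ) / 2) with hc
  have hcm : ∀ n, Measurable (c n) := fun n => hNmeas.mul ((hwm n).pow_const _)
  have hlev := fun n s => LevS_bounds (hslm s) volume hq'1 hq'2 (hIt s) n
  set f : ℤ → ℝ → H := fun n s => ∫ x, Gn n (s, x) • e (s, x) with hf
  have hint : ∀ n, Integrable (fun z => Gn n z • e z) ((volume : Measure ℝ).prod volume) :=
    fun n => (hGnn n).integrable_smul he hM0
  have hfi : ∀ n, Integrable (f n) := fun n => (hint n).integral_prod_left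
  have hff : ∀ n, ∫ s, f n s = ∫ z, Gn n z • e z := fun n => (integral_prod _ (hint n)).symm
  have hes : ∀ s, Continuous fun x => e (s, x) := fun s => by fun_prop
  have hL1 : ∀ n s, ∫⁻ x, ‖Gn n (s, x)‖ₑ ≤ 2 ^ ((-(q' * n)) / q) * c n s := by
    intro n s
    have h1 := hslice n s 1 one_pos
    simp only [ENNReal.rpow_one] at h1
    rw [h1, show (-(q' * n)) / q = -(n * (q' - 1)) by
      have : q' - 1 = q' / q := by field_simp at hqq ⊢; linarith
      rw [this]; ring]
    exact (hlev n s).1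
  have hB1 : ∀ n m t s, ‖(inner ℂ (f n t) (f m s) : ℂ)‖ₑ ≤
        D * ENNReal.ofReal |t - s| ^ (-σ) * (2 ^ ((-(q' * m)) / q) * c m s) *
          (2 ^ ((-(q' * n)) / q) * c n t) := by
    intro n m t s
    set K := D * ENNReal.ofReal |t - s| ^ (-σ) with hK
    have i1 := ((hGnn n).slice t).integrable_smul (μ := volume) (hes t) (fun x => hM0 _)
    have i2 := ((hGnn m).slice s).integrable_smul (μ := volume) (hes s) (fun x => hM0 _)
    simp only [hf]
    rw [inner_integral_left i1]
    have m1 : Measurable fun x => ‖Gn n (t, x)‖ₑ := (hGnn n).1.enorm.comp measurable_prodMk_left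
    have m2 : Measurable fun x => ‖Gn m (s, x)‖ₑ := (hGnn m).1.enorm.comp measurable_prodMk_left
    calc _ ≤ ∫⁻ x, ∫⁻ y, ‖(inner ℂ (Gn n (t, x) • e (t, x)) (Gn m (s, y) • e (s, y)) : ℂ)‖ₑ := by
          refine (enorm_integral_le_lintegral_enorm _).trans ?_
          gcongr with x
          rw [inner_integral_right i2]
          exact enorm_integral_le_lintegral_enorm _
      _ ≤ ∫⁻ x, ∫⁻ y, (‖Gn n (t, x)‖ₑ * K) * ‖Gn m (s, y)‖ₑ := by
          gcongr with x y
          rw [inner_smul_left, inner_smul_right, enorm_mul, enorm_mul]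
          have : ‖(starRingEnd ℂ) (Gn n (t, x))‖ₑ = ‖Gn n (t, x)‖ₑ := by
            rw [← ofReal_norm, RCLike.norm_conj, ofReal_norm]
          rw [this]
          calc _ ≤ ‖Gn n (t, x)‖ₑ * (‖Gn m (s, y)‖ₑ * K) := by gcongr; exact hdisp t s x y
            _ = _ := by ring
      _ = (∫⁻ x, ‖Gn n (t, x)‖ₑ) * K * ∫⁻ y, ‖Gn m (s, y)‖ₑ := by
          simp_rw [lintegral_const_mul _ m2]
          have : ∀ x, ‖Gn n (t, x)‖ₑ * K * (∫⁻ y, ‖Gn m (s, y)‖ₑ) =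
            ‖Gn n (t, x)‖ₑ * (K * (∫⁻ y, ‖Gn m (s, y)‖ₑ)) := fun x => by ring
          simp_rw [this]
          rw [lintegral_mul_const _ m1]; ring
      _ ≤ (2 ^ ((-(q' * n)) / q) * c n t) * K * (2 ^ ((-(q' * m)) / q) * c m s) := by
          gcongr
          · exact hL1 n t
          · exact hL1 m s
      _ = _ := by ring
  have hB2 : ∀ n s, ‖f n s‖ₑ ≤ E * 2 ^ (1 - q' / 2) *
      (2 ^ (-(-(q' * n) * (1 / 2 - 1 / q))) * c n s) := by
    intro n s
    refine (hL2 s _ ((hGnn n).slice s)).trans ?_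
    have h1 := hslice n s 2 two_pos
    have h2 := (hlev n s).2
    simp only [ENNReal.rpow_two] at h1
    rw [h1, mul_assoc, ← mul_assoc (2 ^ (1 - q' / 2)),
      ← ENNReal.rpow_add _ _ (by norm_num) (by norm_num)]
    gcongr
    rw [show 1 - q' / 2 + -(-(q' * n) * (1 / 2 - 1 / q)) = (n + 1) * (1 - q' / 2) by
      have : 1 / q = 1 - 1 / q' := by linarith
      rw [this]; field_simp; ring]
    exact h2
  have hfin := hsum f hfi c hcm hB1 hB2
  have hcs := coef_sum hp'.pos hp'2 hNmeas hwm (fun s => LevS_sum (hslm s) volume (N s) q')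
  have hdisj : Pairwise (Function.onFun Disjoint A) := by
    intro i j hij
    rw [Function.onFun, Set.disjoint_left]
    rintro ⟨s, x⟩ h1 h2
    exact Set.disjoint_left.1 (LevS_disj (fun x => ‖G (s, x)‖ₑ) (N s) hij) h1 h2
  have hIG : Integrable (fun z => G z • e z) ((volume : Measure ℝ).prod volume) :=
    hG.integrable_smul he hM0
  have hHS := hasSum_integral_iUnion (μ := (volume : Measure ℝ).prod (volume : Measure (Eu d)))
    hAm hdisj hIG.integrableOn
  have hterm : ∀ n, ∫ z in A n, G z • e z ∂((volume : Measure ℝ).prod volume) = ∫ s, f n s := by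
    intro n
    rw [hff, ← integral_indicator (hAm n)]
    congr 1; ext z
    by_cases hz : z ∈ A n
    · simp [hGn, hz]
    · simp [hGn, hz]
  have hall : ∫ z in ⋃ n, A n, G z • e z ∂((volume : Measure ℝ).prod volume) = ∫ z, G z • e z := by
    rw [← integral_indicator (MeasurableSet.iUnion hAm)]
    apply integral_congr_ae
    have hnull : ∀ᵐ z ∂((volume : Measure ℝ).prod (volume : Measure (Eu d))),
        N z.1 = 0 → G z = 0 := by
      have hms : MeasurableSet {z : ℝ × Eu d | N z.1 = 0 → G z = 0} := by
        have : {z : ℝ × Eu d | N z.1 = 0 → G z = 0} =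
            {z : ℝ × Eu d | N z.1 = 0}ᶜ ∪ {z | G z = 0} := by
          ext z; simp [imp_iff_not_or]
        rw [this]
        exact ((hNmeas.comp measurable_fst) (measurableSet_singleton 0)).compl.union
          (hGm (measurableSet_singleton 0))
      rw [Measure.ae_prod_iff_ae_ae hms]
      refine Filter.Eventually.of_forall fun s => ?_
      by_cases hs : N s = 0
      · have hIs : I s = 0 := by
          have := (ENNReal.rpow_eq_zero_iff_of_pos (show 0 < 1 / q' by positivity)).1 hs
          exact this
        rw [hI] at hIs
        simp only at hIs
        rw [lintegral_eq_zero_iff ((hslm s).pow_const _)] at hIs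
        filter_upwards [hIs] with x hx _
        simpa [hq'0, hq'0.le, ENNReal.rpow_eq_zero_iff_of_pos hq'0] using hx
      · exact Filter.Eventually.of_forall fun x hx => absurd hx hs
    filter_upwards [hnull] with z hz
    by_cases hzA : z ∈ ⋃ n, A n
    · rw [Set.indicator_of_mem hzA]
    · rw [Set.indicator_of_notMem hzA]
      have : G z = 0 := by
        by_contra h0
        have hNz : N z.1 ≠ 0 := fun h => h0 (hz h)
        obtain ⟨n, hn⟩ := LevS_cover (g := fun x => ‖G (z.1, x)‖ₑ) (x := z.2) hNz (hNt z.1)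
          (by simpa using h0) (by simp)
        exact hzA (Set.mem_iUnion.2 ⟨n, hn⟩)
      rw [this, zero_smul]
  rw [hall] at hHS
  simp_rw [hterm] at hHS
  have hlim : Filter.Tendsto (fun S : Finset ℤ => ‖∑ n ∈ S, ∫ s, f n s‖ₑ ^ 2) Filter.atTop
      (nhds (‖∫ z, G z • e z‖ₑ ^ 2)) :=
    (ENNReal.continuous_pow 2).continuousAt.tendsto.comp hHS.enorm
  refine le_of_tendsto' hlim fun S => (hfin S).trans ?_
  gcongr
end KT

lemma thetaP_sub {d : ℕ} (t s : ℝ) (x y ξ : Eu d) :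
    thetaP t x ξ - thetaP s y ξ = thetaP (t - s) (x - y) ξ := by
  unfold thetaP
  rw [inner_sub_left]; ring

lemma thetaP_cont3 {d : ℕ} : Continuous fun w : (ℝ × Eu d) × Eu d => thetaP w.1.1 w.1.2 w.2 := by
  unfold thetaP; fun_prop

lemma phiB_integrable {d : ℕ} : Integrable (phiB (d := d)) :=
  phiB_smooth.continuous.integrable_of_hasCompactSupport phiB_hcs

lemma Kd_cont {d : ℕ} : Continuous fun z : ℝ × Eu d => Kd z.1 z.2 := by
  unfold Kd
  have hp : Continuous (phiB (d := d)) := phiB_smooth.continuous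
  apply continuous_of_dominated (bound := phiB)
  · intro z
    have := thetaP_cont z.1 z.2
    exact Continuous.aestronglyMeasurable (by fun_prop)
  · intro z
    refine Filter.Eventually.of_forall fun ξ => ?_
    rw [norm_mul, Complex.norm_exp_ofReal_mul_I, one_mul]
    simp [abs_of_nonneg (phiB_nonneg ξ)]
  · exact phiB_integrable
  · refine Filter.Eventually.of_forall fun ξ => ?_
    have : Continuous fun z : ℝ × Eu d => thetaP z.1 z.2 ξ :=
      thetaP_cont3.comp (continuous_id.prodMk continuous_const)
    fun_prop

lemma Kd_zero_integrable {d : ℕ} : Integrable (Kd (d := d) 0) := by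
  have hc : ContDiff ℝ (⊤ : ℕ∞) (fun ξ : Eu d => (phiB ξ : ℂ)) :=
    Complex.ofRealCLM.contDiff.comp phiB_smooth
  have hs : HasCompactSupport (fun ξ : Eu d => (phiB ξ : ℂ)) :=
    phiB_hcs.comp_left (g := fun r : ℝ => (r : ℂ)) (by simp)
  let f : 𝓢(Eu d, ℂ) := hs.toSchwartzMap hc
  have : Kd (d := d) 0 = (𝓕⁻ f : 𝓢(Eu d, ℂ)) := by
    ext x
    rw [SchwartzMap.fourierInv_coe, Real.fourierInv_eq']
    unfold Kd
    congr 1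
    ext ξ
    have e1 : f ξ = (phiB ξ : ℂ) := rfl
    rw [e1, smul_eq_mul]
    congr 3
    unfold thetaP
    rw [real_inner_comm]; simp
  rw [this]
  exact SchwartzMap.integrable _

/-- square root of cutoff times conjugate character. -/
noncomputable def eFun {d : ℕ} (z : ℝ × Eu d) (ξ : Eu d) : ℂ :=
  Complex.exp ((-thetaP z.1 z.2 ξ : ℝ) * I) * (Real.sqrt (phiB ξ) : ℂ)

lemma eFun_memLp {d : ℕ} (z : ℝ × Eu d) : MemLp (eFun z) 2 volume := by
  apply Continuous.memLp_of_hasCompactSupport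
  · unfold eFun
    have := thetaP_cont z.1 z.2
    have hp : Continuous (phiB (d := d)) := phiB_smooth.continuous
    fun_prop
  · apply HasCompactSupport.mul_left
    exact phiB_hcs.comp_left (g := fun r : ℝ => (Real.sqrt r : ℂ)) (by simp)

noncomputable def eV {d : ℕ} (z : ℝ × Eu d) : Lp ℂ 2 (volume : Measure (Eu d)) :=
  (eFun_memLp z).toLp _

lemma eV_inner {d : ℕ} (z : ℝ × Eu d) (h : Eu d → ℂ) (hh : MemLp h 2 volume) :
    (inner ℂ (eV z) (hh.toLp h) : ℂ) =
      ∫ ξ, Complex.exp ((thetaP z.1 z.2 ξ : ℝ) * I) * (Real.sqrt (phiB ξ) : ℂ) * h ξ := by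
  rw [L2.inner_def]
  apply integral_congr_ae
  filter_upwards [(eFun_memLp z).coeFn_toLp, hh.coeFn_toLp] with ξ h1 h2
  unfold eV
  rw [h1, h2, RCLike.inner_apply, mul_comm]
  congr 1
  unfold eFun
  rw [map_mul, ← Complex.exp_conj]
  simp

lemma eV_inner_eV {d : ℕ} (z w : ℝ × Eu d) :
    (inner ℂ (eV z) (eV w) : ℂ) = Kd (z.1 - w.1) (z.2 - w.2) := by
  rw [eV, eV, ← eV, eV_inner]
  unfold Kd eFun
  congr 1; ext ξ
  rw [← thetaP_sub]
  have : (phiB ξ : ℂ) = (Real.sqrt (phiB ξ) : ℂ) * (Real.sqrt (phiB ξ) : ℂ) := by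
    rw [← Complex.ofReal_mul, Real.mul_self_sqrt (phiB_nonneg ξ)]
  rw [this]
  have h2 : Complex.exp (((thetaP z.1 z.2 ξ - thetaP w.1 w.2 ξ : ℝ) : ℂ) * I) =
      Complex.exp ((thetaP z.1 z.2 ξ : ℝ) * I) * Complex.exp ((-thetaP w.1 w.2 ξ : ℝ) * I) := by
    rw [← Complex.exp_add]; push_cast; ring_nf
  rw [h2]; ring

lemma eV_cont {d : ℕ} : Continuous (eV (d := d)) := by
  rw [continuous_iff_continuousAt]
  intro z
  unfold ContinuousAt
  rw [tendsto_iff_norm_sub_tendsto_zero]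
  have h1 : ∀ w : ℝ × Eu d, ‖eV w - eV z‖ =
      Real.sqrt (RCLike.re (Kd (d := d) 0 0 - Kd (w.1 - z.1) (w.2 - z.2) - Kd (z.1 - w.1) (z.2 - w.2) + Kd (d := d) 0 0)) := by
    intro w
    rw [norm_eq_sqrt_re_inner (𝕜 := ℂ)]
    congr 2
    rw [inner_sub_left, inner_sub_right, inner_sub_right]
    simp only [eV_inner_eV, sub_self]
    ring
  simp_rw [h1]
  have hK := Kd_cont (d := d)
  have hc : Continuous fun w : ℝ × Eu d => Real.sqrt (RCLike.re (Kd (d := d) 0 0 -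
      Kd (w.1 - z.1) (w.2 - z.2) - Kd (z.1 - w.1) (z.2 - w.2) + Kd (d := d) 0 0)) := by
    have a1 : Continuous fun w : ℝ × Eu d => Kd (w.1 - z.1) (w.2 - z.2) :=
      hK.comp (f := fun w : ℝ × Eu d => (w.1 - z.1, w.2 - z.2)) (by fun_prop)
    have a2 : Continuous fun w : ℝ × Eu d => Kd (z.1 - w.1) (z.2 - w.2) :=
      hK.comp (f := fun w : ℝ × Eu d => (z.1 - w.1, z.2 - w.2)) (by fun_prop)
    exact Real.continuous_sqrt.comp (RCLike.continuous_re.comp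
      (((continuous_const.sub a1).sub a2).add continuous_const))
  have := hc.tendsto z
  simpa using this

lemma eV_bound {d : ℕ} : ∃ M0 : ℝ, ∀ z : ℝ × Eu d, ‖eV z‖ ≤ M0 := by
  refine ⟨Real.sqrt (RCLike.re (Kd (d := d) 0 0)), fun z => ?_⟩
  rw [norm_eq_sqrt_re_inner (𝕜 := ℂ), eV_inner_eV]
  simp

lemma eV_L2 {d : ℕ} : ∃ E : ℝ≥0∞, E ≠ ∞ ∧ ∀ t (g : Eu d → ℂ), NiceF g →
      ‖∫ x, g x • eV (t, x)‖ₑ ≤ E * (∫⁻ x, ‖g x‖ₑ ^ 2) ^ ((1 : ℝ) / 2) := by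
  set k : Eu d → ℝ≥0∞ := fun x => ‖Kd (d := d) 0 x‖ₑ with hk
  have hkc : Continuous (Kd (d := d) 0) :=
    Kd_cont.comp (f := fun x : Eu d => ((0 : ℝ), x)) (by fun_prop)
  have hkm : Measurable k := hkc.measurable.enorm
  set A := ∫⁻ x, k x with hA
  have hAt : A ≠ ∞ := (Kd_zero_integrable (d := d)).2.ne
  refine ⟨(2 * A) ^ ((1 : ℝ) / 2), by finiteness, ?_⟩
  intro t g hg
  obtain ⟨M0, hM0⟩ := eV_bound (d := d)
  have hi : Integrable (fun x => g x • eV (t, x)) :=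
    hg.integrable_smul (eV_cont.comp (by fun_prop)) (fun z => hM0 _)
  have hgm : Measurable fun x => ‖g x‖ₑ := hg.1.enorm
  have h1 := enorm_sq_integral_le hi
  have hle : ∫⁻ s, ∫⁻ s', ‖(inner ℂ (g s • eV (t, s)) (g s' • eV (t, s')) : ℂ)‖ₑ ≤
      2 * A * ∫⁻ x, ‖g x‖ₑ ^ 2 := by
    calc _ ≤ ∫⁻ s, ∫⁻ s', (k (s - s') * ‖g s‖ₑ ^ 2 + k (s - s') * ‖g s'‖ₑ ^ 2) := by
          apply lintegral_mono; intro s; apply lintegral_mono; intro s'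
          simp only
          rw [inner_smul_left, inner_smul_right, eV_inner_eV]
          simp only [sub_self, enorm_mul, RCLike.enorm_conj]
          have : ‖g s‖ₑ * ‖g s'‖ₑ ≤ ‖g s‖ₑ ^ 2 + ‖g s'‖ₑ ^ 2 := by
            rcases le_total ‖g s‖ₑ ‖g s'‖ₑ with h | h
            · calc _ ≤ ‖g s'‖ₑ * ‖g s'‖ₑ := by gcongr
                _ = ‖g s'‖ₑ ^ 2 := by ring
                _ ≤ _ := le_add_self
            · calc _ ≤ ‖g s‖ₑ * ‖g s‖ₑ := by gcongr
                _ = ‖g s‖ₑ ^ 2 := by ring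
                _ ≤ _ := le_self_add
          calc _ = k (s - s') * (‖g s‖ₑ * ‖g s'‖ₑ) := by rw [hk]; ring
            _ ≤ k (s - s') * (‖g s‖ₑ ^ 2 + ‖g s'‖ₑ ^ 2) := by gcongr
            _ = _ := by ring
      _ = (∫⁻ s, ∫⁻ s', k (s - s') * ‖g s‖ₑ ^ 2) + ∫⁻ s, ∫⁻ s', k (s - s') * ‖g s'‖ₑ ^ 2 := by
          rw [← lintegral_add_left]
          · congr 1; ext s
            rw [lintegral_add_left]
            exact (hkm.comp (measurable_const.sub measurable_id)).mul_const _
          · exact Measurable.lintegral_prod_right' (f := fun z : Eu d × Eu d => k (z.1 - z.2) * ‖g z.1‖ₑ ^ 2)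
              ((hkm.comp (measurable_fst.sub measurable_snd)).mul ((hgm.comp measurable_fst).pow_const _))
      _ = A * (∫⁻ x, ‖g x‖ₑ ^ 2) + A * ∫⁻ x, ‖g x‖ₑ ^ 2 := by
          congr 1
          · rw [← lintegral_const_mul _ (hgm.pow_const 2)]
            congr 1; ext s
            rw [lintegral_mul_const _ (show Measurable fun s' => k (s - s') from hkm.comp (measurable_const.sub measurable_id)),
              lintegral_sub_left_eq_self k s]
          · rw [lintegral_lintegral_swap, ← lintegral_const_mul _ (hgm.pow_const 2)]
            · congr 1; ext s
              rw [lintegral_mul_const _ (show Measurable fun x => k (x - s) from hkm.comp (measurable_id.sub measurable_const)),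
                lintegral_sub_right_eq_self k s]
            · exact ((hkm.comp (measurable_fst.sub measurable_snd)).mul ((hgm.comp measurable_snd).pow_const _)).aemeasurable
      _ = _ := by ring
  have h2 : ‖∫ x, g x • eV (t, x)‖ₑ = (‖∫ x, g x • eV (t, x)‖ₑ ^ 2) ^ ((1 : ℝ) / 2) := by
    rw [← ENNReal.rpow_natCast, ← ENNReal.rpow_mul]; norm_num
  rw [h2, ← ENNReal.mul_rpow_of_nonneg _ _ (by norm_num)]
  gcongr
  exact h1.trans hle

/-- Keel-Tao for the frequency localized flow, dual form. -/
theorem kt_flow {d : ℕ} {p p' q q' σ : ℝ} (hp' : p'.HolderConjugate p) (hq' : q'.HolderConjugate q)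
    (hp : 2 ≤ p) (hq : 2 < q) (hσ : 0 < σ) (hσd : σ ≤ d / 2)
    (hpq : 1 / p = σ * (1 / 2 - 1 / q)) :
    ∃ C : ℝ≥0∞, C ≠ ∞ ∧ ∀ G : ℝ × Eu d → ℂ, NiceF G → ‖∫ z, G z • eV z‖ₑ ^ 2 ≤
      C * ((∫⁻ s, ((∫⁻ x, ‖G (s, x)‖ₑ ^ q') ^ (1 / q')) ^ p') ^ (1 / p')) ^ 2 := by
  obtain ⟨M0, hM0⟩ := eV_bound (d := d)
  obtain ⟨E, hE, hL2⟩ := eV_L2 (d := d)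
  obtain ⟨D, hD0, hD1, hD⟩ := dispersive (d := d)
  refine kt_main hp' hq' hp hq hσ hpq (ENNReal.ofReal D) E (by finiteness) hE eV eV_cont hM0 ?_ hL2
  intro t s x y
  rw [eV_inner_eV]
  by_cases hts : t = s
  · subst hts
    simp only [sub_self, abs_zero, ENNReal.ofReal_zero]
    rw [ENNReal.zero_rpow_of_neg (by linarith), ENNReal.mul_top (by simpa using hD0)]
    exact le_top
  · have h0 : t - s ≠ 0 := sub_ne_zero.mpr hts
    rw [ENNReal.ofReal_rpow_of_pos (abs_pos.mpr h0), ← ENNReal.ofReal_mul hD0.le, ← ofReal_norm]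
    exact ENNReal.ofReal_le_ofReal (hD σ hσ.le hσd _ _ h0)

section Dual
variable {H : Type*} [NormedAddCommGroup H] [InnerProductSpace ℂ H] [CompleteSpace H]

set_option maxHeartbeats 1000000 in
lemma dual_cut {d : ℕ} {p p' q q' : ℝ} (hp' : p'.HolderConjugate p) (hq' : q'.HolderConjugate q)
    (hq : 2 < q) (C : ℝ≥0∞)
    (e : ℝ × Eu d → H) (he : Continuous e) {M0 : ℝ} (hM0 : ∀ z, ‖e z‖ ≤ M0)
    (hC : ∀ G : ℝ × Eu d → ℂ, NiceF G → ‖∫ z, G z • e z‖ₑ ≤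
      C * (∫⁻ s, ((∫⁻ x, ‖G (s, x)‖ₑ ^ q') ^ (1 / q')) ^ p') ^ (1 / p'))
    (h : H) (M : ℝ) (hM : 0 < M) (n : ℝ → ℝ≥0∞)
    (hn : n = fun t => (∫⁻ x, (Metric.closedBall (0 : Eu d) M).indicator
      (fun x => ‖(inner ℂ (e (t, x)) h : ℂ)‖ₑ ^ q) x) ^ (1 / q)) :
    (∫⁻ t, {t : ℝ | |t| ≤ M ∧ ENNReal.ofReal (1 / M) ≤ n t}.indicator (fun t => n t ^ p) t) ^ (1 / p)
      ≤ C * ‖h‖ₑ := by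
  have hq0 : 0 < q := by linarith
  have hp0 : 0 < p := hp'.symm.pos
  have hp'0 : 0 < p' := hp'.pos
  have hq'0 : 0 < q' := hq'.pos
  set F : ℝ × Eu d → ℂ := fun z => inner ℂ (e z) h with hF
  have hFc : Continuous F := he.inner continuous_const
  have hFm : Measurable fun z => ‖F z‖ₑ := hFc.measurable.enorm
  set B := M0 * ‖h‖ with hB
  have hFB : ∀ z, ‖F z‖ ≤ B := fun z => (norm_inner_le_norm _ _).trans
    (mul_le_mul_of_nonneg_right (hM0 z) (norm_nonneg _))
  have hB0 : 0 ≤ B := (norm_nonneg _).trans (hFB 0)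
  set K := Metric.closedBall (0 : Eu d) M with hK
  have hKm : MeasurableSet K := measurableSet_closedBall
  have hn2 : ∀ t, n t = (∫⁻ x, K.indicator (fun x => ‖F (t, x)‖ₑ ^ q) x) ^ (1 / q) := by
    intro t; rw [hn]
  have hmeas0 : Measurable fun z : ℝ × Eu d => K.indicator (fun x => ‖F (z.1, x)‖ₑ ^ q) z.2 := by
    have : (fun z : ℝ × Eu d => K.indicator (fun x => ‖F (z.1, x)‖ₑ ^ q) z.2) =
        (Prod.snd ⁻¹' K).indicator fun z => ‖F z‖ₑ ^ q := by
      ext z; by_cases hz : z.2 ∈ K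
      · rw [Set.indicator_of_mem hz, Set.indicator_of_mem (show z ∈ Prod.snd ⁻¹' K from hz)]
      · rw [Set.indicator_of_notMem hz, Set.indicator_of_notMem (show z ∉ Prod.snd ⁻¹' K from hz)]
    rw [this]
    exact (hFm.pow_const _).indicator (measurable_snd hKm)
  have hnm : Measurable n := by
    rw [hn]
    exact (Measurable.lintegral_prod_right' hmeas0).pow_const _
  -- bound on n
  obtain ⟨N, hN0, hN⟩ : ∃ N : ℝ, 0 ≤ N ∧ ∀ t, n t ≤ ENNReal.ofReal N := by
    set V := (ENNReal.ofReal B ^ q * volume K) ^ (1 / q) with hV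
    have hVt : V ≠ ∞ := by
      have : volume K ≠ ∞ := (isCompact_closedBall _ _).measure_lt_top.ne
      finiteness
    refine ⟨V.toReal, by positivity, fun t => ?_⟩
    rw [ENNReal.ofReal_toReal hVt, hn2, hV]
    gcongr
    rw [← lintegral_indicator_const hKm]
    apply lintegral_mono
    intro x
    apply Set.indicator_le_indicator
    gcongr
    rw [← ofReal_norm]; exact ENNReal.ofReal_le_ofReal (hFB _)
  have hnt : ∀ t, n t ≠ ∞ := fun t => ne_top_of_le_ne_top (by finiteness) (hN t)
  set T := {t : ℝ | |t| ≤ M ∧ ENNReal.ofReal (1 / M) ≤ n t} with hT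
  have hTm : MeasurableSet T :=
    (measurableSet_le (f := fun t : ℝ => |t|) (by fun_prop) measurable_const).inter (measurableSet_le measurable_const hnm)
  set S : Set (ℝ × Eu d) := T ×ˢ K with hS
  have hSm : MeasurableSet S := hTm.prod hKm
  set w : ℝ × Eu d → ℝ := fun z => (n z.1).toReal ^ (p - q) * ‖F z‖ ^ (q - 2) with hw
  have hw0 : ∀ z, 0 ≤ w z := fun z => by positivity
  set G : ℝ × Eu d → ℂ := S.indicator fun z => (w z : ℂ) * F z with hG
  have hnT : ∀ t ∈ T, 1 / M ≤ (n t).toReal ∧ (n t).toReal ≤ N := by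
    intro t ht
    constructor
    · have := ENNReal.toReal_mono (hnt t) ht.2
      rwa [ENNReal.toReal_ofReal (by positivity)] at this
    · have := ENNReal.toReal_mono (by finiteness) (hN t)
      rwa [ENNReal.toReal_ofReal hN0] at this
  have hGn : NiceF G := by
    have hwm : Measurable w := by
      apply Measurable.mul
      · exact (hnm.comp measurable_fst).ennreal_toReal.pow_const _
      · exact hFc.measurable.norm.pow_const _
    refine ⟨((Complex.measurable_ofReal.comp hwm).mul hFc.measurable).indicator hSm,
      ((1 / M) ^ (p - q) + N ^ (p - q)) * B ^ (q - 2) * B + M, ?_, ?_⟩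
    · intro z
      by_cases hz : z ∈ S
      · rw [hG, Set.indicator_of_mem hz, norm_mul, Complex.norm_real, Real.norm_of_nonneg (hw0 z)]
        obtain ⟨h1, h2⟩ := hnT z.1 hz.1
        have h0 : 0 < 1 / M := by positivity
        have a1 : (n z.1).toReal ^ (p - q) ≤ (1 / M) ^ (p - q) + N ^ (p - q) := by
          rcases le_total p q with hpq | hpq
          · have := Real.rpow_le_rpow_of_nonpos h0 h1 (sub_nonpos.mpr hpq)
            have : 0 ≤ N ^ (p - q) := by positivity
            linarith
          · have := Real.rpow_le_rpow (h0.le.trans h1) h2 (sub_nonneg.mpr hpq)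
            have : 0 ≤ (1 / M) ^ (p - q) := by positivity
            linarith
        have a2 : ‖F z‖ ^ (q - 2) ≤ B ^ (q - 2) :=
          Real.rpow_le_rpow (norm_nonneg _) (hFB z) (by linarith)
        calc w z * ‖F z‖ ≤ ((1 / M) ^ (p - q) + N ^ (p - q)) * B ^ (q - 2) * B := by
              have := hFB z
              rw [hw]; simp only; gcongr
          _ ≤ _ := by linarith
      · rw [hG, Set.indicator_of_notMem hz, norm_zero]; positivity
    · intro z hz
      have hzS : z ∈ S := by
        by_contra hc; exact hz (Set.indicator_of_notMem hc _)
      have : ‖z‖ ≤ M := max_le hzS.1.1 (by simpa [hK] using hzS.2)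
      have h2 : 0 ≤ ((1 / M) ^ (p - q) + N ^ (p - q)) * B ^ (q - 2) * B := by positivity
      linarith
  set Y := ∫⁻ t, T.indicator (fun t => n t ^ p) t with hY
  -- norms of G
  have hGen : ∀ t x, ‖G (t, x)‖ₑ = T.indicator (fun t => n t ^ (p - q)) t *
      K.indicator (fun x => ‖F (t, x)‖ₑ ^ (q - 1)) x := by
    intro t x
    by_cases ht : t ∈ T
    · by_cases hx : x ∈ K
      · rw [hG, Set.indicator_of_mem (show (t, x) ∈ S from ⟨ht, hx⟩), Set.indicator_of_mem ht,
          Set.indicator_of_mem hx, ← ofReal_norm, norm_mul, Complex.norm_real,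
          Real.norm_of_nonneg (hw0 _)]
        have h0 : 0 < (n t).toReal := lt_of_lt_of_le (by positivity) (hnT t ht).1
        rw [hw]; simp only
        rw [mul_assoc, ENNReal.ofReal_mul (by positivity), ← ENNReal.ofReal_rpow_of_pos h0,
          ENNReal.ofReal_toReal (hnt t), ← ofReal_norm (F (t, x)),
          ENNReal.ofReal_rpow_of_nonneg (norm_nonneg _) (by linarith)]
        congr 2
        rcases eq_or_ne ‖F (t, x)‖ 0 with h | h
        · rw [h, mul_zero, Real.zero_rpow (by linarith)]
        · have h1 : 0 < ‖F (t, x)‖ := lt_of_le_of_ne (norm_nonneg _) h.symm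
          nth_rewrite 2 [← Real.rpow_one ‖F (t, x)‖]
          rw [← Real.rpow_add h1]; congr 1; ring
      · rw [hG, Set.indicator_of_notMem (fun hc => hx hc.2), Set.indicator_of_notMem hx]; simp
    · rw [hG, Set.indicator_of_notMem (fun hc => ht hc.1), Set.indicator_of_notMem ht]; simp
  have hqq : (q - 1) * q' = q := by
    have := hq'.symm.sub_one_mul_conj
    linarith
  have hpp : (p - 1) * p' = p := by
    have := hp'.symm.sub_one_mul_conj
    linarith
  have hnpos : ∀ t ∈ T, n t ≠ 0 := by
    intro t ht h0
    have := (hnT t ht).1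
    rw [h0] at this
    have h1 : 0 < 1 / M := by positivity
    simp at this; linarith
  have hnq : ∀ t, ∫⁻ x, K.indicator (fun x => ‖F (t, x)‖ₑ ^ q) x = n t ^ q := by
    intro t
    rw [hn2, ← ENNReal.rpow_mul]
    rw [one_div, inv_mul_cancel₀ hq0.ne', ENNReal.rpow_one]
  have hKs : ∀ t, Measurable fun x => K.indicator (fun x => ‖F (t, x)‖ₑ ^ q) x := by
    intro t
    have hft : Measurable fun x : Eu d => ‖F (t, x)‖ₑ :=
      (hFc.comp (Continuous.prodMk continuous_const continuous_id)).measurable.enorm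
    exact (hft.pow_const q).indicator hKm
  have hnorm : ∀ t, (∫⁻ x, ‖G (t, x)‖ₑ ^ q') ^ (1 / q') = T.indicator (fun t => n t ^ (p - 1)) t := by
    intro t
    by_cases ht : t ∈ T
    · rw [Set.indicator_of_mem ht]
      have : ∀ x, ‖G (t, x)‖ₑ ^ q' = n t ^ ((p - q) * q') * K.indicator (fun x => ‖F (t, x)‖ₑ ^ q) x := by
        intro x
        rw [hGen, Set.indicator_of_mem ht, ENNReal.mul_rpow_of_nonneg _ _ hq'0.le, ← ENNReal.rpow_mul]
        congr 1
        by_cases hx : x ∈ K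
        · rw [Set.indicator_of_mem hx, Set.indicator_of_mem hx, ← ENNReal.rpow_mul, hqq]
        · rw [Set.indicator_of_notMem hx, Set.indicator_of_notMem hx, ENNReal.zero_rpow_of_pos hq'0]
      simp_rw [this]
      rw [lintegral_const_mul _ (hKs t), hnq, ← ENNReal.rpow_add _ _ (hnpos t ht) (hnt t),
        ← ENNReal.rpow_mul]
      congr 1
      have : q / q' = q - 1 := by rw [div_eq_iff hq'0.ne']; exact hqq.symm
      field_simp
      field_simp at this
      linarith
    · rw [Set.indicator_of_notMem ht]
      have : ∀ x, ‖G (t, x)‖ₑ ^ q' = 0 := by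
        intro x
        rw [hGen, Set.indicator_of_notMem ht, zero_mul, ENNReal.zero_rpow_of_pos hq'0]
      simp_rw [this]
      simp [hq'0]
  have hGY : ∫⁻ s, ((∫⁻ x, ‖G (s, x)‖ₑ ^ q') ^ (1 / q')) ^ p' = Y := by
    rw [hY]
    congr 1; ext t
    rw [hnorm]
    by_cases ht : t ∈ T
    · rw [Set.indicator_of_mem ht, Set.indicator_of_mem ht, ← ENNReal.rpow_mul, hpp]
    · rw [Set.indicator_of_notMem ht, Set.indicator_of_notMem ht, ENNReal.zero_rpow_of_pos hp'0]
  -- pairing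
  have hpair : Y ≤ ‖(inner ℂ (∫ z, G z • e z) h : ℂ)‖ₑ := by
    rw [inner_integral_left (hGn.integrable_smul he hM0)]
    have h1 : ∀ z, (inner ℂ (G z • e z) h : ℂ) = ((S.indicator (fun z => w z * ‖F z‖ ^ 2) z : ℝ) : ℂ) := by
      intro z
      rw [inner_smul_left]
      by_cases hz : z ∈ S
      · rw [hG, Set.indicator_of_mem hz, Set.indicator_of_mem hz]
        simp only [map_mul, Complex.conj_ofReal]
        rw [mul_assoc]
        change (w z : ℂ) * ((starRingEnd ℂ) (F z) * F z) = _
        rw [Complex.conj_mul']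
        push_cast; rfl
      · rw [hG, Set.indicator_of_notMem hz, Set.indicator_of_notMem hz]; simp
    simp_rw [h1]
    rw [integral_complex_ofReal, ← ofReal_norm, Complex.norm_real]
    have hnn : ∀ z, 0 ≤ S.indicator (fun z => w z * ‖F z‖ ^ 2) z := by
      intro z; apply Set.indicator_nonneg; intro z _; have := hw0 z; positivity
    have hint : Integrable (S.indicator (fun z => w z * ‖F z‖ ^ 2)) := by
      have := (hGn.integrable_smul (μ := volume) he hM0).inner_const (𝕜 := ℂ) h
      simp_rw [h1] at this
      have h3 := this.re
      simpa using h3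
    rw [Real.norm_of_nonneg (integral_nonneg hnn),
      ofReal_integral_eq_lintegral_ofReal hint (Filter.Eventually.of_forall hnn)]
    have h4 : ∀ z, ENNReal.ofReal (S.indicator (fun z => w z * ‖F z‖ ^ 2) z) = ‖G z‖ₑ * ‖F z‖ₑ := by
      intro z
      by_cases hz : z ∈ S
      · rw [hG, Set.indicator_of_mem hz, Set.indicator_of_mem hz, ← enorm_mul, ← ofReal_norm,
          norm_mul, norm_mul, Complex.norm_real, Real.norm_of_nonneg (hw0 z)]
        congr 1; ring
      · rw [hG, Set.indicator_of_notMem hz, Set.indicator_of_notMem hz]; simp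
    simp_rw [h4]
    have hGF : Measurable fun z => ‖G z‖ₑ * ‖F z‖ₑ := hGn.1.enorm.mul hFm
    rw [Measure.volume_eq_prod, lintegral_prod _ hGF.aemeasurable, hY]
    apply lintegral_mono
    intro t
    simp only
    by_cases ht : t ∈ T
    · rw [Set.indicator_of_mem ht]
      have : ∀ x, ‖G (t, x)‖ₑ * ‖F (t, x)‖ₑ = n t ^ (p - q) * K.indicator (fun x => ‖F (t, x)‖ₑ ^ q) x := by
        intro x
        rw [hGen, Set.indicator_of_mem ht, mul_assoc]
        congr 1
        by_cases hx : x ∈ K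
        · rw [Set.indicator_of_mem hx, Set.indicator_of_mem hx]
          nth_rewrite 2 [← ENNReal.rpow_one ‖F (t, x)‖ₑ]
          rw [← ENNReal.rpow_add_of_nonneg _ _ (by linarith) (by linarith)]
          congr 1; ring
        · rw [Set.indicator_of_notMem hx, Set.indicator_of_notMem hx, zero_mul]
      simp_rw [this]
      rw [lintegral_const_mul _ (hKs t), hnq, ← ENNReal.rpow_add _ _ (hnpos t ht) (hnt t)]
      simp
    · rw [Set.indicator_of_notMem ht]; exact zero_le
  have hfin : Y ≤ C * ‖h‖ₑ * Y ^ (1 / p') := by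
    calc Y ≤ _ := hpair
      _ ≤ ‖∫ z, G z • e z‖ₑ * ‖h‖ₑ := enorm_inner_le _ _
      _ ≤ (C * Y ^ (1 / p')) * ‖h‖ₑ := by
          gcongr
          have := hC G hGn
          rwa [hGY] at this
      _ = _ := by ring
  have hYt : Y ≠ ∞ := by
    have : Y ≤ ∫⁻ t, (Metric.closedBall (0 : ℝ) M).indicator (fun _ => ENNReal.ofReal N ^ p) t := by
      apply lintegral_mono; intro t
      by_cases ht : t ∈ T
      · rw [Set.indicator_of_mem ht, Set.indicator_of_mem (by simpa using ht.1)]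
        have := hN t
        simp only
        gcongr
      · rw [Set.indicator_of_notMem ht]; exact zero_le
    refine ne_top_of_le_ne_top ?_ this
    rw [lintegral_indicator_const measurableSet_closedBall]
    exact ENNReal.mul_ne_top (by finiteness) (isCompact_closedBall _ _).measure_lt_top.ne
  rcases eq_or_ne Y 0 with h0 | h0
  · rw [h0, ENNReal.zero_rpow_of_pos (by positivity)]; exact zero_le
  · have e1 : 1 / p = 1 + -(1 / p') := by
      have := hp'.inv_add_inv_eq_one
      simp only [one_div]; linarith
    rw [e1, ENNReal.rpow_add _ _ h0 hYt, ENNReal.rpow_one, ENNReal.rpow_neg, ← div_eq_mul_inv]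
    exact ENNReal.div_le_of_le_mul hfin

set_option maxHeartbeats 1000000 in
lemma dual_full {d : ℕ} {p p' q q' : ℝ} (hp' : p'.HolderConjugate p) (hq' : q'.HolderConjugate q)
    (hq : 2 < q) (C : ℝ≥0∞)
    (e : ℝ × Eu d → H) (he : Continuous e) {M0 : ℝ} (hM0 : ∀ z, ‖e z‖ ≤ M0)
    (hC : ∀ G : ℝ × Eu d → ℂ, NiceF G → ‖∫ z, G z • e z‖ₑ ≤
      C * (∫⁻ s, ((∫⁻ x, ‖G (s, x)‖ₑ ^ q') ^ (1 / q')) ^ p') ^ (1 / p'))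
    (h : H) :
    (∫⁻ t, ((∫⁻ x, ‖(inner ℂ (e (t, x)) h : ℂ)‖ₑ ^ q) ^ (1 / q)) ^ p) ^ (1 / p) ≤ C * ‖h‖ₑ := by
  have hq0 : 0 < q := by linarith
  have hp0 : 0 < p := hp'.symm.pos
  set f : ℝ → Eu d → ℝ≥0∞ := fun t x => ‖(inner ℂ (e (t, x)) h : ℂ)‖ₑ ^ q with hf
  have hfc : Continuous fun z => (inner ℂ (e z) h : ℂ) := he.inner continuous_const
  have hfm : Measurable fun z : ℝ × Eu d => f z.1 z.2 := hfc.measurable.enorm.pow_const _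
  set n : ℕ → ℝ → ℝ≥0∞ := fun k t => (∫⁻ x, (Metric.closedBall (0 : Eu d) ((k : ℝ) + 1)).indicator
      (f t) x) ^ (1 / q) with hn
  set T : ℕ → Set ℝ := fun k => {t : ℝ | |t| ≤ (k : ℝ) + 1 ∧ ENNReal.ofReal (1 / ((k : ℝ) + 1)) ≤ n k t} with hT
  have hcut : ∀ k, ∫⁻ t, (T k).indicator (fun t => n k t ^ p) t ≤ (C * ‖h‖ₑ) ^ p := by
    intro k
    have := dual_cut hp' hq' hq C e he hM0 hC h ((k : ℝ) + 1) (by positivity) (n k) rfl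
    calc _ = ((∫⁻ t, (T k).indicator (fun t => n k t ^ p) t) ^ (1 / p)) ^ p := by
          rw [← ENNReal.rpow_mul, one_div, inv_mul_cancel₀ hp0.ne', ENNReal.rpow_one]
      _ ≤ _ := by gcongr
  have hnm : ∀ k, Measurable (n k) := by
    intro k
    have : (fun z : ℝ × Eu d => (Metric.closedBall (0 : Eu d) ((k : ℝ) + 1)).indicator (f z.1) z.2) =
        (Prod.snd ⁻¹' (Metric.closedBall (0 : Eu d) ((k : ℝ) + 1))).indicator fun z => f z.1 z.2 := by
      ext z; simp [Set.indicator]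
    have h2 : Measurable (fun z : ℝ × Eu d => (Metric.closedBall (0 : Eu d) ((k : ℝ) + 1)).indicator (f z.1) z.2) := by
      rw [this]
      exact hfm.indicator (measurable_snd measurableSet_closedBall)
    exact (Measurable.lintegral_prod_right' h2).pow_const _
  have hTm : ∀ k, MeasurableSet (T k) := fun k =>
    (measurableSet_le (f := fun t : ℝ => |t|) (by fun_prop) measurable_const).inter (measurableSet_le measurable_const (hnm k))
  have hlim : ∀ t, Filter.Tendsto (fun k => n k t) Filter.atTop (nhds ((∫⁻ x, f t x) ^ (1 / q))) := by
    intro t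
    apply Filter.Tendsto.ennrpow_const
    have hft : Measurable (f t) := hfm.comp (measurable_const.prodMk measurable_id)
    apply lintegral_tendsto_of_tendsto_of_monotone
    · intro k; exact (hft.indicator measurableSet_closedBall).aemeasurable
    · refine Filter.Eventually.of_forall fun x => ?_
      intro k l hkl
      apply Set.indicator_le_indicator_of_subset
      · apply Metric.closedBall_subset_closedBall
        have : (k : ℝ) ≤ l := by exact_mod_cast hkl
        linarith
      · intro _; exact zero_le
    · refine Filter.Eventually.of_forall fun x => ?_
      apply tendsto_const_nhds.congr'
      obtain ⟨k0, hk0⟩ := exists_nat_ge ‖x‖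
      filter_upwards [Filter.eventually_ge_atTop k0] with k hk
      rw [Set.indicator_of_mem]
      have : (k0 : ℝ) ≤ k := by exact_mod_cast hk
      simp; linarith
  have hpt : ∀ t, ((∫⁻ x, f t x) ^ (1 / q)) ^ p ≤
      Filter.liminf (fun k => (T k).indicator (fun t => n k t ^ p) t) Filter.atTop := by
    intro t
    rcases eq_or_ne ((∫⁻ x, f t x) ^ (1 / q)) 0 with h0 | h0
    · rw [h0, ENNReal.zero_rpow_of_pos hp0]; exact zero_le
    · apply le_of_eq
      symm
      apply Filter.Tendsto.liminf_eq
      have h1 : Filter.Tendsto (fun k => n k t ^ p) Filter.atTop (nhds (((∫⁻ x, f t x) ^ (1 / q)) ^ p)) :=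
        Filter.Tendsto.ennrpow_const _ (hlim t)
      apply h1.congr'
      obtain ⟨c, hc0, hc⟩ := exists_between (pos_iff_ne_zero.mpr h0)
      have h2 := (hlim t).eventually (lt_mem_nhds hc)
      have h3 : Filter.Tendsto (fun k : ℕ => ENNReal.ofReal (1 / ((k : ℝ) + 1))) Filter.atTop (nhds 0) := by
        rw [← ENNReal.ofReal_zero]
        exact ENNReal.tendsto_ofReal tendsto_one_div_add_atTop_nhds_zero_nat
      have h4 := h3.eventually (gt_mem_nhds hc0)
      obtain ⟨k0, hk0⟩ := exists_nat_ge |t|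
      filter_upwards [h2, h4, Filter.eventually_ge_atTop k0] with k hk2 hk4 hk
      rw [Set.indicator_of_mem]
      have : (k0 : ℝ) ≤ k := by exact_mod_cast hk
      exact ⟨by linarith, (hk4.trans hk2).le⟩
  have hfin : ∫⁻ t, ((∫⁻ x, f t x) ^ (1 / q)) ^ p ≤ (C * ‖h‖ₑ) ^ p := by
    calc _ ≤ ∫⁻ t, Filter.liminf (fun k => (T k).indicator (fun t => n k t ^ p) t) Filter.atTop :=
          lintegral_mono hpt
      _ ≤ Filter.liminf (fun k => ∫⁻ t, (T k).indicator (fun t => n k t ^ p) t) Filter.atTop :=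
          lintegral_liminf_le fun k => ((hnm k).pow_const _).indicator (hTm k)
      _ ≤ Filter.liminf (fun _ : ℕ => (C * ‖h‖ₑ) ^ p) Filter.atTop := by
          apply Filter.liminf_le_liminf (Filter.Eventually.of_forall hcut)
      _ = _ := by simp
  calc _ ≤ ((C * ‖h‖ₑ) ^ p) ^ (1 / p) := by gcongr
    _ = _ := by rw [← ENNReal.rpow_mul, mul_one_div_cancel hp0.ne', ENNReal.rpow_one]

end Dual

/-- The extension operator. -/
noncomputable def EE {d : ℕ} (h : Eu d → ℂ) (t : ℝ) (x : Eu d) : ℂ :=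
  ∫ ξ : Eu d, Complex.exp ((thetaP t x ξ : ℝ) * I) * h ξ

/-- The `L^q` norm with real exponent. -/
noncomputable def nQ {d : ℕ} (q : ℝ) (f : Eu d → ℂ) : ℝ≥0∞ := (∫⁻ x, ‖f x‖ₑ ^ q) ^ (1 / q)

/-- smooth functions supported in the `k`-th dyadic annulus. -/
def Good {d : ℕ} (k : ℤ) (h : Eu d → ℂ) : Prop :=
  ContDiff ℝ (⊤ : ℕ∞) h ∧ ∀ ξ, h ξ ≠ 0 → (2 : ℝ) ^ (k - 1) ≤ ‖ξ‖ ∧ ‖ξ‖ ≤ (2 : ℝ) ^ (k + 1)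

lemma Good.hcs {d : ℕ} {k : ℤ} {h : Eu d → ℂ} (hh : Good k h) : HasCompactSupport h := by
  apply HasCompactSupport.intro (isCompact_closedBall (0 : Eu d) ((2 : ℝ) ^ (k + 1)))
  intro x hx
  by_contra hc
  apply hx
  simpa using (hh.2 x hc).2

lemma lint_scale {E : Type*} [NormedAddCommGroup E] [NormedSpace ℝ E] [FiniteDimensional ℝ E]
    [MeasurableSpace E] [BorelSpace E] (μ : Measure E) [μ.IsAddHaarMeasure]
    (f : E → ℝ≥0∞) {r : ℝ} (hr : 0 < r) :
    ∫⁻ x, f (r • x) ∂μ = ENNReal.ofReal (r ^ (-(Module.finrank ℝ E : ℝ))) * ∫⁻ x, f x ∂μ := by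
  have h1 := Measure.map_addHaar_smul μ hr.ne'
  have h2 : ∫⁻ x, f (r • x) ∂μ = ∫⁻ x, f x ∂(Measure.map (r • ·) μ) := by
    rw [show (fun x : E => r • x) = (Homeomorph.smulOfNeZero r hr.ne').toMeasurableEquiv from rfl,
      lintegral_map_equiv]
    rfl
  rw [h2, h1, lintegral_smul_measure, smul_eq_mul, Real.rpow_neg hr.le, Real.rpow_natCast,
    abs_of_pos (by positivity)]

lemma extmod_smooth {d : ℕ} {h : Eu d → ℂ} (hh : ContDiff ℝ (⊤ : ℕ∞) h) (t : ℝ) :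
    ContDiff ℝ (⊤ : ℕ∞) fun ξ : Eu d => Complex.exp ((t * (2 * π * ‖ξ‖) ^ 4 : ℝ) * I) * h ξ := by
  have e1 : ∀ ξ : Eu d, t * (2 * π * ‖ξ‖) ^ 4 = t * ((2 * π) ^ 4 * (‖ξ‖ ^ 2) ^ 2) := by intro ξ; ring
  simp_rw [e1]
  have h2 : ContDiff ℝ (⊤ : ℕ∞) fun ξ : Eu d => ‖ξ‖ ^ 2 := contDiff_norm_sq ℝ
  have h3 : ContDiff ℝ (⊤ : ℕ∞) fun ξ : Eu d => t * ((2 * π) ^ 4 * (‖ξ‖ ^ 2) ^ 2) :=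
    contDiff_const.mul (contDiff_const.mul (h2.pow 2))
  have h4 : ContDiff ℝ (⊤ : ℕ∞) fun ξ : Eu d => ((t * ((2 * π) ^ 4 * (‖ξ‖ ^ 2) ^ 2) : ℝ) : ℂ) :=
    Complex.ofRealCLM.contDiff.comp h3
  exact ((h4.mul contDiff_const).cexp).mul hh

lemma EE_schwartz {d : ℕ} {h : Eu d → ℂ} (hh : ContDiff ℝ (⊤ : ℕ∞) h) (hs : HasCompactSupport h)
    (t : ℝ) : ∃ F f : 𝓢(Eu d, ℂ), (∀ x, F x = EE h t x) ∧ F = 𝓕⁻ f ∧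
      ∀ ξ, f ξ = Complex.exp ((t * (2 * π * ‖ξ‖) ^ 4 : ℝ) * I) * h ξ := by
  let f : 𝓢(Eu d, ℂ) := (hs.mul_left (f := fun ξ : Eu d => Complex.exp ((t * (2 * π * ‖ξ‖) ^ 4 : ℝ) * I))).toSchwartzMap
    (extmod_smooth hh t)
  refine ⟨𝓕⁻ f, f, ?_, rfl, fun ξ => rfl⟩
  intro x
  rw [SchwartzMap.fourierInv_coe, Real.fourierInv_eq']
  unfold EE
  congr 1
  ext ξ
  have e1 : f ξ = Complex.exp ((t * (2 * π * ‖ξ‖) ^ 4 : ℝ) * I) * h ξ := rfl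
  rw [e1, smul_eq_mul, ← mul_assoc, ← Complex.exp_add]
  congr 2
  unfold thetaP
  rw [real_inner_comm]; push_cast; ring

lemma nQ_two_eq {d : ℕ} (F : 𝓢(Eu d, ℂ)) : ∫⁻ x, ‖F x‖ₑ ^ (2 : ℝ) = ENNReal.ofReal (∫ x, ‖F x‖ ^ 2) := by
  have hint : Integrable fun x => ‖F x‖ ^ 2 := by
    have := (F.memLp 2 (volume : Measure (Eu d))).integrable_norm_pow (by norm_num)
    simpa using this
  rw [ofReal_integral_eq_lintegral_ofReal hint (Filter.Eventually.of_forall fun x => by positivity)]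
  congr 1; ext x
  rw [← ofReal_norm, ENNReal.ofReal_rpow_of_nonneg (norm_nonneg _) (by norm_num)]
  norm_num

lemma EE_plancherel {d : ℕ} {h : Eu d → ℂ} (hh : ContDiff ℝ (⊤ : ℕ∞) h) (hs : HasCompactSupport h)
    (t : ℝ) : nQ 2 (EE h t) = nQ 2 h := by
  obtain ⟨F, f, hF, hFf, hf⟩ := EE_schwartz hh hs t
  unfold nQ
  congr 1
  simp_rw [← hF]
  have h1 := SchwartzMap.integral_norm_sq_fourier F
  have h2 : (𝓕 F : 𝓢(Eu d, ℂ)) = f := by rw [hFf]; simp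
  rw [h2] at h1
  rw [nQ_two_eq, ← h1, ← nQ_two_eq]
  congr 1; ext ξ
  rw [hf, enorm_mul, ← ofReal_norm (Complex.exp _), Complex.norm_exp_ofReal_mul_I]
  simp

lemma EE_scale {d : ℕ} (h : Eu d → ℂ) {r : ℝ} (hr : 0 < r) (t : ℝ) (x : Eu d) :
    EE h t x = (r ^ (d : ℝ) : ℝ) * EE (fun ξ => h (r • ξ)) (r ^ 4 * t) (r • x) := by
  unfold EE
  have h1 := Measure.integral_comp_smul_of_nonneg (volume : Measure (Eu d))
    (fun ξ => Complex.exp ((thetaP t x ξ : ℝ) * I) * h ξ) r (hR := hr.le)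
  have h2 : ∀ ξ, thetaP (r ^ 4 * t) (r • x) ξ = thetaP t x (r • ξ) := by
    intro ξ
    unfold thetaP
    rw [inner_smul_left, inner_smul_right, norm_smul, Real.norm_of_nonneg hr.le]
    simp; ring
  simp_rw [h2]
  rw [h1]
  simp only [finrank_euclideanSpace, Fintype.card_fin, Real.rpow_natCast]
  rw [Complex.real_smul, ← mul_assoc, ← Complex.ofReal_mul, mul_inv_cancel₀ (by positivity)]
  simp

lemma nQ_scale {d : ℕ} {q : ℝ} (hq : 0 < q) (f : Eu d → ℂ) {r : ℝ} (hr : 0 < r) :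
    nQ q (fun x => f (r • x)) = ENNReal.ofReal (r ^ (-(d : ℝ) / q)) * nQ q f := by
  unfold nQ
  rw [lint_scale volume (fun x => ‖f x‖ₑ ^ q) hr, ENNReal.mul_rpow_of_nonneg _ _ (by positivity),
    ENNReal.ofReal_rpow_of_pos (by positivity), ← Real.rpow_mul hr.le]
  simp only [finrank_euclideanSpace, Fintype.card_fin]
  congr 3; ring

lemma nQ_const_mul {d : ℕ} {q : ℝ} (hq : 0 < q) (f : Eu d → ℂ) (c : ℂ) :
    nQ q (fun x => c * f x) = ‖c‖ₑ * nQ q f := by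
  unfold nQ
  simp_rw [enorm_mul, ENNReal.mul_rpow_of_nonneg _ _ hq.le]
  rw [lintegral_const_mul' _ _ (by finiteness), ENNReal.mul_rpow_of_nonneg _ _ (by positivity),
    ← ENNReal.rpow_mul, mul_one_div_cancel hq.ne', ENNReal.rpow_one]

lemma nQ_EE_scale {d : ℕ} {q : ℝ} (hq : 0 < q) (h : Eu d → ℂ) {r : ℝ} (hr : 0 < r) (t : ℝ) :
    nQ q (EE h t) = ENNReal.ofReal (r ^ ((d : ℝ) - d / q)) *
      nQ q (EE (fun ξ => h (r • ξ)) (r ^ 4 * t)) := by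
  have : EE h t = fun x => ((r ^ (d : ℝ) : ℝ) : ℂ) * (fun x => EE (fun ξ => h (r • ξ)) (r ^ 4 * t) (r • x)) x := by
    ext x; exact EE_scale h hr t x
  rw [this, nQ_const_mul hq, nQ_scale hq _ hr, ← mul_assoc, ← ofReal_norm, Complex.norm_real,
    Real.norm_of_nonneg (by positivity), ← ENNReal.ofReal_mul (by positivity), ← Real.rpow_add hr]
  congr 4
  ring

lemma Good.scale {d : ℕ} {k : ℤ} {h : Eu d → ℂ} (hh : Good k h) :
    Good 0 (fun ξ => h (((2 : ℝ) ^ k) • ξ)) := by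
  refine ⟨hh.1.comp (contDiff_const_smul _), ?_⟩
  intro ξ hξ
  have := hh.2 _ hξ
  rw [norm_smul, Real.norm_of_nonneg (by positivity)] at this
  have hk : (0 : ℝ) < 2 ^ k := by positivity
  rw [zpow_sub₀ (by norm_num), zpow_add₀ (by norm_num)] at this
  constructor
  · have h1 := this.1
    rw [div_eq_mul_inv] at h1
    have := le_of_mul_le_mul_left h1 hk
    simpa using this
  · have := le_of_mul_le_mul_left this.2 hk
    simpa using this

lemma eV_inner_good {d : ℕ} {h : Eu d → ℂ} (hh : Good 0 h) :
    ∃ v : Lp ℂ 2 (volume : Measure (Eu d)), ‖v‖ₑ = nQ 2 h ∧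
      ∀ t x, (inner ℂ (eV (t, x)) v : ℂ) = EE h t x := by
  have hm : MemLp h 2 (volume : Measure (Eu d)) :=
    hh.1.continuous.memLp_of_hasCompactSupport hh.hcs
  refine ⟨hm.toLp h, ?_, ?_⟩
  · rw [Lp.enorm_toLp, eLpNorm_eq_lintegral_rpow_enorm_toReal (by norm_num) (by norm_num)]
    unfold nQ
    norm_num
  · intro t x
    rw [eV_inner]
    unfold EE
    congr 1; ext ξ
    by_cases hξ : h ξ = 0
    · simp [hξ]
    · have := hh.2 ξ hξ
      norm_num at this
      rw [phiB_one (by linarith [this.1]) this.2]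
      simp

lemma LS_unit_fin {d : ℕ} {p q : ℝ} (hp : 2 ≤ p) (hq : 2 < q) (hpq : 2 / p + d / q ≤ d / 2) :
    ∃ C : ℝ≥0∞, C ≠ ∞ ∧ ∀ h : Eu d → ℂ, Good 0 h →
      (∫⁻ t, nQ q (EE h t) ^ p) ^ (1 / p) ≤ C * nQ 2 h := by
  have hp0 : 0 < p := by linarith
  have hq0 : 0 < q := by linarith
  have hp' := (Real.HolderConjugate.conjExponent (show 1 < p by linarith)).symm
  have hq' := (Real.HolderConjugate.conjExponent (show 1 < q by linarith)).symm
  have hμ : 0 < 1 / 2 - 1 / q := by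
    have : 1 / q < 1 / 2 := one_div_lt_one_div_of_lt (by norm_num) hq
    linarith
  obtain ⟨C, hC, hG⟩ := kt_flow (d := d) (σ := 1 / p / (1 / 2 - 1 / q)) hp' hq' hp hq (by positivity)
    (by
      rw [div_le_iff₀ hμ]
      have e1 : (2 : ℝ) / p = 2 * (1 / p) := by ring
      have e2 : (d : ℝ) / q = d * (1 / q) := by ring
      have e3 : (d : ℝ) / 2 * (1 / 2 - 1 / q) = d / 2 / 2 - d * (1 / q) / 2 := by ring
      rw [e3]; rw [e1, e2] at hpq; linarith) (div_mul_cancel₀ _ hμ.ne').symm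
  obtain ⟨M0, hM0⟩ := eV_bound (d := d)
  refine ⟨C ^ ((1 : ℝ) / 2), by finiteness, ?_⟩
  intro h hh
  obtain ⟨v, hv, hvE⟩ := eV_inner_good hh
  have := dual_full hp' hq' hq (C ^ ((1 : ℝ) / 2)) eV eV_cont hM0 (by
    intro G hGn
    have h1 := hG G hGn
    have e : ∀ a : ℝ≥0∞, a = (a ^ 2) ^ ((1 : ℝ) / 2) := by
      intro a
      rw [← ENNReal.rpow_natCast, ← ENNReal.rpow_mul]; norm_num
    refine (e _).le.trans ?_
    refine (ENNReal.rpow_le_rpow h1 (by norm_num)).trans ?_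
    rw [ENNReal.mul_rpow_of_nonneg _ _ (by norm_num), ← e]) v
  simp_rw [hvE, hv] at this
  exact this

lemma LS_unit_inf {d : ℕ} {q : ℝ} (hq : 2 < q) :
    ∃ C : ℝ≥0∞, C ≠ ∞ ∧ ∀ h : Eu d → ℂ, Good 0 h → ∀ t, nQ q (EE h t) ≤ C * nQ 2 h := by
  have hq0 : 0 < q := by linarith
  obtain ⟨M0, hM0⟩ := eV_bound (d := d)
  set A := ENNReal.ofReal M0 with hA
  refine ⟨A ^ ((q - 2) / q), ENNReal.rpow_ne_top_of_nonneg (div_nonneg (by linarith) hq0.le) (by finiteness), ?_⟩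
  intro h hh t
  obtain ⟨v, hv, hvE⟩ := eV_inner_good hh
  have hb : ∀ x, ‖EE h t x‖ₑ ≤ A * nQ 2 h := by
    intro x
    rw [← hvE, ← hv]
    refine (enorm_inner_le _ _).trans ?_
    gcongr
    rw [← ofReal_norm]; exact ENNReal.ofReal_le_ofReal (hM0 _)
  have hvt : nQ 2 h ≠ ∞ := by rw [← hv]; exact enorm_ne_top
  have hpl : ∫⁻ x, ‖EE h t x‖ₑ ^ (2 : ℝ) = nQ 2 h ^ (2 : ℝ) := by
    rw [← EE_plancherel hh.1 hh.hcs t]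
    unfold nQ
    rw [← ENNReal.rpow_mul]; norm_num
  have h1 : ∫⁻ x, ‖EE h t x‖ₑ ^ q ≤ A ^ (q - 2) * nQ 2 h ^ q := by
    calc _ ≤ ∫⁻ x, (A * nQ 2 h) ^ (q - 2) * ‖EE h t x‖ₑ ^ (2 : ℝ) := by
          apply lintegral_mono; intro x
          simp only
          calc ‖EE h t x‖ₑ ^ q = ‖EE h t x‖ₑ ^ (q - 2) * ‖EE h t x‖ₑ ^ (2 : ℝ) := by
                rw [← ENNReal.rpow_add_of_nonneg _ _ (by linarith) (by norm_num)]
                congr 1; ring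
            _ ≤ _ := by
                exact mul_le_mul_left (ENNReal.rpow_le_rpow (hb x) (by linarith)) _
      _ = (A * nQ 2 h) ^ (q - 2) * nQ 2 h ^ (2 : ℝ) := by
          rw [lintegral_const_mul' _ _ (ENNReal.rpow_ne_top_of_nonneg (by linarith) (by finiteness)), hpl]
      _ = _ := by
          rw [ENNReal.mul_rpow_of_nonneg _ _ (by linarith), mul_assoc,
            ← ENNReal.rpow_add_of_nonneg _ _ (by linarith) (by norm_num)]
          congr 2; ring
  calc nQ q (EE h t) ≤ (A ^ (q - 2) * nQ 2 h ^ q) ^ (1 / q) := by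
        unfold nQ at h1 ⊢
        gcongr
    _ = _ := by
        rw [ENNReal.mul_rpow_of_nonneg _ _ (by positivity), ← ENNReal.rpow_mul, ← ENNReal.rpow_mul,
          mul_one_div_cancel hq0.ne', ENNReal.rpow_one]
        congr 2; ring

/-- Localized Strichartz estimate at frequency `2^k`. -/
theorem LS {d : ℕ} {p q : ℝ≥0∞} (hadm : Admissible d p q) (hq2 : 2 < q) (hqt : q ≠ ∞) :
    ∃ C : ℝ≥0∞, C ≠ ∞ ∧ ∀ (k : ℤ) (h : Eu d → ℂ), Good k h →
      timeLp p Set.univ (fun t => nQ q.toReal (EE h t)) ≤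
        C * (ENNReal.ofReal (((2 : ℝ) ^ k) ^ gammaExp d p q) * nQ 2 h) := by
  obtain ⟨hp2, -, -, hpq⟩ := hadm
  set Q := q.toReal with hQ
  have hQ2 : 2 < Q := by
    have := (ENNReal.toReal_lt_toReal (by norm_num) hqt).mpr hq2
    simpa using this
  have hQ0 : 0 < Q := by linarith
  by_cases hpt : p = ∞
  · obtain ⟨C, hC, hh⟩ := LS_unit_inf (d := d) hQ2
    refine ⟨C, hC, ?_⟩
    intro k h hk
    have hr : (0 : ℝ) < 2 ^ k := by positivity
    rw [timeLp, if_pos hpt]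
    refine essSup_le_of_ae_le _ (Filter.Eventually.of_forall fun t => ?_)
    simp only
    rw [nQ_EE_scale hQ0 h hr]
    calc _ ≤ ENNReal.ofReal (((2 : ℝ) ^ k) ^ ((d : ℝ) - d / Q)) * (C * nQ 2 (fun ξ => h (((2 : ℝ) ^ k) • ξ))) := by
          gcongr
          exact hh _ hk.scale _
      _ = _ := by
          rw [nQ_scale (by norm_num) h hr, mul_left_comm]
          congr 1
          rw [← mul_assoc, ← ENNReal.ofReal_mul (by positivity), ← Real.rpow_add hr]
          congr 3
          rw [gammaExp, hpt]
          simp; ring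
  · set P := p.toReal with hP
    have hP2 : 2 ≤ P := by
      have := (ENNReal.toReal_le_toReal (by norm_num) hpt).mpr hp2
      simpa using this
    have hP0 : 0 < P := by linarith
    have hreal : 2 / P + d / Q ≤ (d : ℝ) / 2 := by
      have hp0 : p ≠ 0 := by intro h0; rw [h0] at hp2; simp at hp2
      have hq0 : q ≠ 0 := by intro h0; rw [h0] at hq2; simp at hq2
      have f1 : 2 / p ≠ ∞ := ENNReal.div_ne_top (by norm_num) hp0
      have f2 : (d : ℝ≥0∞) / q ≠ ∞ := ENNReal.div_ne_top (by simp) hq0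
      have := (ENNReal.toReal_le_toReal (ENNReal.add_ne_top.mpr ⟨f1, f2⟩)
        (ENNReal.div_ne_top (by simp) (by norm_num))).mpr hpq
      rw [ENNReal.toReal_add f1 f2] at this
      simpa [ENNReal.toReal_div] using this
    obtain ⟨C, hC, hh⟩ := LS_unit_fin (d := d) hP2 hQ2 hreal
    refine ⟨C, hC, ?_⟩
    intro k h hk
    have hr : (0 : ℝ) < 2 ^ k := by positivity
    rw [timeLp, if_neg hpt, Measure.restrict_univ]
    simp_rw [nQ_EE_scale hQ0 h hr]
    set r : ℝ := (2 : ℝ) ^ k with hrk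
    set h0 := fun ξ => h (r • ξ) with hh0
    have e1 : ∫⁻ t, (ENNReal.ofReal (r ^ ((d : ℝ) - d / Q)) * nQ Q (EE h0 (r ^ 4 * t))) ^ P =
        ENNReal.ofReal (r ^ ((d : ℝ) - d / Q)) ^ P * (ENNReal.ofReal (r ^ (-4 : ℝ)) *
          ∫⁻ t, nQ Q (EE h0 t) ^ P) := by
      simp_rw [ENNReal.mul_rpow_of_nonneg _ _ hP0.le]
      rw [lintegral_const_mul' _ _ (by finiteness)]
      congr 1
      have := lint_scale (volume : Measure ℝ) (fun t => nQ Q (EE h0 t) ^ P) (r := r ^ 4) (by positivity)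
      simp only [smul_eq_mul, Module.finrank_self, Nat.cast_one] at this
      rw [this]
      congr 2
      rw [← Real.rpow_natCast, ← Real.rpow_mul hr.le]; norm_num
    rw [e1, ENNReal.mul_rpow_of_nonneg _ _ (by positivity), ENNReal.mul_rpow_of_nonneg _ _ (by positivity),
      ← ENNReal.rpow_mul, mul_one_div_cancel hP0.ne', ENNReal.rpow_one]
    calc _ ≤ ENNReal.ofReal (r ^ ((d : ℝ) - d / Q)) * (ENNReal.ofReal (r ^ (-4 : ℝ)) ^ (1 / P) * (C * nQ 2 h0)) := by
          gcongr
          exact hh _ hk.scale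
      _ = _ := by
          rw [hh0, nQ_scale (by norm_num) h hr, ENNReal.ofReal_rpow_of_pos (by positivity),
            ← Real.rpow_mul hr.le]
          rw [mul_left_comm _ C, mul_left_comm _ C]
          congr 1
          rw [← mul_assoc, ← mul_assoc, ← ENNReal.ofReal_mul (by positivity), ← Real.rpow_add hr,
            ← ENNReal.ofReal_mul (by positivity), ← Real.rpow_add hr]
          congr 3
          rw [gammaExp]
          ring

lemma pt_ineq {q : ℝ} (hq : 2 < q) (a b : ℝ) :
    |a + b| ^ q ≤ |a| ^ q + q * (|a| ^ (q - 2) * a * b) +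
      (q ^ 2 + (q + 1) ^ q + q ^ q) * (|a| ^ (q - 2) * b ^ 2 + |b| ^ q) := by
  have hq0 : 0 < q := by linarith
  have hP : 0 ≤ |a| ^ (q - 2) := by positivity
  have hb : 0 ≤ |b| ^ q := by positivity
  have h1 : 0 ≤ (q + 1) ^ q := by positivity
  have h2 : 0 ≤ q ^ q := by positivity
  by_cases h : q * |b| ≤ |a|
  · rcases eq_or_ne a 0 with ha | ha
    · have hb0 : b = 0 := by
        rw [ha, abs_zero] at h
        have : |b| ≤ 0 := by nlinarith [abs_nonneg b]
        exact abs_eq_zero.mp (le_antisymm this (abs_nonneg b))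
      rw [ha, hb0]
      simp [Real.zero_rpow hq0.ne']
    · have ha' : 0 < |a| := abs_pos.mpr ha
      set x := b / a with hx
      have hbx : b = x * a := by rw [hx]; field_simp
      have hqx : |q * x| ≤ 1 := by
        rw [hx, abs_mul, abs_div, abs_of_pos hq0, ← mul_div_assoc, div_le_one ha']; exact h
      have hx1 : -1 ≤ x := by
        have h3 := (abs_le.mp hqx).1
        by_contra hc
        push Not at hc
        nlinarith
      have e1 : |a + b| ^ q = |a| ^ q * (1 + x) ^ q := by
        rw [hbx, show a + x * a = a * (1 + x) by ring, abs_mul, abs_of_nonneg (by linarith : 0 ≤ 1 + x),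
          Real.mul_rpow (abs_nonneg a) (by linarith)]
      have e2 : (1 + x) ^ q ≤ 1 + q * x + (q * x) ^ 2 := by
        have s1 : (1 + x) ^ q ≤ (Real.exp x) ^ q :=
          Real.rpow_le_rpow (by linarith) (by linarith [Real.add_one_le_exp x]) hq0.le
        have s2 : (Real.exp x) ^ q = Real.exp (q * x) := by
          rw [← Real.exp_mul, mul_comm]
        have s3 := (abs_le.mp (Real.abs_exp_sub_one_sub_id_le hqx)).2
        linarith
      have e3 : |a| ^ q = |a| ^ (q - 2) * a ^ 2 := by
        rw [← sq_abs a, ← Real.rpow_natCast |a| 2, ← Real.rpow_add ha']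
        congr 1; push_cast; ring
      have hPa : 0 ≤ |a| ^ (q - 2) * a ^ 2 := by positivity
      have e4 : |a| ^ (q - 2) * b ^ 2 = |a| ^ (q - 2) * a ^ 2 * x ^ 2 := by rw [hbx]; ring
      have e5 : |a| ^ (q - 2) * a * b = |a| ^ (q - 2) * a ^ 2 * x := by rw [hbx]; ring
      rw [e1, e4, e5, e3]
      set Z := |a| ^ (q - 2) * a ^ 2
      have m1 := mul_le_mul_of_nonneg_left e2 hPa
      have m2 : 0 ≤ (q + 1) ^ q * (Z * x ^ 2) := by positivity
      have m3 : 0 ≤ q ^ q * (Z * x ^ 2) := by positivity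
      have m4 : 0 ≤ (q ^ 2 + (q + 1) ^ q + q ^ q) * |b| ^ q := by positivity
      nlinarith
  · push Not at h
    have s1 : |a + b| ^ q ≤ (q + 1) ^ q * |b| ^ q := by
      rw [← Real.mul_rpow (by linarith) (abs_nonneg b)]
      apply Real.rpow_le_rpow (abs_nonneg _) _ hq0.le
      have := abs_add_le a b
      nlinarith
    have s2 : -(q ^ q * |b| ^ q) ≤ q * (|a| ^ (q - 2) * a * b) := by
      have u1 : |a| ^ (q - 2) * |a| ≤ (q * |b|) ^ (q - 2) * (q * |b|) := by
        have := Real.rpow_le_rpow (abs_nonneg a) h.le (show 0 ≤ q - 2 by linarith)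
        gcongr
      have u0 : 0 < |b| := by
        by_contra hc
        have hb0 : |b| = 0 := le_antisymm (not_lt.mp hc) (abs_nonneg b)
        rw [hb0, mul_zero] at h
        exact absurd h (not_lt.mpr (abs_nonneg a))
      have u2 : q * ((q * |b|) ^ (q - 2) * (q * |b|) * |b|) = q ^ q * |b| ^ q := by
        have v1 : (q * |b|) ^ q = (q * |b|) ^ (q - 2) * (q * |b|) ^ 2 := by
          rw [← Real.rpow_natCast (q * |b|) 2, ← Real.rpow_add (by positivity)]
          congr 1; push_cast; ring
        rw [← Real.mul_rpow hq0.le (abs_nonneg b), v1]; ring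
      rw [← u2]
      have u3 : -(|a| ^ (q - 2) * |a| * |b|) ≤ |a| ^ (q - 2) * a * b := by
        have := neg_abs_le (|a| ^ (q - 2) * a * b)
        rw [abs_mul, abs_mul, abs_of_nonneg hP] at this
        exact this
      have u4 : |a| ^ (q - 2) * |a| * |b| ≤ (q * |b|) ^ (q - 2) * (q * |b|) * |b| := by gcongr
      nlinarith
    have m1 : 0 ≤ |a| ^ q := by positivity
    have m2 : 0 ≤ (q ^ 2 + (q + 1) ^ q + q ^ q) * (|a| ^ (q - 2) * b ^ 2) := by positivity
    have m3 : 0 ≤ q ^ 2 * |b| ^ q := by positivity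
    nlinarith

lemma phi_deriv {q : ℝ} (hq : 2 < q) (s : ℝ) :
    HasDerivAt (fun s : ℝ => |s| ^ (q - 2) * s) ((q - 1) * |s| ^ (q - 2)) s := by
  rcases lt_trichotomy s 0 with h | h | h
  · have h1 : HasDerivAt (fun s : ℝ => -(-s) ^ (q - 1)) ((q - 1) * |s| ^ (q - 2)) s := by
      have := ((Real.hasDerivAt_rpow_const (x := -s) (p := q - 1) (Or.inl (by linarith))).comp s
        (hasDerivAt_neg s)).neg
      refine this.congr_deriv ?_
      rw [abs_of_neg h, show q - 1 - 1 = q - 2 by ring]; ring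
    refine h1.congr_of_eventuallyEq ?_
    filter_upwards [gt_mem_nhds h] with y hy
    rw [abs_of_neg hy, show q - 1 = q - 2 + 1 by ring, Real.rpow_add_one (by linarith)]; ring
  · subst h
    rw [abs_zero, Real.zero_rpow (by linarith), mul_zero, hasDerivAt_iff_tendsto_slope]
    have hc : Continuous fun y : ℝ => |y| ^ (q - 2) :=
      continuous_abs.rpow_const fun x => Or.inr (by linarith)
    have h2 := hc.tendsto 0
    simp only [abs_zero] at h2
    rw [Real.zero_rpow (by linarith)] at h2
    refine (h2.mono_left nhdsWithin_le_nhds).congr' ?_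
    filter_upwards [self_mem_nhdsWithin] with y hy
    rw [slope_def_field]
    have : y ≠ 0 := hy
    simp; field_simp
  · have h1 : HasDerivAt (fun s : ℝ => s ^ (q - 1)) ((q - 1) * |s| ^ (q - 2)) s := by
      have := (Real.hasDerivAt_rpow_const (x := s) (p := q - 1) (Or.inl (by linarith)))
      refine this.congr_deriv ?_
      rw [abs_of_pos h, show q - 1 - 1 = q - 2 by ring]
    refine h1.congr_of_eventuallyEq ?_
    filter_upwards [lt_mem_nhds h] with y hy
    rw [abs_of_pos hy, show q - 1 = q - 2 + 1 by ring, Real.rpow_add_one (by linarith)]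

lemma recur {q : ℝ} (hq : 2 < q) {C : ℝ} (hC : 0 ≤ C) (n : ℕ) (X a : ℕ → ℝ) (hX : ∀ k, 0 ≤ X k)
    (ha : ∀ k, 0 ≤ a k) (hX0 : X 0 = 0)
    (hr : ∀ k < n, X (k + 1) ^ q ≤ X k ^ q +
      C * (X k ^ (q - 2) * (a k * ∑ j ∈ Finset.range k, (2 : ℝ) ^ ((j : ℝ) - k) * a j + a k ^ 2) + a k ^ q)) :
    X n ^ 2 ≤ (1 + 6 * C) * ∑ k ∈ Finset.range n, a k ^ 2 := by
  have hq0 : 0 < q := by linarith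
  set A2 := ∑ k ∈ Finset.range n, a k ^ 2 with hA2
  have hA20 : 0 ≤ A2 := Finset.sum_nonneg fun k _ => by positivity
  set A := Real.sqrt A2 with hA
  have hA0 : 0 ≤ A := Real.sqrt_nonneg _
  have hAA : A ^ 2 = A2 := Real.sq_sqrt hA20
  -- choose max
  obtain ⟨m, hm, hmax⟩ := Finset.exists_max_image (Finset.range (n + 1)) X ⟨0, by simp⟩
  set B := X m with hB
  have hmn : m ≤ n := by simpa [Nat.lt_succ_iff] using hm
  have hXB : ∀ k ≤ n, X k ≤ B := fun k hk => hmax k (by simpa [Nat.lt_succ_iff] using hk)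
  have hB0 : 0 ≤ B := hX m
  have haA : ∀ k < n, a k ≤ A := by
    intro k hk
    apply Real.le_sqrt_of_sq_le
    exact Finset.single_le_sum (f := fun k => a k ^ 2) (fun i _ => by positivity) (Finset.mem_range.mpr hk)
  -- telescoped
  have htel : ∀ l ≤ n, X l ^ q ≤ ∑ k ∈ Finset.range l,
      C * (B ^ (q - 2) * (a k * ∑ j ∈ Finset.range k, (2 : ℝ) ^ ((j : ℝ) - k) * a j + a k ^ 2) + a k ^ q) := by
    intro l
    induction l with
    | zero => intro _; simp [hX0, Real.zero_rpow hq0.ne']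
    | succ l ih =>
      intro hl
      rw [Finset.sum_range_succ]
      refine (hr l (by omega)).trans ?_
      apply add_le_add (ih (by omega))
      have h1 : X l ^ (q - 2) ≤ B ^ (q - 2) :=
        Real.rpow_le_rpow (hX l) (hXB l (by omega)) (by linarith)
      have h2 : 0 ≤ a l * ∑ j ∈ Finset.range l, (2 : ℝ) ^ ((j : ℝ) - l) * a j + a l ^ 2 := by
        have : 0 ≤ ∑ j ∈ Finset.range l, (2 : ℝ) ^ ((j : ℝ) - l) * a j :=
          Finset.sum_nonneg fun j _ => mul_nonneg (by positivity) (ha j)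
        have := ha l
        positivity
      gcongr
  -- geometric sums
  have hgeo1 : ∀ k : ℕ, ∑ j ∈ Finset.range k, (2 : ℝ) ^ ((j : ℝ) - k) ≤ 1 := by
    intro k
    have : ∀ j : ℕ, (2 : ℝ) ^ ((j : ℝ) - k) = 2 ^ j * (2 ^ k)⁻¹ := by
      intro j
      rw [Real.rpow_sub (by norm_num), Real.rpow_natCast, Real.rpow_natCast, div_eq_mul_inv]
    simp_rw [this]
    rw [← Finset.sum_mul, geom_sum_eq (by norm_num)]
    rw [← div_eq_mul_inv, div_le_one (by positivity)]
    norm_num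
  have hgeo2 : ∀ (N j : ℕ), ∑ k ∈ Finset.range N, (if j < k then (2 : ℝ) ^ ((j : ℝ) - k) else 0) ≤ 2 := by
    intro N j
    have hs := summable_geometric_two
    calc _ ≤ ∑ k ∈ Finset.range N, (2 : ℝ) ^ j * (if j ≤ k then (1 / 2 : ℝ) ^ k else 0) := by
          apply Finset.sum_le_sum
          intro k _
          split_ifs with h1 h2
          · rw [Real.rpow_sub (by norm_num), Real.rpow_natCast, Real.rpow_natCast, one_div, inv_pow,
              div_eq_mul_inv]
          · omega
          · positivity
          · simp
      _ ≤ 2 := by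
          rcases le_total N j with hN | hN
          · rw [Finset.sum_eq_zero]
            · norm_num
            · intro k hk
              rw [if_neg (by have := Finset.mem_range.mp hk; omega), mul_zero]
          · obtain ⟨M, rfl⟩ := Nat.exists_eq_add_of_le hN
            rw [Finset.sum_range_add, Finset.sum_eq_zero, zero_add]
            · have : ∀ i : ℕ, (2 : ℝ) ^ j * (if j ≤ j + i then (1 / 2 : ℝ) ^ (j + i) else 0) = (1 / 2 : ℝ) ^ i := by
                intro i
                rw [if_pos (by omega), pow_add, ← mul_assoc, ← mul_pow]; norm_num
              simp_rw [this]
              calc _ ≤ ∑' i : ℕ, (1 / 2 : ℝ) ^ i := hs.sum_le_tsum _ (fun i _ => by positivity)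
                _ = 2 := tsum_geometric_two
            · intro k hk
              rw [if_neg (by have := Finset.mem_range.mp hk; omega), mul_zero]
  have hcross : ∑ k ∈ Finset.range m, a k * ∑ j ∈ Finset.range k, (2 : ℝ) ^ ((j : ℝ) - k) * a j ≤ 2 * A2 := by
    have hmle : ∑ k ∈ Finset.range m, a k ^ 2 ≤ A2 :=
      Finset.sum_le_sum_of_subset_of_nonneg (Finset.range_subset_range.mpr hmn) fun i _ _ => by positivity
    calc _ ≤ ∑ k ∈ Finset.range m, ∑ j ∈ Finset.range k,
          ((2 : ℝ) ^ ((j : ℝ) - k) * (a k ^ 2) / 2 + (2 : ℝ) ^ ((j : ℝ) - k) * (a j ^ 2) / 2) := by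
          apply Finset.sum_le_sum; intro k _
          rw [Finset.mul_sum]
          apply Finset.sum_le_sum; intro j _
          have : 0 < (2 : ℝ) ^ ((j : ℝ) - k) := by positivity
          nlinarith [mul_nonneg this.le (sq_nonneg (a k - a j))]
      _ = ∑ k ∈ Finset.range m, (∑ j ∈ Finset.range k, (2 : ℝ) ^ ((j : ℝ) - k)) * (a k ^ 2) / 2 +
          ∑ k ∈ Finset.range m, ∑ j ∈ Finset.range m,
            (if j < k then (2 : ℝ) ^ ((j : ℝ) - k) else 0) * (a j ^ 2) / 2 := by
          rw [← Finset.sum_add_distrib]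
          apply Finset.sum_congr rfl
          intro k hk
          rw [Finset.sum_add_distrib]
          congr 1
          · rw [Finset.sum_mul, Finset.sum_div]
          · have hkm : k ≤ m := (Finset.mem_range.mp hk).le
            rw [← Finset.sum_subset (Finset.range_subset_range.mpr hkm)]
            · apply Finset.sum_congr rfl
              intro j hj
              rw [if_pos (Finset.mem_range.mp hj)]
            · intro j _ hj
              rw [if_neg (by simpa using hj)]; simp
      _ ≤ ∑ k ∈ Finset.range m, 1 * (a k ^ 2) / 2 + ∑ j ∈ Finset.range m, 2 * (a j ^ 2) / 2 := by
          apply add_le_add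
          · apply Finset.sum_le_sum; intro k _
            have := hgeo1 k
            gcongr
          · rw [Finset.sum_comm]
            apply Finset.sum_le_sum; intro j _
            rw [← Finset.sum_div, ← Finset.sum_mul]
            have := hgeo2 m j
            gcongr
      _ ≤ 2 * A2 := by
          rw [← Finset.sum_div, ← Finset.sum_div, ← Finset.mul_sum, ← Finset.mul_sum]
          linarith
  have hsq : ∑ k ∈ Finset.range m, a k ^ 2 ≤ A2 :=
      Finset.sum_le_sum_of_subset_of_nonneg (Finset.range_subset_range.mpr hmn) fun i _ _ => by positivity
  have hqs : ∑ k ∈ Finset.range m, a k ^ q ≤ A ^ (q - 2) * A2 := by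
    calc _ ≤ ∑ k ∈ Finset.range m, A ^ (q - 2) * a k ^ 2 := by
          apply Finset.sum_le_sum; intro k hk
          have hk' := haA k (lt_of_lt_of_le (Finset.mem_range.mp hk) hmn)
          have e : a k ^ q = a k ^ (q - 2) * a k ^ 2 := by
            rw [← Real.rpow_natCast (a k) 2, ← Real.rpow_add_of_nonneg (ha k) (by linarith) (by norm_num)]
            congr 1; push_cast; ring
          rw [e]
          have := Real.rpow_le_rpow (ha k) hk' (show 0 ≤ q - 2 by linarith)
          gcongr
      _ = A ^ (q - 2) * ∑ k ∈ Finset.range m, a k ^ 2 := by rw [Finset.mul_sum]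
      _ ≤ _ := by gcongr
  have hBq : B ^ q ≤ C * (B ^ (q - 2) * (3 * A2) + A ^ (q - 2) * A2) := by
    refine (htel m hmn).trans ?_
    rw [← Finset.mul_sum, Finset.sum_add_distrib, ← Finset.mul_sum, Finset.sum_add_distrib]
    have : 0 ≤ B ^ (q - 2) := by positivity
    gcongr
    linarith
  have hfinal : B ^ 2 ≤ (1 + 6 * C) * A2 := by
    by_cases hAB : B ≤ A
    · have : B ^ 2 ≤ A ^ 2 := by gcongr
      rw [hAA] at this
      have : 0 ≤ C * A2 := by positivity
      linarith
    · push Not at hAB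
      have hBp : 0 < B := lt_of_le_of_lt hA0 hAB
      have h1 : A ^ (q - 2) ≤ B ^ (q - 2) := Real.rpow_le_rpow hA0 hAB.le (by linarith)
      have h2 : B ^ q = B ^ (q - 2) * B ^ 2 := by
        rw [← Real.rpow_natCast B 2, ← Real.rpow_add hBp]
        congr 1; push_cast; ring
      have h3 : 0 < B ^ (q - 2) := by positivity
      have h4 : B ^ (q - 2) * B ^ 2 ≤ B ^ (q - 2) * (4 * C * A2) := by
        rw [← h2]
        calc _ ≤ _ := hBq
          _ ≤ C * (B ^ (q - 2) * (3 * A2) + B ^ (q - 2) * A2) := by gcongr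
          _ = _ := by ring
      have h5 := le_of_mul_le_mul_left h4 h3
      have : 0 ≤ C * A2 := by positivity
      linarith
  have := hXB n le_rfl
  calc X n ^ 2 ≤ B ^ 2 := by have := hX n; gcongr
    _ ≤ _ := hfinal

/-- continuous, integrable and bounded. -/
def Reg {d : ℕ} (f : Eu d → ℝ) : Prop := Continuous f ∧ Integrable f ∧ ∃ M, ∀ x, |f x| ≤ M

/-- regular together with the first derivatives. -/
def Reg1 {d : ℕ} (f : Eu d → ℝ) : Prop :=
  Reg f ∧ Differentiable ℝ f ∧ ∀ v, Reg (fun x => fderiv ℝ f x v)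

/-- real-valued `L^q` norm. -/
noncomputable def nR {d : ℕ} (q : ℝ) (f : Eu d → ℝ) : ℝ := (∫ x, |f x| ^ q) ^ (1 / q)

lemma nR_nonneg {d : ℕ} (q : ℝ) (f : Eu d → ℝ) : 0 ≤ nR q f :=
  Real.rpow_nonneg (integral_nonneg fun x => by positivity) _

lemma nR_pow {d : ℕ} {q : ℝ} (hq : 0 < q) (f : Eu d → ℝ) : nR q f ^ q = ∫ x, |f x| ^ q := by
  unfold nR
  rw [← Real.rpow_mul (integral_nonneg fun x => by positivity), one_div_mul_cancel hq.ne', Real.rpow_one]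

lemma Reg.rpow_int {d : ℕ} {q : ℝ} (hq : 1 ≤ q) {f : Eu d → ℝ} (hf : Reg f) :
    Integrable fun x => |f x| ^ q := by
  obtain ⟨hc, hi, M, hM⟩ := hf
  refine Integrable.mono' (hi.abs.const_mul (M ^ (q - 1)))
    ((hc.abs.rpow_const fun x => Or.inr (by linarith)).aestronglyMeasurable) (Filter.Eventually.of_forall fun x => ?_)
  rw [Real.norm_of_nonneg (by positivity)]
  have : |f x| ^ q = |f x| ^ (q - 1) * |f x| := by
    conv_rhs => rw [← Real.rpow_add_one' (abs_nonneg _) (by linarith)]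
    ring_nf
  rw [this]
  gcongr
  · exact hM x

lemma Reg.zero {d : ℕ} : Reg (fun _ : Eu d => (0 : ℝ)) :=
  ⟨continuous_const, integrable_zero _ _ _, 0, by simp⟩

lemma Reg.add {d : ℕ} {f g : Eu d → ℝ} (hf : Reg f) (hg : Reg g) : Reg (fun x => f x + g x) := by
  obtain ⟨M, hM⟩ := hf.2.2
  obtain ⟨N, hN⟩ := hg.2.2
  exact ⟨hf.1.add hg.1, hf.2.1.add hg.2.1, M + N, fun x => (abs_add_le _ _).trans (add_le_add (hM x) (hN x))⟩

lemma Reg1.zero {d : ℕ} : Reg1 (fun _ : Eu d => (0 : ℝ)) :=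
  ⟨Reg.zero, differentiable_const _, fun v => by simpa using Reg.zero⟩

lemma Reg1.add {d : ℕ} {f g : Eu d → ℝ} (hf : Reg1 f) (hg : Reg1 g) : Reg1 (fun x => f x + g x) := by
  refine ⟨hf.1.add hg.1, hf.2.1.add hg.2.1, fun v => ?_⟩
  have : ∀ x, fderiv ℝ (fun x => f x + g x) x v = fderiv ℝ f x v + fderiv ℝ g x v := by
    intro x
    rw [fderiv_fun_add (hf.2.1 x) (hg.2.1 x)]; rfl
  simp_rw [this]
  exact (hf.2.2 v).add (hg.2.2 v)

lemma Reg1.sum {d : ℕ} {f : ℕ → Eu d → ℝ} (hf : ∀ k, Reg1 (f k)) (n : ℕ) :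
    Reg1 (fun x => ∑ k ∈ Finset.range n, f k x) := by
  induction n with
  | zero => simpa using Reg1.zero
  | succ n ih => simp_rw [Finset.sum_range_succ]; exact ih.add (hf n)

lemma Reg.mul3_int {d : ℕ} {r : ℝ} (hr : 0 ≤ r) {S a b : Eu d → ℝ} (hS : Reg S) (ha : Reg a) (hb : Reg b) :
    Integrable fun x => |S x| ^ r * (a x * b x) := by
  obtain ⟨M, hM⟩ := hS.2.2
  obtain ⟨N, hN⟩ := ha.2.2
  refine Integrable.mono' (hb.2.1.abs.const_mul (M ^ r * N))
    (((hS.1.abs.rpow_const fun x => Or.inr hr).mul (ha.1.mul hb.1)).aestronglyMeasurable)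
    (Filter.Eventually.of_forall fun x => ?_)
  rw [norm_mul, norm_mul, Real.norm_of_nonneg (by positivity : 0 ≤ |S x| ^ r), Real.norm_eq_abs, Real.norm_eq_abs,
    ← mul_assoc]
  have h1 : |S x| ^ r ≤ M ^ r := Real.rpow_le_rpow (abs_nonneg _) (hM x) hr
  have h2 := hN x
  have h3 : 0 ≤ |S x| ^ r := by positivity
  gcongr
  exact h3.trans h1

lemma holder3 {d : ℕ} {q : ℝ} (hq : 2 < q) {S a b : Eu d → ℝ} (hS : Reg S) (ha : Reg a) (hb : Reg b) :
    ∫ x, |S x| ^ (q - 2) * (|a x| * |b x|) ≤ nR q S ^ (q - 2) * (nR q a * nR q b) := by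
  have hq0 : 0 < q := by linarith
  have habs : ∀ {f : Eu d → ℝ}, Reg f → Reg (fun x => |f x|) := fun {f} hf =>
    ⟨hf.1.abs, hf.2.1.abs, by simpa using hf.2.2⟩
  have hint := Reg.mul3_int (by linarith : 0 ≤ q - 2) hS (habs ha) (habs hb)
  have hR : 0 ≤ nR q S ^ (q - 2) * (nR q a * nR q b) :=
    mul_nonneg (Real.rpow_nonneg (nR_nonneg _ _) _) (mul_nonneg (nR_nonneg _ _) (nR_nonneg _ _))
  rw [← ENNReal.ofReal_le_ofReal_iff hR,
    ofReal_integral_eq_lintegral_ofReal hint (Filter.Eventually.of_forall fun x => by positivity)]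
  let G : Fin 3 → Eu d → ℝ := ![S, a, b]
  let w : Fin 3 → ℝ := ![(q - 2) / q, 1 / q, 1 / q]
  have hG : ∀ i, Reg (G i) := by intro i; fin_cases i <;> [exact hS; exact ha; exact hb]
  have hw : ∀ i, 0 ≤ w i := by
    intro i; fin_cases i
    · exact div_nonneg (by linarith) hq0.le
    · exact div_nonneg (by linarith) hq0.le
    · exact div_nonneg (by linarith) hq0.le
  have key := ENNReal.lintegral_prod_norm_pow_le (μ := (volume : Measure (Eu d))) (s := Finset.univ)
    (f := fun i x => ENNReal.ofReal (|G i x| ^ q)) (p := w)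
    (fun i _ => (((hG i).1.abs.rpow_const fun x => Or.inr hq0.le).measurable.ennreal_ofReal).aemeasurable)
    (by simp [Fin.sum_univ_three, w]; field_simp; ring) (fun i _ => hw i)
  have e : ∀ i, (∫⁻ x, ENNReal.ofReal (|G i x| ^ q)) = ENNReal.ofReal (nR q (G i) ^ q) := by
    intro i
    rw [nR_pow hq0, ofReal_integral_eq_lintegral_ofReal ((hG i).rpow_int (by linarith))
      (Filter.Eventually.of_forall fun x => by positivity)]
  simp_rw [e] at key
  have e2 : ∀ (r : ℝ) (i), 0 ≤ r → ENNReal.ofReal (r ^ q) ^ w i = ENNReal.ofReal (r ^ (q * w i)) := by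
    intro r i hr
    rw [ENNReal.ofReal_rpow_of_nonneg (by positivity) (hw i), ← Real.rpow_mul hr]
  have w0 : q * w 0 = q - 2 := by simp [w]; field_simp
  have w1 : q * w 1 = 1 := by simp [w]; field_simp
  have w2 : q * w 2 = 1 := by simp [w]; field_simp
  simp only [Fin.prod_univ_three] at key
  simp_rw [e2 _ _ (abs_nonneg _), e2 _ _ (nR_nonneg _ _), w0, w1, w2, Real.rpow_one] at key
  have n1 := nR_nonneg q S
  have n2 := nR_nonneg q a
  have n3 := nR_nonneg q b
  have p1 : ∀ x y z : ℝ, 0 ≤ x → 0 ≤ y → 0 ≤ z →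
      ENNReal.ofReal x * ENNReal.ofReal y * ENNReal.ofReal z = ENNReal.ofReal (x * (y * z)) := by
    intro x y z hx hy hz
    rw [ENNReal.ofReal_mul hx, ENNReal.ofReal_mul hy, mul_assoc]
  rw [p1 _ _ _ (Real.rpow_nonneg (nR_nonneg _ _) _) (nR_nonneg _ _) (nR_nonneg _ _)] at key
  have p2 : ∀ x, ENNReal.ofReal (|G 0 x| ^ (q - 2)) * ENNReal.ofReal |G 1 x| * ENNReal.ofReal |G 2 x|
      = ENNReal.ofReal (|S x| ^ (q - 2) * (|a x| * |b x|)) := by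
    intro x
    rw [p1 _ _ _ (by positivity) (by positivity) (by positivity)]; rfl
  simp_rw [p2] at key
  exact key

/-- basis vector. -/
noncomputable def eB {d : ℕ} (i : Fin d) : Eu d := EuclideanSpace.single i 1

lemma ibp_S {d : ℕ} {q : ℝ} (hq : 2 < q) {S g : Eu d → ℝ} (hS : Reg1 S) (hg : Reg1 g) (v : Eu d) :
    ∫ x, |S x| ^ (q - 2) * (S x * fderiv ℝ g x v) =
      -∫ x, (q - 1) * (|S x| ^ (q - 2) * (fderiv ℝ S x v * g x)) := by
  have hf : ∀ x, HasFDerivAt (fun x => |S x| ^ (q - 2) * S x)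
      (((q - 1) * |S x| ^ (q - 2)) • fderiv ℝ S x) x := by
    intro x
    exact (phi_deriv hq (S x)).comp_hasFDerivAt x (hS.2.1 x).hasFDerivAt
  have := integral_mul_fderiv_eq_neg_fderiv_mul_of_integrable (μ := (volume : Measure (Eu d)))
    (f := fun x => |S x| ^ (q - 2) * S x) (g := g) (v := v) ?_ ?_ ?_ (fun x _ => (hf x).differentiableAt)
    (fun x _ => hg.2.1 x)
  · simp_rw [(hf _).fderiv] at this
    simp only [smul_apply, smul_eq_mul] at this
    simpa [mul_assoc] using this
  · simp_rw [(hf _).fderiv]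
    simp only [smul_apply, smul_eq_mul]
    have := (Reg.mul3_int (by linarith : 0 ≤ q - 2) hS.1 (hS.2.2 v) hg.1).const_mul (q - 1)
    simpa [mul_assoc] using this
  · have := (Reg.mul3_int (by linarith : 0 ≤ q - 2) hS.1 hS.1 (hg.2.2 v))
    simpa [mul_assoc] using this
  · have := (Reg.mul3_int (by linarith : 0 ≤ q - 2) hS.1 hS.1 hg.1)
    simpa [mul_assoc] using this

lemma fderiv_sum_range {d : ℕ} {v : ℕ → Eu d → ℝ} (hv : ∀ k, Reg1 (v k)) (n : ℕ) (x e : Eu d) :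
    fderiv ℝ (fun x => ∑ k ∈ Finset.range n, v k x) x e = ∑ k ∈ Finset.range n, fderiv ℝ (v k) x e := by
  rw [fderiv_fun_sum (fun i _ => (hv i).2.1 x)]
  simp

lemma cross_bound {d : ℕ} {q : ℝ} (hq : 2 < q) {v : ℕ → Eu d → ℝ} {g : ℕ → Fin d → Eu d → ℝ}
    {a : ℕ → ℝ} {L : ℝ} (hL : 0 < L) (ha : ∀ k, 0 ≤ a k)
    (hv : ∀ k, Reg1 (v k)) (hg : ∀ k i, Reg1 (g k i))
    (hdiv : ∀ k x, v k x = ∑ i, fderiv ℝ (g k i) x (eB i))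
    (h2 : ∀ k i, nR q (fun x => fderiv ℝ (v k) x (eB i)) ≤ L * 2 ^ k * a k)
    (h3 : ∀ k i, nR q (g k i) ≤ (L * 2 ^ k)⁻¹ * a k) (k : ℕ) {S : Eu d → ℝ}
    (hS : S = fun x => ∑ j ∈ Finset.range k, v j x) :
    ∫ x, |S x| ^ (q - 2) * (S x * v k x) ≤
      (q - 1) * d * (nR q S ^ (q - 2) * (a k * ∑ j ∈ Finset.range k, (2 : ℝ) ^ ((j : ℝ) - k) * a j)) := by
  have hS1 : Reg1 S := by rw [hS]; exact Reg1.sum hv k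
  have hq2 : 0 ≤ q - 2 := by linarith
  have e1 : ∀ x, |S x| ^ (q - 2) * (S x * v k x) =
      ∑ i, |S x| ^ (q - 2) * (S x * fderiv ℝ (g k i) x (eB i)) := by
    intro x; rw [hdiv k x, Finset.mul_sum, Finset.mul_sum]
  simp_rw [e1]
  rw [integral_finsetSum _ (fun i _ => Reg.mul3_int hq2 hS1.1 hS1.1 ((hg k i).2.2 _))]
  have e2 : ∀ i, ∫ x, |S x| ^ (q - 2) * (S x * fderiv ℝ (g k i) x (eB i)) ≤
      (q - 1) * (nR q S ^ (q - 2) * (a k * ∑ j ∈ Finset.range k, (2 : ℝ) ^ ((j : ℝ) - k) * a j)) := by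
    intro i
    rw [ibp_S hq hS1 (hg k i), ← integral_neg]
    have habs : ∀ {f : Eu d → ℝ}, Reg f → Reg (fun x => |f x|) := fun {f} hf =>
      ⟨hf.1.abs, hf.2.1.abs, by simpa using hf.2.2⟩
    have hi : ∀ j, Integrable fun x => |S x| ^ (q - 2) * (|fderiv ℝ (v j) x (eB i)| * |g k i x|) :=
      fun j => Reg.mul3_int hq2 hS1.1 (habs ((hv j).2.2 _)) (habs (hg k i).1)
    calc ∫ x, -((q - 1) * (|S x| ^ (q - 2) * (fderiv ℝ S x (eB i) * g k i x)))
        ≤ ∫ x, (q - 1) * ∑ j ∈ Finset.range k, |S x| ^ (q - 2) * (|fderiv ℝ (v j) x (eB i)| * |g k i x|) := by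
          apply integral_mono
          · exact ((Reg.mul3_int hq2 hS1.1 (hS1.2.2 _) (hg k i).1).const_mul _).neg
          · exact (integrable_finsetSum _ fun j _ => hi j).const_mul _
          · intro x
            simp only
            rw [← mul_neg, ← Finset.mul_sum, ← Finset.sum_mul, ← mul_neg]
            have hP : 0 ≤ |S x| ^ (q - 2) := by positivity
            have hq1 : 0 ≤ q - 1 := by linarith
            gcongr
            have : |fderiv ℝ S x (eB i)| ≤ ∑ j ∈ Finset.range k, |fderiv ℝ (v j) x (eB i)| := by
              rw [hS, fderiv_sum_range hv]; exact Finset.abs_sum_le_sum_abs _ _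
            calc -(fderiv ℝ S x (eB i) * g k i x) ≤ |fderiv ℝ S x (eB i) * g k i x| := neg_le_abs _
              _ = |fderiv ℝ S x (eB i)| * |g k i x| := abs_mul _ _
              _ ≤ _ := by gcongr
      _ = (q - 1) * ∑ j ∈ Finset.range k, ∫ x, |S x| ^ (q - 2) * (|fderiv ℝ (v j) x (eB i)| * |g k i x|) := by
          rw [integral_const_mul, integral_finsetSum _ fun j _ => hi j]
      _ ≤ (q - 1) * ∑ j ∈ Finset.range k, nR q S ^ (q - 2) * (a k * ((2 : ℝ) ^ ((j : ℝ) - k) * a j)) := by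
          have hq1 : 0 ≤ q - 1 := by linarith
          have hX : 0 ≤ nR q S ^ (q - 2) := Real.rpow_nonneg (nR_nonneg _ _) _
          gcongr with j hj
          refine (holder3 hq hS1.1 ((hv j).2.2 _) (hg k i).1).trans (mul_le_mul_of_nonneg_left ?_ hX)
          calc _ ≤ (L * 2 ^ j * a j) * ((L * 2 ^ k)⁻¹ * a k) :=
                mul_le_mul (h2 j i) (h3 k i) (nR_nonneg _ _) (by have := ha j; positivity)
            _ = _ := by
                rw [Real.rpow_sub (by norm_num), Real.rpow_natCast, Real.rpow_natCast]
                field_simp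
      _ = _ := by rw [← Finset.mul_sum, ← Finset.mul_sum]
  calc _ ≤ ∑ i : Fin d, (q - 1) * (nR q S ^ (q - 2) * (a k * ∑ j ∈ Finset.range k, (2 : ℝ) ^ ((j : ℝ) - k) * a j)) :=
        Finset.sum_le_sum fun i _ => e2 i
    _ = _ := by rw [Finset.sum_const, Finset.card_univ, Fintype.card_fin, nsmul_eq_mul]; ring

lemma besov_real {d : ℕ} {q : ℝ} (hq : 2 < q) {v : ℕ → Eu d → ℝ} {g : ℕ → Fin d → Eu d → ℝ}
    {a : ℕ → ℝ} {L : ℝ} (hL : 0 < L) (ha : ∀ k, 0 ≤ a k)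
    (hv : ∀ k, Reg1 (v k)) (hg : ∀ k i, Reg1 (g k i))
    (hdiv : ∀ k x, v k x = ∑ i, fderiv ℝ (g k i) x (eB i))
    (h1 : ∀ k, nR q (v k) ≤ a k)
    (h2 : ∀ k i, nR q (fun x => fderiv ℝ (v k) x (eB i)) ≤ L * 2 ^ k * a k)
    (h3 : ∀ k i, nR q (g k i) ≤ (L * 2 ^ k)⁻¹ * a k) (n : ℕ) :
    nR q (fun x => ∑ j ∈ Finset.range n, v j x) ^ 2 ≤
      (1 + 6 * (q * (q - 1) * d + (q ^ 2 + (q + 1) ^ q + q ^ q))) * ∑ k ∈ Finset.range n, a k ^ 2 := by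
  have hq0 : 0 < q := by linarith
  have hq2 : 0 ≤ q - 2 := by linarith
  have hK : 0 ≤ q ^ 2 + (q + 1) ^ q + q ^ q := by positivity
  have hC1 : 0 ≤ q * (q - 1) * d := by
    have : 0 ≤ q - 1 := by linarith
    positivity
  refine recur hq (by linarith) n (fun n => nR q (fun x => ∑ j ∈ Finset.range n, v j x)) a
    (fun k => nR_nonneg _ _) ha ?_ ?_
  · simp [nR, Real.zero_rpow hq0.ne', hq0.ne']
  · intro k _
    set S : Eu d → ℝ := fun x => ∑ j ∈ Finset.range k, v j x with hS
    set K := q ^ 2 + (q + 1) ^ q + q ^ q with hKdef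
    have hS1 : Reg1 S := Reg1.sum hv k
    have hcross := cross_bound hq hL ha hv hg hdiv h2 h3 k hS
    have hbb : ∫ x, |S x| ^ (q - 2) * (v k x) ^ 2 ≤ nR q S ^ (q - 2) * a k ^ 2 := by
      have := holder3 hq hS1.1 (hv k).1 (hv k).1
      have e : ∀ x, |v k x| * |v k x| = v k x ^ 2 := fun x => by rw [← abs_mul, ← sq, abs_of_nonneg (sq_nonneg _)]
      simp_rw [e] at this
      refine this.trans ?_
      have hX : 0 ≤ nR q S ^ (q - 2) := Real.rpow_nonneg (nR_nonneg _ _) _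
      gcongr
      rw [sq]
      exact mul_le_mul (h1 k) (h1 k) (nR_nonneg _ _) (ha k)
    have hvq : ∫ x, |v k x| ^ q ≤ a k ^ q := by
      rw [← nR_pow hq0]; exact Real.rpow_le_rpow (nR_nonneg _ _) (h1 k) hq0.le
    rw [nR_pow hq0, nR_pow hq0]
    have i1 : Integrable fun x => |S x| ^ q := hS1.1.rpow_int (by linarith)
    have i2 : Integrable fun x => |S x| ^ (q - 2) * (S x * v k x) := Reg.mul3_int hq2 hS1.1 hS1.1 (hv k).1
    have i3 : Integrable fun x => |S x| ^ (q - 2) * (v k x) ^ 2 := by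
      simp_rw [sq]; exact Reg.mul3_int hq2 hS1.1 (hv k).1 (hv k).1
    have i4 : Integrable fun x => |v k x| ^ q := (hv k).1.rpow_int (by linarith)
    have i34 : Integrable fun x => |S x| ^ (q - 2) * (v k x) ^ 2 + |v k x| ^ q := i3.add i4
    have i12 : Integrable fun x => |S x| ^ q + q * (|S x| ^ (q - 2) * (S x * v k x)) := i1.add (i2.const_mul q)
    have m : ∫ x, |∑ j ∈ Finset.range (k + 1), v j x| ^ q ≤
        ∫ x, (|S x| ^ q + q * (|S x| ^ (q - 2) * (S x * v k x)) +
          K * (|S x| ^ (q - 2) * (v k x) ^ 2 + |v k x| ^ q)) := by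
      apply integral_mono
      · exact (Reg1.sum hv (k + 1)).1.rpow_int (by linarith)
      · exact i12.add (i34.const_mul K)
      · intro x
        simp only [Finset.sum_range_succ]
        have := pt_ineq hq (S x) (v k x)
        simpa [mul_assoc] using this
    rw [integral_add i12 (i34.const_mul K), integral_add i1 (i2.const_mul q),
      integral_const_mul, integral_const_mul, integral_add i3 i4] at m
    refine m.trans ?_
    set X := nR q S ^ (q - 2) with hX
    have hX0 : 0 ≤ X := Real.rpow_nonneg (nR_nonneg _ _) _
    set Z := ∑ j ∈ Finset.range k, (2 : ℝ) ^ ((j : ℝ) - k) * a j with hZ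
    have hZ0 : 0 ≤ Z := Finset.sum_nonneg fun j _ => by have := ha j; positivity
    have c1 := mul_le_mul_of_nonneg_left hcross hq0.le
    have c2 := mul_le_mul_of_nonneg_left (add_le_add hbb hvq) hK
    have z1 : 0 ≤ K * (X * (a k * Z)) := by have := ha k; positivity
    have z2 : 0 ≤ q * (q - 1) * d * (X * a k ^ 2 + a k ^ q) := by
      have := ha k; positivity
    nlinarith

lemma reg_re {d : ℕ} (l : ℂ →L[ℝ] ℝ) (hl : ∀ z, |l z| ≤ ‖z‖) (F : 𝓢(Eu d, ℂ)) : Reg (fun x => l (F x)) := by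
  refine ⟨l.continuous.comp F.continuous, l.integrable_comp F.integrable, ‖F.toBoundedContinuousFunction‖, fun x => ?_⟩
  exact (hl _).trans (F.toBoundedContinuousFunction.norm_coe_le_norm x)

lemma fderiv_re {d : ℕ} (l : ℂ →L[ℝ] ℝ) (F : 𝓢(Eu d, ℂ)) (x v : Eu d) :
    fderiv ℝ (fun x => l (F x)) x v = l (fderiv ℝ F x v) := by
  have : HasFDerivAt (fun x => l (F x)) (l.comp (fderiv ℝ F x)) x :=
    l.hasFDerivAt.comp x (F.differentiableAt.hasFDerivAt)
  rw [this.fderiv]; rfl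

lemma reg1_re {d : ℕ} (l : ℂ →L[ℝ] ℝ) (hl : ∀ z, |l z| ≤ ‖z‖) (F : 𝓢(Eu d, ℂ)) : Reg1 (fun x => l (F x)) := by
  refine ⟨reg_re l hl F, fun x => l.differentiableAt.comp x F.differentiableAt, fun v => ?_⟩
  simp_rw [fderiv_re]
  have : ∀ x, fderiv ℝ F x v = (LineDeriv.lineDerivOp v F) x := fun x =>
    (SchwartzMap.lineDerivOp_apply_eq_fderiv v F x).symm
  simp_rw [this]
  exact reg_re l hl _

lemma nR_le_nQ {d : ℕ} {q : ℝ} (hq : 0 < q) {f : Eu d → ℝ} {F : Eu d → ℂ} (hf : AEStronglyMeasurable f)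
    (h : ∀ x, |f x| ≤ ‖F x‖) {a : ℝ} (ha : 0 ≤ a) (hF : nQ q F ≤ ENNReal.ofReal a) : nR q f ≤ a := by
  rw [← ENNReal.ofReal_le_ofReal_iff ha]
  refine le_trans ?_ hF
  unfold nR nQ
  rw [← ENNReal.ofReal_rpow_of_nonneg (integral_nonneg fun x => by positivity) (by positivity)]
  refine ENNReal.rpow_le_rpow ?_ (by positivity)
  rw [integral_eq_lintegral_of_nonneg_ae (f := fun x => |f x| ^ q) (Filter.Eventually.of_forall fun x => by positivity)
    ((hf.norm.aemeasurable.pow_const q).aestronglyMeasurable)]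
  refine ENNReal.ofReal_toReal_le.trans (lintegral_mono fun x => ?_)
  rw [← ENNReal.ofReal_rpow_of_nonneg (abs_nonneg _) hq.le, ← ofReal_norm]
  exact ENNReal.rpow_le_rpow (ENNReal.ofReal_le_ofReal (h x)) hq.le

lemma nQ_le_re_im {d : ℕ} {q : ℝ} (hq : 1 ≤ q) {F : Eu d → ℂ}
    (h1 : Reg fun x => (F x).re) (h2 : Reg fun x => (F x).im) :
    nQ q F ≤ ENNReal.ofReal (nR q (fun x => (F x).re)) + ENNReal.ofReal (nR q (fun x => (F x).im)) := by
  have hq0 : 0 < q := by linarith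
  have e : ∀ f : Eu d → ℝ, Reg f → ENNReal.ofReal (nR q f) = (∫⁻ x, (ENNReal.ofReal |f x|) ^ q) ^ (1 / q) := by
    intro f hf
    unfold nR
    rw [← ENNReal.ofReal_rpow_of_nonneg (integral_nonneg fun x => by positivity) (by positivity),
      ofReal_integral_eq_lintegral_ofReal (hf.rpow_int hq) (Filter.Eventually.of_forall fun x => by positivity)]
    simp_rw [ENNReal.ofReal_rpow_of_nonneg (abs_nonneg _) hq0.le]
  rw [e _ h1, e _ h2]
  refine le_trans ?_ (ENNReal.lintegral_Lp_add_le (p := q) h1.1.abs.measurable.ennreal_ofReal.aemeasurable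
    h2.1.abs.measurable.ennreal_ofReal.aemeasurable hq)
  unfold nQ
  gcongr with x
  simp only [Pi.add_apply]
  rw [← ENNReal.ofReal_add (abs_nonneg _) (abs_nonneg _), ← ofReal_norm]
  exact ENNReal.ofReal_le_ofReal (Complex.norm_le_abs_re_add_abs_im _)

lemma besov_cpx {d : ℕ} {q : ℝ} (hq : 2 < q) : ∃ C : ℝ, 0 < C ∧ ∀ {F : ℕ → 𝓢(Eu d, ℂ)} {G : ℕ → Fin d → 𝓢(Eu d, ℂ)}
    {a : ℕ → ℝ} {L : ℝ}, 0 < L → (∀ k, 0 ≤ a k) →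
    (∀ k x, F k x = ∑ i, fderiv ℝ (G k i) x (eB i)) →
    (∀ k, nQ q (F k) ≤ ENNReal.ofReal (a k)) →
    (∀ k i, nQ q (fun x => fderiv ℝ (F k) x (eB i)) ≤ ENNReal.ofReal (L * 2 ^ k * a k)) →
    (∀ k i, nQ q (G k i) ≤ ENNReal.ofReal ((L * 2 ^ k)⁻¹ * a k)) → ∀ (n : ℕ),
    nQ q (fun x => ∑ j ∈ Finset.range n, F j x) ≤
      ENNReal.ofReal C * ENNReal.ofReal (√(∑ k ∈ Finset.range n, a k ^ 2)) := by
  set B := (1 + 6 * (q * (q - 1) * d + (q ^ 2 + (q + 1) ^ q + q ^ q))) with hB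
  have hB0 : 0 < B := by
    have : 0 ≤ q - 1 := by linarith
    have : 0 < q := by linarith
    positivity
  have hq0 : 0 < q := by linarith
  refine ⟨2 * √B, by positivity, ?_⟩
  intro F G a L hL ha hdiv h1 h2 h3 n
  have key : ∀ l : ℂ →L[ℝ] ℝ, (∀ z, |l z| ≤ ‖z‖) →
      nR q (fun x => ∑ j ∈ Finset.range n, l (F j x)) ≤ √B * √(∑ k ∈ Finset.range n, a k ^ 2) := by
    intro l hl
    have := besov_real (d := d) hq (v := fun k x => l (F k x)) (g := fun k i x => l (G k i x)) hL ha
      (fun k => reg1_re l hl _) (fun k i => reg1_re l hl _) ?_ ?_ ?_ ?_ n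
    · rw [← Real.sqrt_mul hB0.le]
      exact Real.le_sqrt_of_sq_le this
    · intro k x
      simp_rw [fderiv_re, hdiv k x, map_sum]
    · intro k
      exact nR_le_nQ hq0 (reg1_re l hl _).1.1.aestronglyMeasurable (fun x => hl _) (ha k) (h1 k)
    · intro k i
      refine nR_le_nQ hq0 ((reg1_re l hl _).2.2 _).1.aestronglyMeasurable (fun x => ?_) ?_ (h2 k i)
      · rw [fderiv_re]; exact hl _
      · have := ha k
        positivity
    · intro k i
      refine nR_le_nQ hq0 (reg1_re l hl _).1.1.aestronglyMeasurable (fun x => hl _) ?_ (h3 k i)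
      have := ha k
      positivity
  have kre := key Complex.reCLM (fun z => Complex.abs_re_le_norm z)
  have kim := key Complex.imCLM (fun z => Complex.abs_im_le_norm z)
  have rre := (Reg1.sum (fun k => reg1_re Complex.reCLM (fun z => Complex.abs_re_le_norm z) (F k)) n).1
  have rim := (Reg1.sum (fun k => reg1_re Complex.imCLM (fun z => Complex.abs_im_le_norm z) (F k)) n).1
  simp only [Complex.reCLM_apply, Complex.imCLM_apply] at kre kim rre rim
  have := nQ_le_re_im (q := q) (by linarith) (F := fun x => ∑ j ∈ Finset.range n, F j x)
    (by simpa using rre) (by simpa using rim)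
  refine this.trans ?_
  simp only [Complex.re_sum, Complex.im_sum]
  rw [← ENNReal.ofReal_mul (by positivity), ← ENNReal.ofReal_add (nR_nonneg _ _) (nR_nonneg _ _)]
  apply ENNReal.ofReal_le_ofReal
  linarith

lemma timeLp_eq {p : ℝ≥0∞} (hp : p ≠ 0) (g : ℝ → ℝ≥0∞) : timeLp p Set.univ g = eLpNorm g p volume := by
  unfold timeLp
  rw [Measure.restrict_univ]
  split_ifs with h
  · rw [h, eLpNorm_exponent_top]; rfl
  · rw [eLpNorm_eq_lintegral_rpow_enorm_toReal hp h]; rfl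

lemma minkowski_sq {p : ℝ≥0∞} (hp : 2 ≤ p) (s : Finset ℕ) (b : ℕ → ℝ → ℝ≥0∞) (hb : ∀ k, Measurable (b k)) :
    eLpNorm (fun t => (∑ k ∈ s, b k t ^ (2 : ℝ)) ^ (1 / 2 : ℝ)) p volume ≤
      (∑ k ∈ s, eLpNorm (b k) p volume ^ (2 : ℝ)) ^ (1 / 2 : ℝ) := by
  have h1 := eLpNorm_enorm_rpow (p := p) (μ := (volume : Measure ℝ)) (fun t => ∑ k ∈ s, b k t ^ (2 : ℝ))
    (show (0 : ℝ) < 1 / 2 by norm_num)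
  simp only [enorm_eq_self] at h1
  rw [h1]
  refine ENNReal.rpow_le_rpow ?_ (by norm_num)
  have hp1 : 1 ≤ p * ENNReal.ofReal (1 / 2) := by
    calc (1 : ℝ≥0∞) = 2 * ENNReal.ofReal (1 / 2) := by
          rw [show (2 : ℝ≥0∞) = ENNReal.ofReal 2 by norm_num, ← ENNReal.ofReal_mul (by norm_num)]; norm_num
      _ ≤ _ := by gcongr
  have h2 : ∀ k, eLpNorm (fun t => b k t ^ (2 : ℝ)) (p * ENNReal.ofReal (1 / 2)) volume = eLpNorm (b k) p volume ^ (2 : ℝ) := by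
    intro k
    have := eLpNorm_enorm_rpow (p := p * ENNReal.ofReal (1 / 2)) (μ := (volume : Measure ℝ)) (b k)
      (show (0 : ℝ) < 2 by norm_num)
    simp only [enorm_eq_self] at this
    rw [this, mul_assoc, ← ENNReal.ofReal_mul (by norm_num)]
    norm_num
  simp_rw [← h2]
  have h3 := eLpNorm_sum_le (μ := (volume : Measure ℝ)) (s := s) (f := fun k t => b k t ^ (2 : ℝ))
    (fun k _ => ((hb k).pow_const 2).aestronglyMeasurable) hp1
  have e : (fun t => ∑ k ∈ s, b k t ^ (2 : ℝ)) = ∑ k ∈ s, (fun t => b k t ^ (2 : ℝ)) := by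
    ext t; simp
  rw [e]
  exact h3

lemma EE_cont {d : ℕ} {h : Eu d → ℂ} (hh : Integrable h) : Continuous fun w : ℝ × Eu d => EE h w.1 w.2 := by
  unfold EE
  refine continuous_of_dominated (bound := fun ξ => ‖h ξ‖) ?_ ?_ hh.norm ?_
  · intro w
    have : Continuous fun ξ => Complex.exp ((thetaP w.1 w.2 ξ : ℝ) * I) := by
      have := thetaP_cont w.1 w.2
      fun_prop
    exact this.aestronglyMeasurable.mul hh.1
  · intro w
    refine Filter.Eventually.of_forall fun ξ => ?_
    rw [norm_mul, Complex.norm_exp_ofReal_mul_I, one_mul]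
  · refine Filter.Eventually.of_forall fun ξ => ?_
    unfold thetaP
    fun_prop

lemma nQ_meas {d : ℕ} {h : Eu d → ℂ} (hh : Integrable h) (q : ℝ) : Measurable fun t => nQ q (EE h t) := by
  unfold nQ
  refine Measurable.pow_const ?_ _
  exact Measurable.lintegral_prod_right' (f := fun w : ℝ × Eu d => ‖EE h w.1 w.2‖ₑ ^ q)
    ((EE_cont hh).measurable.enorm.pow_const q)

lemma EE_const_mul {d : ℕ} (h : Eu d → ℂ) (c : ℂ) (t : ℝ) (x : Eu d) :
    EE (fun ξ => c * h ξ) t x = c * EE h t x := by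
  unfold EE
  rw [← integral_const_mul]
  congr 1; ext ξ; ring

/-- multiplier of a derivative. -/
noncomputable def mD {d : ℕ} (i : Fin d) (h : Eu d → ℂ) (ξ : Eu d) : ℂ := 2 * π * I * (ξ i : ℂ) * h ξ

/-- multiplier of an antiderivative. -/
noncomputable def mV {d : ℕ} (i : Fin d) (h : Eu d → ℂ) (ξ : Eu d) : ℂ :=
  (((ξ i : ℝ) / ‖ξ‖ ^ 2 : ℝ) : ℂ) * (2 * π * I)⁻¹ * h ξ

lemma coord_smooth {d : ℕ} (i : Fin d) : ContDiff ℝ (⊤ : ℕ∞) fun ξ : Eu d => (ξ i : ℝ) :=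
  (EuclideanSpace.proj i : Eu d →L[ℝ] ℝ).contDiff

lemma Good.mD {d : ℕ} {k : ℤ} {h : Eu d → ℂ} (hh : Good k h) (i : Fin d) : Good k (mD i h) := by
  refine ⟨?_, fun ξ hξ => hh.2 ξ fun h0 => hξ (by simp [_root_.mD, h0])⟩
  unfold _root_.mD
  have h1 : ContDiff ℝ (⊤ : ℕ∞) fun ξ : Eu d => ((ξ i : ℝ) : ℂ) := Complex.ofRealCLM.contDiff.comp (coord_smooth i)
  exact (contDiff_const.mul h1).mul hh.1

lemma Good.mV {d : ℕ} {k : ℤ} {h : Eu d → ℂ} (hh : Good k h) (i : Fin d) : Good k (mV i h) := by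
  refine ⟨?_, fun ξ hξ => hh.2 ξ fun h0 => hξ (by simp [_root_.mV, h0])⟩
  rw [contDiff_iff_contDiffAt]
  intro z
  by_cases hz : z = 0
  · have : (_root_.mV i h) =ᶠ[nhds z] fun _ => 0 := by
      have : ∀ᶠ w in nhds z, ‖w‖ < (2 : ℝ) ^ (k - 1) := by
        apply (continuous_norm.tendsto z).eventually_lt_const
        simp only [hz, norm_zero]; positivity
      filter_upwards [this] with w hw
      have : h w = 0 := by
        by_contra h
        linarith [(hh.2 w h).1]
      simp [_root_.mV, this]
    exact contDiffAt_const.congr_of_eventuallyEq this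
  · unfold _root_.mV
    have hn : ‖z‖ ^ 2 ≠ 0 := by positivity
    have h1 : ContDiffAt ℝ (⊤ : ℕ∞) (fun ξ : Eu d => (ξ i : ℝ) / ‖ξ‖ ^ 2) z :=
      (coord_smooth i).contDiffAt.div (contDiff_norm_sq ℝ).contDiffAt hn
    have h2 : ContDiffAt ℝ (⊤ : ℕ∞) (fun ξ : Eu d => (((ξ i : ℝ) / ‖ξ‖ ^ 2 : ℝ) : ℂ)) z :=
      Complex.ofRealCLM.contDiff.contDiffAt.comp z h1
    exact (h2.mul contDiffAt_const).mul hh.1.contDiffAt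

lemma Good.const_mul {d : ℕ} {k : ℤ} {h : Eu d → ℂ} (hh : Good k h) (c : ℂ) : Good k (fun ξ => c * h ξ) :=
  ⟨contDiff_const.mul hh.1, fun ξ hξ => hh.2 ξ fun h0 => hξ (by simp [h0])⟩

lemma nQ_mono_mul {d : ℕ} {q : ℝ} (hq : 0 < q) {f g : Eu d → ℂ} {c : ℝ} (hc : 0 ≤ c)
    (h : ∀ x, ‖f x‖ ≤ c * ‖g x‖) : nQ q f ≤ ENNReal.ofReal c * nQ q g := by
  have e : ENNReal.ofReal c * nQ q g = nQ q (fun x => (c : ℂ) * g x) := by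
    rw [nQ_const_mul hq, ← ofReal_norm, Complex.norm_real, Real.norm_of_nonneg hc]
  rw [e]
  unfold nQ
  gcongr with x
  rw [← ofReal_norm, ← ofReal_norm, norm_mul, Complex.norm_real, Real.norm_of_nonneg hc]
  exact ENNReal.ofReal_le_ofReal (h x)

lemma nQ_mD {d : ℕ} {k : ℤ} {h : Eu d → ℂ} (hh : Good k h) (i : Fin d) :
    nQ 2 (fun ξ => (((2 : ℝ) ^ k)⁻¹ : ℝ) * mD i h ξ) ≤ ENNReal.ofReal (4 * π) * nQ 2 h := by
  refine nQ_mono_mul (by norm_num) (by positivity) fun ξ => ?_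
  by_cases h0 : h ξ = 0
  · simp [mD, h0]
  have h1 := (hh.2 ξ h0).2
  have h2 : |ξ i| ≤ ‖ξ‖ := by simpa using PiLp.norm_apply_le (p := 2) ξ i
  have hk : (0 : ℝ) < 2 ^ k := by positivity
  rw [zpow_add₀ (by norm_num), zpow_one] at h1
  unfold mD
  simp only [norm_mul, Complex.norm_real, Complex.norm_I, Complex.norm_ofNat, mul_one, Real.norm_eq_abs]
  rw [abs_of_pos (by positivity), abs_of_pos Real.pi_pos, ← mul_assoc]
  refine mul_le_mul_of_nonneg_right ?_ (norm_nonneg _)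
  rw [inv_mul_le_iff₀ hk]
  have := Real.pi_pos
  nlinarith

lemma nQ_mV {d : ℕ} {k : ℤ} {h : Eu d → ℂ} (hh : Good k h) (i : Fin d) :
    nQ 2 (fun ξ => ((2 : ℝ) ^ k : ℝ) * mV i h ξ) ≤ ENNReal.ofReal (4 * π) * nQ 2 h := by
  refine nQ_mono_mul (by norm_num) (by positivity) fun ξ => ?_
  by_cases h0 : h ξ = 0
  · simp [mV, h0]
  have h1 := (hh.2 ξ h0).1
  have h2 : |ξ i| ≤ ‖ξ‖ := by simpa using PiLp.norm_apply_le (p := 2) ξ i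
  have hk : (0 : ℝ) < 2 ^ k := by positivity
  rw [zpow_sub₀ (by norm_num), zpow_one] at h1
  have hn : 0 < ‖ξ‖ := by linarith [show (0 : ℝ) < 2 ^ k / 2 by positivity]
  unfold mV
  simp only [norm_mul, norm_inv, Complex.norm_real, Complex.norm_I, Complex.norm_ofNat, mul_one, Real.norm_eq_abs]
  rw [abs_of_pos hk, abs_of_pos Real.pi_pos, abs_div, abs_of_pos (by positivity : 0 < ‖ξ‖ ^ 2), ← mul_assoc]
  refine mul_le_mul_of_nonneg_right ?_ (norm_nonneg _)
  have hpi := Real.pi_gt_three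
  have e1 : |ξ i| / ‖ξ‖ ^ 2 ≤ 1 / ‖ξ‖ := by
    rw [div_le_div_iff₀ (by positivity) hn]; nlinarith
  have e2 : 1 / ‖ξ‖ ≤ 2 / 2 ^ k := by
    rw [div_le_div_iff₀ hn hk]; linarith
  have e3 : (2 * π)⁻¹ ≤ 1 := inv_le_one_of_one_le₀ (by linarith)
  calc 2 ^ k * (|ξ i| / ‖ξ‖ ^ 2 * (2 * π)⁻¹) ≤ 2 ^ k * (2 / 2 ^ k * 1) :=
        mul_le_mul_of_nonneg_left (mul_le_mul (e1.trans e2) e3 (by positivity) (by positivity)) hk.le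
    _ = 2 := by field_simp
    _ ≤ 4 * π := by linarith

lemma EE_fderiv {d : ℕ} {h : Eu d → ℂ} {k : ℤ} (hh : Good k h) (i : Fin d) (t : ℝ) (F : 𝓢(Eu d, ℂ))
    (hF : ∀ x, F x = EE h t x) (x : Eu d) : fderiv ℝ F x (eB i) = EE (mD i h) t x := by
  obtain ⟨F1, f1, a1, b1, c1⟩ := EE_schwartz hh.1 hh.hcs t
  obtain ⟨F2, f2, a2, b2, c2⟩ := EE_schwartz (hh.mD i).1 (hh.mD i).hcs t
  have e : F = F1 := by ext x; rw [hF, a1]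
  rw [e, ← SchwartzMap.lineDerivOp_apply_eq_fderiv, b1, SchwartzMap.lineDerivOp_fourierInv_eq, ← a2, b2]
  congr 2
  ext ξ
  have ht : Function.HasTemperateGrowth (fun ξ : Eu d => (inner ℝ ξ (eB i) : ℝ)) := by fun_prop
  rw [smul_apply, SchwartzMap.smulLeftCLM_apply_apply ht, c2, c1]
  unfold mD eB
  rw [EuclideanSpace.inner_single_right]
  simp
  ring

lemma EE_div {d : ℕ} {h : Eu d → ℂ} {k : ℤ} (hh : Good k h) (t : ℝ) (x : Eu d) :
    EE h t x = ∑ i, EE (mD i (mV i h)) t x := by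
  unfold EE
  rw [← integral_finsetSum]
  · congr 1; ext ξ
    rw [← Finset.mul_sum]
    congr 1
    by_cases h0 : h ξ = 0
    · simp [mD, mV, h0]
    have hn : 0 < ‖ξ‖ := lt_of_lt_of_le (by positivity) (hh.2 ξ h0).1
    have hpi : (2 * π * I : ℂ) ≠ 0 := by simp [Real.pi_ne_zero]
    have e : ∀ i, mD i (mV i h) ξ = (((ξ i) ^ 2 / ‖ξ‖ ^ 2 : ℝ) : ℂ) * h ξ := by
      intro i
      unfold mD mV
      push_cast
      field_simp
    simp_rw [e]
    rw [← Finset.sum_mul, ← Complex.ofReal_sum, ← Finset.sum_div, EuclideanSpace.norm_sq_eq]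
    simp only [Real.norm_eq_abs, sq_abs]
    have : ∑ i, ξ i ^ 2 ≠ 0 := by
      have h3 := EuclideanSpace.norm_sq_eq ξ
      simp only [Real.norm_eq_abs, sq_abs] at h3
      rw [← h3]; positivity
    rw [div_self this]; simp
  · intro i _
    have hg := (hh.mV i).mD i
    have hi : Integrable (mD i (mV i h)) := hg.1.continuous.integrable_of_hasCompactSupport hg.hcs
    refine hi.bdd_mul (c := 1) ?_ ?_
    · have : Continuous fun ξ => Complex.exp ((thetaP t x ξ : ℝ) * I) := by
        have := thetaP_cont t x
        fun_prop
      exact this.aestronglyMeasurable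
    · exact Filter.Eventually.of_forall fun ξ => (Complex.norm_exp_ofReal_mul_I _).le

/-- The size of a dyadic piece together with its normalized derivatives and antiderivatives. -/
noncomputable def Aq {d : ℕ} (q : ℝ) (k : ℤ) (h : Eu d → ℂ) (t : ℝ) : ℝ≥0∞ :=
  nQ q (EE h t) + ∑ i : Fin d, (nQ q (EE (fun ξ => (((2 : ℝ) ^ k)⁻¹ : ℝ) * mD i h ξ) t) +
    nQ q (EE (fun ξ => ((2 : ℝ) ^ k : ℝ) * mV i h ξ) t))

lemma Good.integrable {d : ℕ} {k : ℤ} {h : Eu d → ℂ} (hh : Good k h) : Integrable h :=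
  hh.1.continuous.integrable_of_hasCompactSupport hh.hcs

lemma Aq_meas {d : ℕ} {q : ℝ} {k : ℤ} {h : Eu d → ℂ} (hh : Good k h) : Measurable (Aq q k h) := by
  unfold Aq
  refine (nQ_meas hh.integrable q).add (Finset.measurable_sum _ fun i _ => ?_)
  exact (nQ_meas ((hh.mD i).const_mul _).integrable q).add (nQ_meas ((hh.mV i).const_mul _).integrable q)

lemma nQ_ne_top {d : ℕ} {q : ℝ} (hq : 0 < q) {k : ℤ} {h : Eu d → ℂ} (hh : Good k h) (t : ℝ) :
    nQ q (EE h t) ≠ ∞ := by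
  obtain ⟨F, f, hF, -, -⟩ := EE_schwartz hh.1 hh.hcs t
  have h1 := (F.memLp (ENNReal.ofReal q) (volume : Measure (Eu d))).2
  rw [eLpNorm_eq_lintegral_rpow_enorm_toReal (by simpa using hq) (by finiteness), ENNReal.toReal_ofReal hq.le] at h1
  unfold nQ
  simp_rw [← hF]
  exact h1.ne

lemma Aq_ne_top {d : ℕ} {q : ℝ} (hq : 0 < q) {k : ℤ} {h : Eu d → ℂ} (hh : Good k h) (t : ℝ) :
    Aq q k h t ≠ ∞ := by
  unfold Aq
  refine ENNReal.add_ne_top.mpr ⟨nQ_ne_top hq hh t, ?_⟩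
  refine (ENNReal.sum_ne_top).mpr fun i _ => ?_
  exact ENNReal.add_ne_top.mpr ⟨nQ_ne_top hq ((hh.mD i).const_mul _) t, nQ_ne_top hq ((hh.mV i).const_mul _) t⟩

lemma Aq_bound {d : ℕ} {p q : ℝ≥0∞} (hadm : Admissible d p q) (hq2 : 2 < q) (hqt : q ≠ ∞) :
    ∃ C : ℝ≥0∞, C ≠ ∞ ∧ ∀ (k : ℤ) (h : Eu d → ℂ), Good k h →
      eLpNorm (Aq q.toReal k h) p volume ≤ C * (ENNReal.ofReal (((2 : ℝ) ^ k) ^ gammaExp d p q) * nQ 2 h) := by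
  obtain ⟨C, hC, hLS⟩ := LS hadm hq2 hqt
  have hp2 := hadm.1
  have hp0 : p ≠ 0 := by
    intro h; simp [h] at hp2
  have hp1 : 1 ≤ p := le_trans (by norm_num) hp2
  simp_rw [timeLp_eq hp0] at hLS
  refine ⟨C * (1 + d * (2 * ENNReal.ofReal (4 * π))), by finiteness, fun k h hh => ?_⟩
  set Z := ENNReal.ofReal (((2 : ℝ) ^ k) ^ gammaExp d p q)
  have m0 := nQ_meas hh.integrable q.toReal
  have m1 := fun i => nQ_meas ((hh.mD i).const_mul (((2 : ℝ) ^ k)⁻¹ : ℝ)).integrable q.toReal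
  have m2 := fun i => nQ_meas ((hh.mV i).const_mul ((2 : ℝ) ^ k : ℝ)).integrable q.toReal
  have e : Aq q.toReal k h = (fun t => nQ q.toReal (EE h t)) + ∑ i : Fin d,
      ((fun t => nQ q.toReal (EE (fun ξ => (((2 : ℝ) ^ k)⁻¹ : ℝ) * mD i h ξ) t)) +
        (fun t => nQ q.toReal (EE (fun ξ => ((2 : ℝ) ^ k : ℝ) * mV i h ξ) t))) := by
    ext t; simp [Aq]
  rw [e]
  have b1 : ∀ i, eLpNorm (fun t => nQ q.toReal (EE (fun ξ => (((2 : ℝ) ^ k)⁻¹ : ℝ) * mD i h ξ) t)) p volume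
      ≤ C * (Z * (ENNReal.ofReal (4 * π) * nQ 2 h)) := fun i =>
    (hLS k _ ((hh.mD i).const_mul _)).trans (by gcongr; exact nQ_mD hh i)
  have b2 : ∀ i, eLpNorm (fun t => nQ q.toReal (EE (fun ξ => ((2 : ℝ) ^ k : ℝ) * mV i h ξ) t)) p volume
      ≤ C * (Z * (ENNReal.ofReal (4 * π) * nQ 2 h)) := fun i =>
    (hLS k _ ((hh.mV i).const_mul _)).trans (by gcongr; exact nQ_mV hh i)
  refine (eLpNorm_add_le m0.aestronglyMeasurable
    (Finset.aestronglyMeasurable_sum _ fun i _ => ((m1 i).add (m2 i)).aestronglyMeasurable) hp1).trans ?_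
  calc _ ≤ C * (Z * nQ 2 h) + ∑ i : Fin d, (C * (Z * (ENNReal.ofReal (4 * π) * nQ 2 h)) +
        C * (Z * (ENNReal.ofReal (4 * π) * nQ 2 h))) := by
        refine add_le_add (hLS k h hh) ?_
        refine (eLpNorm_sum_le (fun i _ => ((m1 i).add (m2 i)).aestronglyMeasurable) hp1).trans ?_
        refine Finset.sum_le_sum fun i _ => ?_
        exact (eLpNorm_add_le (m1 i).aestronglyMeasurable (m2 i).aestronglyMeasurable hp1).trans
          (add_le_add (b1 i) (b2 i))
    _ = _ := by
        rw [Finset.sum_const, Finset.card_univ, Fintype.card_fin, nsmul_eq_mul]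
        ring

lemma Aq_besov {d : ℕ} {q : ℝ} (hq : 2 < q) : ∃ C : ℝ, 0 < C ∧ ∀ (k₀ : ℤ) (h : ℕ → Eu d → ℂ),
    (∀ j : ℕ, Good (k₀ + j) (h j)) → ∀ (n : ℕ) (t : ℝ),
    nQ q (fun x => ∑ j ∈ Finset.range n, EE (h j) t x) ≤
      ENNReal.ofReal C * (∑ j ∈ Finset.range n, Aq q (k₀ + j) (h j) t ^ (2 : ℝ)) ^ (1 / 2 : ℝ) := by
  obtain ⟨C, hC, hB⟩ := besov_cpx (d := d) hq
  have hq0 : 0 < q := by linarith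
  refine ⟨C, hC, fun k₀ h hh n t => ?_⟩
  choose F f hF hFf hf using fun j => EE_schwartz (hh j).1 (hh j).hcs t
  choose G g hG hGg hg using fun j i => EE_schwartz ((hh j).mV i).1 ((hh j).mV i).hcs t
  have hfin := fun j => Aq_ne_top hq0 (hh j) t
  have hsc : ∀ j : ℕ, (2 : ℝ) ^ k₀ * 2 ^ j = 2 ^ (k₀ + j) := by
    intro j; rw [zpow_add₀ (by norm_num), zpow_natCast]
  have key := hB (F := F) (G := G) (a := fun j => (Aq q (k₀ + j) (h j) t).toReal) (L := (2 : ℝ) ^ k₀)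
    (by positivity) (fun j => ENNReal.toReal_nonneg) ?_ ?_ ?_ ?_ n
  · simp_rw [hF] at key
    refine key.trans (le_of_eq ?_)
    congr 1
    rw [Real.sqrt_eq_rpow, ← ENNReal.ofReal_rpow_of_nonneg (Finset.sum_nonneg fun j _ => sq_nonneg _) (by norm_num),
      ENNReal.ofReal_sum_of_nonneg fun j _ => sq_nonneg _]
    congr 1
    refine Finset.sum_congr rfl fun j _ => ?_
    rw [ENNReal.ofReal_pow ENNReal.toReal_nonneg, ENNReal.ofReal_toReal (hfin j)]
    norm_num
  · intro j x
    simp_rw [hF, EE_fderiv ((hh j).mV _) _ t _ (hG j _)]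
    exact EE_div (hh j) t x
  · intro j
    rw [ENNReal.ofReal_toReal (hfin j), show (⇑(F j)) = EE (h j) t from funext (hF j)]
    exact le_self_add
  · intro j i
    simp_rw [EE_fderiv (hh j) i t _ (hF j)]
    rw [hsc, ENNReal.ofReal_mul (by positivity), ENNReal.ofReal_toReal (hfin j)]
    have e : EE (mD i (h j)) t = fun x => (((2 : ℝ) ^ (k₀ + j) : ℝ) : ℂ) *
        EE (fun ξ => (((2 : ℝ) ^ (k₀ + j))⁻¹ : ℝ) * mD i (h j) ξ) t x := by
      ext x
      rw [EE_const_mul, ← mul_assoc, ← Complex.ofReal_mul, mul_inv_cancel₀ (by positivity)]; simp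
    have e' : nQ q (fun x => EE (mD i (h j)) t x) = nQ q (EE (mD i (h j)) t) := rfl
    rw [e', e, nQ_const_mul hq0, ← ofReal_norm, Complex.norm_real, Real.norm_of_nonneg (by positivity)]
    gcongr
    unfold Aq
    refine le_add_left ?_
    refine le_trans ?_ (Finset.single_le_sum (fun i _ => zero_le) (Finset.mem_univ i))
    exact le_self_add
  · intro j i
    rw [show (⇑(G j i)) = EE (mV i (h j)) t from funext (hG j i)]
    rw [hsc, ENNReal.ofReal_mul (by positivity), ENNReal.ofReal_toReal (hfin j)]
    have e : EE (mV i (h j)) t = fun x => ((((2 : ℝ) ^ (k₀ + j))⁻¹ : ℝ) : ℂ) *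
        EE (fun ξ => ((2 : ℝ) ^ (k₀ + j) : ℝ) * mV i (h j) ξ) t x := by
      ext x
      rw [EE_const_mul, ← mul_assoc, ← Complex.ofReal_mul, inv_mul_cancel₀ (by positivity)]; simp
    rw [e, nQ_const_mul hq0, ← ofReal_norm, Complex.norm_real, Real.norm_of_nonneg (by positivity)]
    gcongr
    unfold Aq
    refine le_add_left ?_
    refine le_trans ?_ (Finset.single_le_sum (fun i _ => zero_le) (Finset.mem_univ i))
    exact le_add_self

lemma sum_est {d : ℕ} {p q : ℝ≥0∞} (hadm : Admissible d p q) (hq2 : 2 < q) (hqt : q ≠ ∞) :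
    ∃ C : ℝ≥0∞, C ≠ ∞ ∧ ∀ (k₀ : ℤ) (h : ℕ → Eu d → ℂ), (∀ j : ℕ, Good (k₀ + j) (h j)) → ∀ n : ℕ,
      eLpNorm (fun t => nQ q.toReal (fun x => ∑ j ∈ Finset.range n, EE (h j) t x)) p volume ≤
        C * (∑ j ∈ Finset.range n,
          (ENNReal.ofReal (((2 : ℝ) ^ (k₀ + j)) ^ gammaExp d p q) * nQ 2 (h j)) ^ (2 : ℝ)) ^ (1 / 2 : ℝ) := by
  have hQ2 : 2 < q.toReal := by
    have := (ENNReal.toReal_lt_toReal (by norm_num) hqt).mpr hq2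
    simpa using this
  obtain ⟨C1, hC1, h1⟩ := Aq_bound hadm hq2 hqt
  obtain ⟨C2, hC2, h2⟩ := Aq_besov (d := d) hQ2
  refine ⟨ENNReal.ofReal C2 * C1, by finiteness, fun k₀ h hh n => ?_⟩
  have s1 : eLpNorm (fun t => nQ q.toReal (fun x => ∑ j ∈ Finset.range n, EE (h j) t x)) p volume ≤
      ENNReal.ofReal C2 * eLpNorm (fun t =>
        (∑ j ∈ Finset.range n, Aq q.toReal (k₀ + j) (h j) t ^ (2 : ℝ)) ^ (1 / 2 : ℝ)) p volume := by
    have : ENNReal.ofReal C2 = ((C2.toNNReal : NNReal) : ℝ≥0∞) := rfl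
    rw [this]
    refine eLpNorm_le_nnreal_smul_eLpNorm_of_ae_le_mul' ?_ p
    exact Filter.Eventually.of_forall fun t => h2 k₀ h hh n t
  refine s1.trans ?_
  rw [mul_assoc]
  gcongr
  refine (minkowski_sq hadm.1 _ _ (fun j => Aq_meas (hh j))).trans ?_
  calc _ ≤ (∑ j ∈ Finset.range n,
          (C1 * (ENNReal.ofReal (((2 : ℝ) ^ (k₀ + j)) ^ gammaExp d p q) * nQ 2 (h j))) ^ (2 : ℝ)) ^ (1 / 2 : ℝ) := by
        gcongr with j hj
        exact h1 _ _ (hh j)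
    _ = _ := by
        simp_rw [ENNReal.mul_rpow_of_nonneg C1 _ (by norm_num : (0 : ℝ) ≤ 2)]
        rw [← Finset.mul_sum, ENNReal.mul_rpow_of_nonneg _ _ (by norm_num), ← ENNReal.rpow_mul]
        norm_num

/-- dilated cutoff. -/
noncomputable def cK {d : ℕ} (k : ℤ) (ξ : Eu d) : ℝ := chiB d (((2 : ℝ) ^ (-k)) • ξ)

/-- dyadic partition of unity. -/
noncomputable def psiK {d : ℕ} (k : ℤ) (ξ : Eu d) : ℝ := cK k ξ - cK (k - 1) ξ

lemma cK_smooth {d : ℕ} (k : ℤ) : ContDiff ℝ (⊤ : ℕ∞) (cK (d := d) k) :=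
  chiB_smooth.comp (contDiff_const_smul _)

lemma cK_one {d : ℕ} {k : ℤ} {ξ : Eu d} (h : ‖ξ‖ ≤ 2 ^ k) : cK k ξ = 1 := by
  apply chiB_one
  have hk : (0 : ℝ) < 2 ^ k := by positivity
  rw [norm_smul, Real.norm_of_nonneg (by positivity), zpow_neg, inv_mul_le_iff₀ hk]; linarith

lemma cK_zero {d : ℕ} {k : ℤ} {ξ : Eu d} (h : 2 ^ (k + 1) ≤ ‖ξ‖) : cK k ξ = 0 := by
  apply chiB_zero
  have hk : (0 : ℝ) < 2 ^ k := by positivity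
  rw [zpow_add₀ (by norm_num), zpow_one] at h
  rw [norm_smul, Real.norm_of_nonneg (by positivity), zpow_neg, le_inv_mul_iff₀ hk]; exact h

lemma cK_nonneg {d : ℕ} (k : ℤ) (ξ : Eu d) : 0 ≤ cK k ξ := (chiB d).nonneg
lemma cK_le_one {d : ℕ} (k : ℤ) (ξ : Eu d) : cK k ξ ≤ 1 := (chiB d).le_one

lemma psiK_nonneg {d : ℕ} (k : ℤ) (ξ : Eu d) : 0 ≤ psiK k ξ := by
  unfold psiK
  rcases le_total ‖ξ‖ (2 ^ k) with h | h
  · rw [cK_one h]; linarith [cK_le_one (k - 1) ξ]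
  · rw [cK_zero (k := k - 1) (by simpa using h)]; linarith [cK_nonneg k ξ]

lemma psiK_le_one {d : ℕ} (k : ℤ) (ξ : Eu d) : psiK k ξ ≤ 1 := by
  unfold psiK; linarith [cK_le_one k ξ, cK_nonneg (k - 1) ξ]

lemma psiK_supp {d : ℕ} {k : ℤ} {ξ : Eu d} (h : psiK k ξ ≠ 0) :
    (2 : ℝ) ^ (k - 1) ≤ ‖ξ‖ ∧ ‖ξ‖ ≤ 2 ^ (k + 1) := by
  constructor
  · by_contra hc
    push Not at hc
    apply h
    unfold psiK
    rw [cK_one hc.le, cK_one (hc.le.trans (zpow_le_zpow_right₀ (by norm_num) (by linarith))), sub_self]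
  · by_contra hc
    push Not at hc
    apply h
    unfold psiK
    rw [cK_zero hc.le, cK_zero (le_trans (zpow_le_zpow_right₀ (by norm_num) (by linarith)) hc.le), sub_self]

lemma psiK_sum {d : ℕ} (k₀ : ℤ) (n : ℕ) (ξ : Eu d) :
    ∑ j ∈ Finset.range n, psiK (k₀ + j) ξ = cK (k₀ + n - 1) ξ - cK (k₀ - 1) ξ := by
  have := Finset.sum_range_sub (fun j : ℕ => cK (k₀ + j - 1) ξ) n
  simp only [Nat.cast_zero, add_zero] at this
  rw [← this]
  refine Finset.sum_congr rfl fun j _ => ?_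
  unfold psiK
  congr 2
  push_cast; ring

/-- truncated partition of unity. -/
noncomputable def mN {d : ℕ} (N : ℕ) (ξ : Eu d) : ℝ := ∑ j ∈ Finset.range (2 * N), psiK (-(N : ℤ) + j) ξ

lemma mN_nonneg {d : ℕ} (N : ℕ) (ξ : Eu d) : 0 ≤ mN N ξ := Finset.sum_nonneg fun j _ => psiK_nonneg _ _

lemma mN_le_one {d : ℕ} (N : ℕ) (ξ : Eu d) : mN N ξ ≤ 1 := by
  unfold mN
  rw [psiK_sum]
  linarith [cK_le_one (-(N : ℤ) + (2 * N : ℕ) - 1) ξ, cK_nonneg (-(N : ℤ) - 1) ξ]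

lemma mN_eq {d : ℕ} (N : ℕ) (ξ : Eu d) : mN N ξ = cK ((N : ℤ) - 1) ξ - cK (-(N : ℤ) - 1) ξ := by
  unfold mN
  rw [psiK_sum]
  congr 2
  push_cast; ring

lemma mN_tendsto {d : ℕ} {ξ : Eu d} (hξ : ξ ≠ 0) :
    Filter.Tendsto (fun N => mN N ξ) Filter.atTop (nhds 1) := by
  apply tendsto_const_nhds.congr'
  have hn : 0 < ‖ξ‖ := norm_pos_iff.mpr hξ
  obtain ⟨A, hA⟩ := pow_unbounded_of_one_lt (‖ξ‖) (one_lt_two)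
  obtain ⟨B, hB⟩ := pow_unbounded_of_one_lt (‖ξ‖⁻¹) (one_lt_two)
  filter_upwards [Filter.eventually_ge_atTop (A + B + 1)] with N hN
  rw [mN_eq, cK_one, cK_zero, sub_zero]
  · have e : -(N : ℤ) - 1 + 1 = -(N : ℤ) := by ring
    rw [e, zpow_neg, zpow_natCast, inv_le_comm₀ (by positivity) hn]
    exact hB.le.trans (pow_le_pow_right₀ (by norm_num) (by omega))
  · refine hA.le.trans ?_
    rw [← zpow_natCast]
    exact zpow_le_zpow_right₀ (by norm_num) (by omega)

lemma good_psi {d : ℕ} (k : ℤ) (u : 𝓢(Eu d, ℂ)) : Good k (fun ξ => (psiK k ξ : ℂ) * u ξ) := by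
  refine ⟨?_, fun ξ h => psiK_supp fun h0 => h (by simp [h0])⟩
  have h1 : ContDiff ℝ (⊤ : ℕ∞) (psiK (d := d) k) := (cK_smooth k).sub (cK_smooth (k - 1))
  have h2 : ContDiff ℝ (⊤ : ℕ∞) fun ξ : Eu d => ((psiK k ξ : ℝ) : ℂ) := Complex.ofRealCLM.contDiff.comp h1
  exact h2.mul (u.smooth ⊤)

lemma EE_sum {d : ℕ} (N : ℕ) (u : 𝓢(Eu d, ℂ)) (t : ℝ) (x : Eu d) :
    EE (fun ξ => (mN N ξ : ℂ) * u ξ) t x =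
      ∑ j ∈ Finset.range (2 * N), EE (fun ξ => (psiK (-(N : ℤ) + j) ξ : ℂ) * u ξ) t x := by
  unfold EE
  rw [← integral_finsetSum]
  · congr 1; ext ξ
    unfold mN
    push_cast
    rw [Finset.sum_mul, Finset.mul_sum]
  · intro j _
    refine (good_psi _ u).integrable.bdd_mul (c := 1) ?_ ?_
    · have : Continuous fun ξ => Complex.exp ((thetaP t x ξ : ℝ) * I) := by
        have := thetaP_cont t x
        fun_prop
      exact this.aestronglyMeasurable
    · exact Filter.Eventually.of_forall fun ξ => (Complex.norm_exp_ofReal_mul_I _).le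

lemma mN_smooth {d : ℕ} (N : ℕ) : ContDiff ℝ (⊤ : ℕ∞) (mN (d := d) N) := by
  have : mN (d := d) N = fun ξ => cK ((N : ℤ) - 1) ξ - cK (-(N : ℤ) - 1) ξ := funext (mN_eq N)
  rw [this]
  exact (cK_smooth _).sub (cK_smooth _)

lemma mN_cont {d : ℕ} (N : ℕ) (u : 𝓢(Eu d, ℂ)) :
    ContDiff ℝ (⊤ : ℕ∞) (fun ξ : Eu d => (mN N ξ : ℂ) * u ξ) := by
  have h2 : ContDiff ℝ (⊤ : ℕ∞) fun ξ : Eu d => ((mN N ξ : ℝ) : ℂ) := Complex.ofRealCLM.contDiff.comp (mN_smooth N)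
  exact h2.mul (u.smooth ⊤)

lemma mN_hcs {d : ℕ} (N : ℕ) (u : 𝓢(Eu d, ℂ)) :
    HasCompactSupport (fun ξ : Eu d => (mN N ξ : ℂ) * u ξ) := by
  apply HasCompactSupport.intro (isCompact_closedBall (0 : Eu d) ((2 : ℝ) ^ (N : ℤ)))
  intro x hx
  have hx' : (2 : ℝ) ^ (N : ℤ) ≤ ‖x‖ := by
    have : (2 : ℝ) ^ (N : ℤ) < ‖x‖ := by simpa using hx
    exact this.le
  have : mN N x = 0 := by
    rw [mN_eq, cK_zero (by simpa using hx'), cK_zero, sub_self]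
    refine le_trans (zpow_le_zpow_right₀ (by norm_num) ?_) hx'
    omega
  simp [this]

lemma ne_zero_ae {d : ℕ} (hd : 1 ≤ d) : ∀ᵐ ξ : Eu d, ξ ≠ 0 := by
  haveI : Nonempty (Fin d) := ⟨⟨0, hd⟩⟩
  haveI : Nontrivial (Eu d) := inferInstance
  exact Measure.ae_ne volume 0

lemma EE_lim {d : ℕ} (hd : 1 ≤ d) (u : 𝓢(Eu d, ℂ)) (t : ℝ) (x : Eu d) :
    Filter.Tendsto (fun N => EE (fun ξ => (mN N ξ : ℂ) * u ξ) t x) Filter.atTop (nhds (EE u t x)) := by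
  unfold EE
  have hc : Continuous fun ξ => Complex.exp ((thetaP t x ξ : ℝ) * I) := by
    have := thetaP_cont t x
    fun_prop
  refine tendsto_integral_of_dominated_convergence (fun ξ => ‖u ξ‖) ?_ u.integrable.norm ?_ ?_
  · intro N
    exact (hc.mul (mN_cont N u).continuous).aestronglyMeasurable
  · intro N
    refine Filter.Eventually.of_forall fun ξ => ?_
    rw [norm_mul, Complex.norm_exp_ofReal_mul_I, one_mul, norm_mul, Complex.norm_real,
      Real.norm_of_nonneg (mN_nonneg N ξ)]
    exact mul_le_of_le_one_left (norm_nonneg _) (mN_le_one N ξ)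
  · filter_upwards [ne_zero_ae hd] with ξ hξ
    have h1 := ((Complex.continuous_ofReal.tendsto 1).comp (mN_tendsto hξ)).mul_const (u ξ)
    have h2 := h1.const_mul (Complex.exp ((thetaP t x ξ : ℝ) * I))
    simpa using h2

lemma nQ_eq {d : ℕ} {q : ℝ≥0∞} (h0 : q ≠ 0) (ht : q ≠ ∞) (f : Eu d → ℂ) :
    eLpNorm f q volume = nQ q.toReal f := by
  rw [eLpNorm_eq_lintegral_rpow_enorm_toReal h0 ht]; rfl

lemma nQ_fatou {d : ℕ} (hd : 1 ≤ d) {q : ℝ≥0∞} (h0 : q ≠ 0) (ht : q ≠ ∞) (u : 𝓢(Eu d, ℂ)) (t : ℝ) :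
    nQ q.toReal (EE u t) ≤ Filter.liminf (fun N => nQ q.toReal (EE (fun ξ => (mN N ξ : ℂ) * u ξ) t)) Filter.atTop := by
  simp_rw [← nQ_eq h0 ht]
  refine Lp.eLpNorm_lim_le_liminf_eLpNorm ?_ _ (Filter.Eventually.of_forall fun x => EE_lim hd u t x)
  intro N
  have := EE_cont ((mN_cont N u).continuous.integrable_of_hasCompactSupport (mN_hcs N u))
  exact (this.comp (Continuous.prodMk_right t)).aestronglyMeasurable

lemma fatou_time {p : ℝ≥0∞} (hp : p ≠ 0) {b : ℝ → ℝ≥0∞} {c : ℕ → ℝ → ℝ≥0∞} (hc : ∀ N, Measurable (c N))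
    (hb : ∀ t, b t ≤ Filter.liminf (fun N => c N t) Filter.atTop) {B : ℝ≥0∞}
    (hB : ∀ N, eLpNorm (c N) p volume ≤ B) : eLpNorm b p volume ≤ B := by
  by_cases hpt : p = ∞
  · subst hpt
    simp_rw [eLpNorm_exponent_top] at hB ⊢
    refine essSup_le_of_ae_le _ ?_
    have h1 : ∀ᵐ t : ℝ, ∀ N, c N t ≤ B := by
      rw [ae_all_iff]
      intro N
      filter_upwards [ae_le_essSup (f := fun t => ‖c N t‖ₑ)] with t h2
      exact h2.trans (hB N)
    filter_upwards [h1] with t h2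
    refine (hb t).trans ?_
    exact Filter.liminf_le_of_frequently_le' (Filter.Frequently.of_forall h2)
  · have hp0 : 0 < p.toReal := ENNReal.toReal_pos hp hpt
    have e : ∀ g : ℝ → ℝ≥0∞, eLpNorm g p volume ≤ B ↔ ∫⁻ t, g t ^ p.toReal ≤ B ^ p.toReal := by
      intro g
      rw [eLpNorm_eq_lintegral_rpow_enorm_toReal hp hpt, one_div, ENNReal.rpow_inv_le_iff hp0]
      rfl
    rw [e]
    simp_rw [e] at hB
    calc ∫⁻ t, b t ^ p.toReal ≤ ∫⁻ t, Filter.liminf (fun N => c N t ^ p.toReal) Filter.atTop := by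
          refine lintegral_mono fun t => ?_
          refine (ENNReal.rpow_le_rpow (hb t) hp0.le).trans (le_of_eq ?_)
          have := (ENNReal.orderIsoRpow p.toReal hp0).liminf_apply (f := Filter.atTop) (u := fun N => c N t)
          simpa using this
      _ ≤ Filter.liminf (fun N => ∫⁻ t, c N t ^ p.toReal) Filter.atTop :=
          lintegral_liminf_le fun N => (hc N).pow_const _
      _ ≤ _ := Filter.liminf_le_of_frequently_le' (Filter.Frequently.of_forall hB)

lemma dyadic_comp {r s g : ℝ} (hr : 0 < r) (hs : 0 < s) (h1 : r ≤ 2 * s) (h2 : s ≤ 2 * r) :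
    r ^ g ≤ 2 ^ |g| * s ^ g := by
  rcases le_total 0 g with hg | hg
  · rw [abs_of_nonneg hg, ← Real.mul_rpow (by norm_num) hs.le]
    exact Real.rpow_le_rpow hr.le h1 hg
  · rw [abs_of_nonpos hg]
    have e : (2 : ℝ) ^ (-g) * s ^ g = (s / 2) ^ g := by
      rw [Real.div_rpow hs.le (by norm_num), Real.rpow_neg (by norm_num)]; field_simp
    rw [e]
    exact Real.rpow_le_rpow_of_nonpos (by positivity) (by linarith) hg

/-- the homogeneous Sobolev norm on the Fourier side. -/
noncomputable def hsN {d : ℕ} (γ : ℝ) (u : Eu d → ℂ) : ℝ≥0∞ :=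
  (∫⁻ ξ : Eu d, (‖ξ‖₊ : ℝ≥0∞) ^ (2 * γ) * (‖u ξ‖₊ : ℝ≥0∞) ^ (2 : ℝ)) ^ ((1 : ℝ) / 2)

lemma dyadic_pt {d : ℕ} (γ : ℝ) (k : ℤ) (u : Eu d → ℂ) (ξ : Eu d) :
    ENNReal.ofReal (((2 : ℝ) ^ k) ^ γ) ^ (2 : ℝ) * ‖(psiK k ξ : ℂ) * u ξ‖ₑ ^ (2 : ℝ) ≤
      ENNReal.ofReal (2 ^ |γ|) ^ (2 : ℝ) * (ENNReal.ofReal (psiK k ξ) *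
        ((‖ξ‖₊ : ℝ≥0∞) ^ (2 * γ) * (‖u ξ‖₊ : ℝ≥0∞) ^ (2 : ℝ))) := by
  by_cases h0 : psiK k ξ = 0
  · simp [h0]
  obtain ⟨h1, h2⟩ := psiK_supp h0
  have hk : (0 : ℝ) < 2 ^ k := by positivity
  have hn : 0 < ‖ξ‖ := lt_of_lt_of_le (by positivity) h1
  rw [zpow_sub₀ (by norm_num), zpow_one] at h1
  rw [zpow_add₀ (by norm_num), zpow_one] at h2
  have hc := dyadic_comp (g := γ) hk hn (by linarith) (by linarith)
  have e1 : (‖ξ‖₊ : ℝ≥0∞) ^ (2 * γ) = ENNReal.ofReal (‖ξ‖ ^ γ) ^ (2 : ℝ) := by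
    rw [← enorm_eq_nnnorm, ← ofReal_norm, ENNReal.ofReal_rpow_of_pos hn,
      ENNReal.ofReal_rpow_of_nonneg (by positivity) (by norm_num), ← Real.rpow_mul hn.le, mul_comm]
  have e2 : ‖(psiK k ξ : ℂ)‖ₑ = ENNReal.ofReal (psiK k ξ) := by
    rw [← ofReal_norm, Complex.norm_real, Real.norm_of_nonneg (psiK_nonneg _ _)]
  have e3 : ENNReal.ofReal (psiK k ξ) ^ (2 : ℝ) ≤ ENNReal.ofReal (psiK k ξ) := by
    have h3 : ENNReal.ofReal (psiK k ξ) ≤ 1 := by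
      rw [← ENNReal.ofReal_one]; exact ENNReal.ofReal_le_ofReal (psiK_le_one _ _)
    calc _ ≤ ENNReal.ofReal (psiK k ξ) ^ (1 : ℝ) := ENNReal.rpow_le_rpow_of_exponent_ge h3 (by norm_num)
      _ = _ := ENNReal.rpow_one _
  have e4 : ENNReal.ofReal (((2 : ℝ) ^ k) ^ γ) ^ (2 : ℝ) ≤
      ENNReal.ofReal (2 ^ |γ|) ^ (2 : ℝ) * ENNReal.ofReal (‖ξ‖ ^ γ) ^ (2 : ℝ) := by
    rw [← ENNReal.mul_rpow_of_nonneg _ _ (by norm_num), ← ENNReal.ofReal_mul (by positivity)]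
    exact ENNReal.rpow_le_rpow (ENNReal.ofReal_le_ofReal hc) (by norm_num)
  rw [enorm_mul, ENNReal.mul_rpow_of_nonneg _ _ (by norm_num), e1, e2, ← enorm_eq_nnnorm]
  calc _ ≤ (ENNReal.ofReal (2 ^ |γ|) ^ (2 : ℝ) * ENNReal.ofReal (‖ξ‖ ^ γ) ^ (2 : ℝ)) *
        (ENNReal.ofReal (psiK k ξ) * ‖u ξ‖ₑ ^ (2 : ℝ)) := by gcongr
    _ = _ := by ring

lemma dyadic_sum {d : ℕ} (γ : ℝ) (u : 𝓢(Eu d, ℂ)) (N : ℕ) :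
    (∑ j ∈ Finset.range (2 * N), (ENNReal.ofReal (((2 : ℝ) ^ (-(N : ℤ) + j)) ^ γ) *
      nQ 2 (fun ξ => (psiK (-(N : ℤ) + j) ξ : ℂ) * u ξ)) ^ (2 : ℝ)) ^ (1 / 2 : ℝ) ≤
      ENNReal.ofReal (2 ^ |γ|) * hsN γ u := by
  have e : ENNReal.ofReal (2 ^ |γ|) = (ENNReal.ofReal (2 ^ |γ|) ^ (2 : ℝ)) ^ (1 / 2 : ℝ) := by
    rw [← ENNReal.rpow_mul]; norm_num
  rw [e]
  unfold hsN
  rw [← ENNReal.mul_rpow_of_nonneg _ _ (by norm_num)]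
  refine ENNReal.rpow_le_rpow ?_ (by norm_num)
  have m : ∀ k : ℤ, Measurable fun ξ : Eu d => ‖(psiK k ξ : ℂ) * u ξ‖ₑ ^ (2 : ℝ) := fun k =>
    ((good_psi k u).1.continuous.measurable.enorm).pow_const _
  have e1 : ∀ k : ℤ, (ENNReal.ofReal (((2 : ℝ) ^ k) ^ γ) * nQ 2 (fun ξ => (psiK k ξ : ℂ) * u ξ)) ^ (2 : ℝ) =
      ∫⁻ ξ, ENNReal.ofReal (((2 : ℝ) ^ k) ^ γ) ^ (2 : ℝ) * ‖(psiK k ξ : ℂ) * u ξ‖ₑ ^ (2 : ℝ) := by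
    intro k
    rw [ENNReal.mul_rpow_of_nonneg _ _ (by norm_num), lintegral_const_mul _ (m k)]
    unfold nQ
    rw [← ENNReal.rpow_mul]; norm_num
  simp_rw [e1]
  rw [← lintegral_finsetSum _ fun j _ => (m _).const_mul _, ← lintegral_const_mul' _ _ (by finiteness)]
  refine lintegral_mono fun ξ => ?_
  refine (Finset.sum_le_sum fun (j : ℕ) _ => dyadic_pt γ (-(N : ℤ) + j) u ξ).trans ?_
  rw [← Finset.mul_sum, ← Finset.sum_mul, ← ENNReal.ofReal_sum_of_nonneg fun j _ => psiK_nonneg _ _]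
  refine mul_le_mul_right ?_ _
  have h1 : ENNReal.ofReal (∑ j ∈ Finset.range (2 * N), psiK (-(N : ℤ) + j) ξ) ≤ 1 := by
    rw [← ENNReal.ofReal_one]; exact ENNReal.ofReal_le_ofReal (mN_le_one N ξ)
  exact mul_le_of_le_one_left zero_le h1

lemma main_red {d : ℕ} {p q : ℝ≥0∞} (hadm : Admissible d p q) (hqt : q ≠ ∞) :
    ∃ C : ℝ≥0∞, C ≠ ∞ ∧ ∀ (N : ℕ) (u : 𝓢(Eu d, ℂ)),
      eLpNorm (fun t => nQ q.toReal (EE (fun ξ => (mN N ξ : ℂ) * u ξ) t)) p volume ≤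
        C * hsN (gammaExp d p q) u := by
  rcases lt_or_eq_of_le hadm.2.1 with hq2 | hq2
  · obtain ⟨C, hC, h⟩ := sum_est hadm hq2 hqt
    refine ⟨C * ENNReal.ofReal (2 ^ |gammaExp d p q|), by finiteness, fun N u => ?_⟩
    have := h (-(N : ℤ)) (fun j ξ => (psiK (-(N : ℤ) + j) ξ : ℂ) * u ξ) (fun j => good_psi _ u) (2 * N)
    simp_rw [← EE_sum] at this
    refine this.trans ?_
    rw [mul_assoc]
    gcongr
    exact dyadic_sum _ u N
  · subst hq2
    have hp : p = ∞ := by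
      have h1 := hadm.2.2.2
      have h2 : (2 : ℝ≥0∞) / p ≤ 0 := by
        have hf : (d : ℝ≥0∞) / 2 ≠ ∞ := by finiteness
        rw [add_comm] at h1
        nth_rewrite 2 [← add_zero ((d : ℝ≥0∞) / 2)] at h1
        exact (ENNReal.add_le_add_iff_left hf).mp h1
      have h3 := le_antisymm h2 zero_le
      rcases ENNReal.div_eq_zero_iff.mp h3 with h | h
      · norm_num at h
      · exact h
    subst hp
    refine ⟨1, by norm_num, fun N u => ?_⟩
    have hg : gammaExp d ∞ 2 = 0 := by simp [gammaExp]
    rw [hg, one_mul, eLpNorm_exponent_top]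
    refine essSup_le_of_ae_le _ (Filter.Eventually.of_forall fun t => ?_)
    have e2 : (2 : ℝ≥0∞).toReal = 2 := by norm_num
    simp only [e2, enorm_eq_self]
    rw [EE_plancherel (mN_cont N u) (mN_hcs N u)]
    unfold nQ hsN
    gcongr with ξ
    rw [mul_zero, ENNReal.rpow_zero, one_mul, ← enorm_eq_nnnorm, enorm_mul]
    gcongr
    have : ‖(mN N ξ : ℂ)‖ₑ ≤ 1 := by
      rw [← ofReal_norm, Complex.norm_real, Real.norm_of_nonneg (mN_nonneg _ _), ← ENNReal.ofReal_one]
      exact ENNReal.ofReal_le_ofReal (mN_le_one N ξ)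
    exact mul_le_of_le_one_left zero_le this

lemma prop4_eq {d : ℕ} (t : ℝ) (u₀ : 𝓢(Eu d, ℂ)) : prop4 t ⇑u₀ = EE (⇑(𝓕 u₀ : 𝓢(Eu d, ℂ))) t := by
  ext x
  unfold prop4 EE
  congr 1; ext ξ
  rw [SchwartzMap.fourier_coe, ← Complex.exp_add]
  congr 2
  unfold thetaP
  push_cast; ring

theorem stmt3 (d : ℕ) (hd : 1 ≤ d) (p q : ℝ≥0∞) (hpq : Admissible d p q) (hq : q ≠ ∞) :
    ∃ C > (0 : ℝ), ∀ u₀ : 𝓢(EuclideanSpace ℝ (Fin d), ℂ),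
      mixedLp p q Set.univ (fun t => prop4 t ⇑u₀) ≤
        ENNReal.ofReal C * homSobNorm (gammaExp d p q) ⇑u₀ := by
  obtain ⟨C, hC, h⟩ := main_red hpq hq
  have hp0 : p ≠ 0 := by
    intro h0; have := hpq.1; simp [h0] at this
  have hq0 : q ≠ 0 := by
    intro h0; have := hpq.2.1; simp [h0] at this
  refine ⟨C.toReal + 1, by positivity, fun u₀ => ?_⟩
  unfold mixedLp
  simp_rw [nQ_eq hq0 hq, prop4_eq]
  rw [timeLp_eq hp0]
  have hs : homSobNorm (gammaExp d p q) ⇑u₀ = hsN (gammaExp d p q) (⇑(𝓕 u₀ : 𝓢(Eu d, ℂ))) := by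
    unfold homSobNorm hsN
    rw [SchwartzMap.fourier_coe]
  rw [hs]
  refine le_trans (b := C * hsN (gammaExp d p q) (⇑(𝓕 u₀ : 𝓢(Eu d, ℂ)))) ?_ ?_
  · refine fatou_time hp0 (c := fun N t => nQ q.toReal (EE (fun ξ => (mN N ξ : ℂ) * (𝓕 u₀ : 𝓢(Eu d, ℂ)) ξ) t)) ?_ ?_ (fun N => h N (𝓕 u₀))
    · intro N
      exact nQ_meas ((mN_cont N _).continuous.integrable_of_hasCompactSupport (mN_hcs N _)) _
    · intro t
      exact nQ_fatou hd hq0 hq (𝓕 u₀) t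
  · gcongr
    rw [ENNReal.le_ofReal_iff_toReal_le hC (by positivity)]
    linarith
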